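/- arXiv:0804.1388 — 2 statements merged into one kernel-verified Lean document; each statement's English description precedes it below -/
import Mathlib

section
/- Let 𝒩 be a nest on a separable complex Hilbert space H. Then the following are equivalent: (i) for every n ≥ 2 and every row (A_1,…,A_n) ∈ T(𝒩)^n with a right inverse column (C_1,…,C_n) ∈ T(𝒩)^n (i.e. ∑_{i=1}^n A_i C_i = I), there is a matrix W ∈ M_n(T(𝒩)), invertible with inverse in M_n(T(𝒩)), whose first row is (A_1,…,A_n) and such that the first column of W^{-1} is (C_1,…,C_n); (ii) every atom of 𝒩 is finite-dimensional, and every non-empty interval of 𝒩 contains an atom, i.e. for all M ⊊ N in 𝒩 there exist M', N' ∈ 𝒩 with M ⊆ M' ⊊ N' ⊆ N and no element of 𝒩 strictly between M' and N'. -/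
/-- A *nest* on a Hilbert space `H`: a family of closed subspaces, totally
ordered by inclusion, containing `{0}` and `H`, closed under arbitrary
intersections and under closed linear spans of subfamilies. -/
structure IsNest {H : Type*} [NormedAddCommGroup H] [InnerProductSpace ℂ H]
    (𝒩 : Set (Submodule ℂ H)) : Prop where
  closed : ∀ N ∈ 𝒩, IsClosed (N : Set H)
  chain : IsChain (· ≤ ·) 𝒩
  bot_mem : (⊥ : Submodule ℂ H) ∈ 𝒩
  top_mem : (⊤ : Submodule ℂ H) ∈ 𝒩
  sInf_mem : ∀ S ⊆ 𝒩, S.Nonempty → sInf S ∈ 𝒩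
  closure_sSup_mem : ∀ S ⊆ 𝒩, S.Nonempty → (sSup S).topologicalClosure ∈ 𝒩

/-- The nest algebra `T(𝒩)` of all bounded operators leaving each element of
the nest invariant. -/
def nestAlg {H : Type*} [NormedAddCommGroup H] [InnerProductSpace ℂ H]
    (𝒩 : Set (Submodule ℂ H)) : Set (H →L[ℂ] H) :=
  {T | ∀ N ∈ 𝒩, ∀ x ∈ N, T x ∈ N}

open Filter Topology

section Projection

variable {X : Type*} [NormedAddCommGroup X] [InnerProductSpace ℂ X]

lemma starProjection_starProjection_of_le {K L : Submodule ℂ X} [K.HasOrthogonalProjection]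
    [L.HasOrthogonalProjection] (h : K ≤ L) (x : X) :
    K.starProjection (L.starProjection x) = K.starProjection x :=
  congrArg (· x) (Submodule.starProjection_comp_starProjection_of_le h)

lemma starProjection_starProjection_of_ge {K L : Submodule ℂ X} [K.HasOrthogonalProjection]
    [L.HasOrthogonalProjection] (h : K ≤ L) (x : X) :
    L.starProjection (K.starProjection x) = K.starProjection x :=
  Submodule.starProjection_eq_self_iff.2 (h (K.starProjection_apply_mem x))

lemma norm_sq_starProjection_sub {K L : Submodule ℂ X} [K.HasOrthogonalProjection]
    [L.HasOrthogonalProjection] (h : K ≤ L) (x : X) :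
    ‖L.starProjection x - K.starProjection x‖ ^ 2 =
      ‖L.starProjection x‖ ^ 2 - ‖K.starProjection x‖ ^ 2 := by
  have := Submodule.norm_sq_eq_add_norm_sq_starProjection (L.starProjection x) K
  rw [Submodule.starProjection_orthogonal_val, starProjection_starProjection_of_le h] at this
  linarith

lemma norm_starProjection_mono {K L : Submodule ℂ X} [K.HasOrthogonalProjection]
    [L.HasOrthogonalProjection] (h : K ≤ L) (x : X) :
    ‖K.starProjection x‖ ^ 2 ≤ ‖L.starProjection x‖ ^ 2 := by
  have := norm_sq_starProjection_sub h x
  nlinarith [sq_nonneg ‖L.starProjection x - K.starProjection x‖]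

end Projection

/-- A nest on `X` presented as a family of closed subspaces indexed by a linear order. -/
structure NestFamily {X ι : Type*} [NormedAddCommGroup X] [InnerProductSpace ℂ X]
    [LinearOrder ι] (p : ι → Submodule ℂ X) : Prop where
  closed : ∀ i, IsClosed (p i : Set X)
  mono : Monotone p
  exists_bot : ∃ i, p i = ⊥
  exists_top : ∃ i, p i = ⊤
  sup : ∀ S : Set ι, S.Nonempty → ∃ t, IsLUB S t ∧ p t ≤ (⨆ i : S, p i).topologicalClosure
  inf : ∀ S : Set ι, S.Nonempty → ∃ t, IsGLB S t ∧ ⨅ i : S, p i ≤ p t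

namespace NestFamily

variable {X ι : Type*} [NormedAddCommGroup X] [InnerProductSpace ℂ X] [LinearOrder ι]
  {p : ι → Submodule ℂ X}

lemma exists_isLeast (hp : NestFamily p) : ∃ b, (∀ i, b ≤ i) ∧ p b = ⊥ := by
  obtain ⟨j, hj⟩ := hp.exists_bot
  obtain ⟨b, hb, -⟩ := hp.inf Set.univ ⟨j, trivial⟩
  have hb' : ∀ i, b ≤ i := fun i => hb.1 trivial
  exact ⟨b, hb', le_bot_iff.1 ((hp.mono (hb' j)).trans hj.le)⟩

lemma exists_isGreatest (hp : NestFamily p) : ∃ u, (∀ i, i ≤ u) ∧ p u = ⊤ := by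
  obtain ⟨j, hj⟩ := hp.exists_top
  obtain ⟨u, hu, -⟩ := hp.sup Set.univ ⟨j, trivial⟩
  have hu' : ∀ i, i ≤ u := fun i => hu.1 trivial
  exact ⟨u, hu', top_le_iff.1 (hj.symm.le.trans (hp.mono (hu' j)))⟩

variable [CompleteSpace X]

lemma hasOrthogonalProjection (hp : NestFamily p) (i : ι) : (p i).HasOrthogonalProjection := by
  have : CompleteSpace (p i) := (hp.closed i).completeSpace_coe
  infer_instance

lemma exists_isLUB_tendsto [∀ i, (p i).HasOrthogonalProjection] (hp : NestFamily p)
    (S : Set ι) (hS : S.Nonempty) : ∃ t, IsLUB S t ∧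
      ∀ x, Tendsto (fun i : S => (p i).starProjection x) atTop (𝓝 ((p t).starProjection x)) := by
  obtain ⟨t, ht, htp⟩ := hp.sup S hS
  refine ⟨t, ht, fun x => ?_⟩
  have hU : (⨆ i : S, p i).topologicalClosure = p t :=
    le_antisymm (Submodule.topologicalClosure_minimal _
      (iSup_le fun i => hp.mono (ht.1 i.2)) (hp.closed t)) htp
  have := Submodule.starProjection_tendsto_closure_iSup (fun i : S => p i)
    (fun i j hij => hp.mono hij) x
  convert this
  exact hU.symm

lemma exists_isGLB_tendsto [∀ i, (p i).HasOrthogonalProjection] (hp : NestFamily p)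
    (S : Set ι) (hS : S.Nonempty) : ∃ t, IsGLB S t ∧
      ∀ x, Tendsto (fun i : Sᵒᵈ => (p (OrderDual.ofDual i : S)).starProjection x) atTop
        (𝓝 ((p t).starProjection x)) := by
  obtain ⟨t, ht, htp⟩ := hp.inf S hS
  refine ⟨t, ht, fun x => ?_⟩
  have hU : (⨆ i : Sᵒᵈ, (p (OrderDual.ofDual i : S))ᗮ).topologicalClosure = (p t)ᗮ := by
    rw [← Submodule.orthogonal_orthogonal_eq_closure, ← Submodule.iInf_orthogonal]
    simp only [Submodule.orthogonal_orthogonal]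
    congr 1
    refine le_antisymm ?_ (le_iInf fun i => hp.mono (ht.1 (OrderDual.ofDual i : S).2))
    exact le_trans (le_iInf fun i => iInf_le (fun i : Sᵒᵈ => p (OrderDual.ofDual i : S))
      (OrderDual.toDual i)) htp
  have := Submodule.starProjection_tendsto_closure_iSup
    (fun i : Sᵒᵈ => (p (OrderDual.ofDual i : S))ᗮ)
    (fun i j hij => Submodule.orthogonal_le (hp.mono hij)) x
  simp only [Submodule.starProjection_orthogonal_val] at this
  have h2 := this.const_sub x
  simp only [sub_sub_cancel] at h2
  convert h2 using 2
  have h3 : x - (p t).starProjection x = (p t)ᗮ.starProjection x :=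
    (Submodule.starProjection_orthogonal_val x).symm
  rw [eq_sub_iff_add_eq, ← eq_sub_iff_add_eq', h3]
  congr 1
  congr 1

/-- A nest without atoms attains every intermediate value of the total square norm of the
projections of a finite family of vectors. -/
lemma exists_sum_norm_sq_eq [∀ i, (p i).HasOrthogonalProjection] (hp : NestFamily p)
    (hd : ∀ i j, i ⋖ j → p i = p j) {d : Type*} [Fintype d] (r : d → X) {s : ℝ} (hs : 0 ≤ s)
    (hs' : s ≤ ∑ k, ‖r k‖ ^ 2) : ∃ i, ∑ k, ‖(p i).starProjection (r k)‖ ^ 2 = s := by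
  set f : ι → ℝ := fun i => ∑ k, ‖(p i).starProjection (r k)‖ ^ 2 with hf
  have hfm : Monotone f := fun i j hij =>
    Finset.sum_le_sum fun k _ => norm_starProjection_mono (hp.mono hij) _
  obtain ⟨b, hb⟩ := hp.exists_bot
  obtain ⟨u, hu⟩ := hp.exists_top
  have hfb : f b = 0 := by
    simp only [hf]
    refine Finset.sum_eq_zero fun k _ => ?_
    have : (p b).starProjection (r k) = 0 :=
      (Submodule.mem_bot ℂ).1 (hb.le ((p b).starProjection_apply_mem (r k)))
    simp [this]
  have hfu : f u = ∑ k, ‖r k‖ ^ 2 := by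
    simp only [hf]
    refine Finset.sum_congr rfl fun k _ => ?_
    rw [Submodule.starProjection_eq_self_iff.2 (by rw [hu]; trivial)]
  obtain ⟨t₀, ht₀, hT₀⟩ := hp.exists_isLUB_tendsto {i | f i ≤ s} ⟨b, by simpa [hfb] using hs⟩
  obtain ⟨t₁, ht₁, hT₁⟩ := hp.exists_isGLB_tendsto {i | s ≤ f i} ⟨u, by simpa [hfu] using hs'⟩
  have h0 : f t₀ ≤ s := by
    have : Nonempty {i | f i ≤ s} := ⟨⟨b, by simpa [hfb] using hs⟩⟩
    refine le_of_tendsto' (f := fun i : {i | f i ≤ s} => f i) (x := atTop) ?_ (fun i => i.2)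
    exact tendsto_finsetSum _ fun k _ => ((hT₀ (r k)).norm.pow 2)
  have h1 : s ≤ f t₁ := by
    have : Nonempty {i | s ≤ f i}ᵒᵈ := ⟨OrderDual.toDual ⟨u, by simpa [hfu] using hs'⟩⟩
    refine ge_of_tendsto' (f := fun i : {i | s ≤ f i}ᵒᵈ => f (OrderDual.ofDual i : {i | s ≤ f i}))
      (x := atTop) ?_ (fun i => (OrderDual.ofDual i : {i | s ≤ f i}).2)
    exact tendsto_finsetSum _ fun k _ => ((hT₁ (r k)).norm.pow 2)
  rcases le_or_gt t₁ t₀ with h | h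
  · exact ⟨t₁, le_antisymm ((hfm h).trans h0) h1⟩
  · have : t₀ ⋖ t₁ := by
      refine ⟨h, fun c hc hc' => ?_⟩
      rcases le_total (f c) s with h2 | h2
      · exact absurd (ht₀.1 h2) (not_le.2 hc)
      · exact absurd (ht₁.1 h2) (not_le.2 hc')
    have h2 := hd _ _ this
    have h3 : f t₀ = f t₁ := by
      simp only [hf]
      refine Finset.sum_congr rfl fun k _ => ?_
      congr 2
      congr 1
      congr 1
    exact ⟨t₁, le_antisymm (h3.symm.trans_le h0) h1⟩

/-- Finite families of vectors are cut into small pieces by some finite chain of an atomless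
nest. -/
lemma exists_chain_family [∀ i, (p i).HasOrthogonalProjection] (hp : NestFamily p)
    (hd : ∀ i j, i ⋖ j → p i = p j) {d : Type*} [Fintype d] (r : d → X) {ε : ℝ} (hε : 0 < ε) :
    ∃ (n : ℕ) (c : ℕ → ι), Monotone c ∧ (∀ i, c 0 ≤ i) ∧ (∀ i, i ≤ c n) ∧ ∀ k < n, ∀ j,
      ‖(p (c (k + 1))).starProjection (r j) - (p (c k)).starProjection (r j)‖ ≤ ε := by
  set f : ι → ℝ := fun i => ∑ k, ‖(p i).starProjection (r k)‖ ^ 2 with hf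
  set T : ℝ := ∑ k, ‖r k‖ ^ 2 with hT
  have hfm : Monotone f := fun i j hij =>
    Finset.sum_le_sum fun k _ => norm_starProjection_mono (hp.mono hij) _
  have hfT : ∀ i, f i ≤ T := fun i => Finset.sum_le_sum fun k _ =>
    pow_le_pow_left₀ (norm_nonneg _) ((p i).norm_starProjection_apply_le _) 2
  have hf0 : ∀ i, 0 ≤ f i := fun i => Finset.sum_nonneg fun k _ => by positivity
  have hT0 : 0 ≤ T := Finset.sum_nonneg fun k _ => by positivity
  have hstep : ∀ i, ∃ j, i ≤ j ∧ f j = min (f i + ε ^ 2) T := by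
    intro i
    obtain ⟨j, hj⟩ := hp.exists_sum_norm_sq_eq hd r (s := min (f i + ε ^ 2) T)
      (le_min (by nlinarith [hf0 i, sq_nonneg ε]) hT0) (min_le_right _ _)
    have hj : f j = min (f i + ε ^ 2) T := hj
    have hij : f i ≤ f j := by
      rw [hj]; exact le_min (by nlinarith [sq_nonneg ε]) (hfT i)
    refine ⟨max i j, le_max_left _ _, ?_⟩
    rw [hfm.map_max, max_eq_right hij, hj]
  choose g hg hgf using hstep
  obtain ⟨b, hb⟩ := hp.exists_isLeast
  obtain ⟨u, hu', hu⟩ := hp.exists_isGreatest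
  have hub : ∀ i, f i ≤ f u := fun i => by
    refine Finset.sum_le_sum fun k _ => ?_
    rw [Submodule.starProjection_eq_self_iff (K := p u) |>.2 (by rw [hu]; trivial)]
    exact pow_le_pow_left₀ (norm_nonneg _) ((p i).norm_starProjection_apply_le _) 2
  set c₀ : ℕ → ι := fun k => g^[k] b with hc₀
  have hc₀s : ∀ k, c₀ (k + 1) = g (c₀ k) := fun k => Function.iterate_succ_apply' g k b
  have hc₀m : Monotone c₀ := monotone_nat_of_le_succ fun k => by rw [hc₀s]; exact hg _
  have hc₀f : ∀ k : ℕ, min (k * ε ^ 2) T ≤ f (c₀ k) := by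
    intro k
    induction k with
    | zero => simpa using Or.inl (hf0 _)
    | succ k ih =>
      rw [hc₀s, hgf]
      refine le_min ?_ (min_le_right _ _)
      push_cast
      rcases min_le_iff.1 ih with h | h
      · exact (min_le_left _ _).trans (by linarith)
      · exact (min_le_right _ _).trans (by nlinarith [sq_nonneg ε])
  obtain ⟨n, hn⟩ := exists_nat_ge (T / ε ^ 2)
  have hnT : T ≤ f (c₀ n) := by
    refine le_trans (le_min ?_ le_rfl) (hc₀f n)
    rwa [div_le_iff₀ (by positivity)] at hn
  have key : ∀ i j, i ≤ j → f j ≤ f i + ε ^ 2 → ∀ l,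
      ‖(p j).starProjection (r l) - (p i).starProjection (r l)‖ ≤ ε := by
    intro i j hij h l
    refine (sq_le_sq₀ (norm_nonneg _) hε.le).1 ?_
    rw [norm_sq_starProjection_sub (hp.mono hij)]
    have h1 : ∑ k, (‖(p j).starProjection (r k)‖ ^ 2 - ‖(p i).starProjection (r k)‖ ^ 2)
        ≤ ε ^ 2 := by
      rw [Finset.sum_sub_distrib]; simp only [hf] at h; linarith
    exact (Finset.single_le_sum (f := fun k => ‖(p j).starProjection (r k)‖ ^ 2 -
      ‖(p i).starProjection (r k)‖ ^ 2) (fun k _ => sub_nonneg.2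
        (norm_starProjection_mono (hp.mono hij) _)) (Finset.mem_univ l)).trans h1
  refine ⟨n + 1, fun k => if k ≤ n then c₀ k else max u (c₀ n), ?_, ?_, ?_, ?_⟩
  · refine monotone_nat_of_le_succ fun k => ?_
    rcases lt_trichotomy k n with h | h | h
    · simp only [h.le, if_true, Nat.succ_le_of_lt h]; exact hc₀m (Nat.le_succ k)
    · subst h; simp
    · simp [not_le.2 h, not_le.2 (h.trans (Nat.lt_succ_self k))]
  · simpa [hc₀] using hb.1
  · simp only [Nat.add_one_le_iff, lt_irrefl, if_false]
    exact fun i => (hu' i).trans (le_max_left u (c₀ n))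
  · intro k hk
    rw [Nat.lt_succ_iff] at hk
    rcases hk.lt_or_eq with h | h
    · simp only [hk, if_true, Nat.succ_le_of_lt h]
      refine key _ _ (hc₀m (Nat.le_succ k)) ?_
      rw [hc₀s, hgf]; exact min_le_left _ _
    · subst h
      simp only [le_refl, if_true, Nat.add_one_le_iff, lt_irrefl, if_false]
      refine key _ _ (le_max_right _ _) ?_
      exact (hfT _).trans (hnT.trans (by nlinarith [sq_nonneg ε]))

end NestFamily

section Parrott

variable {X : Type*} [NormedAddCommGroup X] [InnerProductSpace ℂ X]

lemma starProjection_comm_of_invariant {K R : Submodule ℂ X} [K.HasOrthogonalProjection]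
    [R.HasOrthogonalProjection] (h : ∀ x ∈ R, K.starProjection x ∈ R) (x : X) :
    R.starProjection (K.starProjection x) = K.starProjection (R.starProjection x) := by
  refine Submodule.eq_starProjection_of_mem_of_inner_eq_zero
    (h _ (R.starProjection_apply_mem x)) fun w hw => ?_
  rw [← map_sub, Submodule.inner_starProjection_left_eq_right]
  exact Submodule.starProjection_inner_eq_zero _ _ (h w hw)

variable [CompleteSpace X]

/-- **Parrott's theorem**, with a little room: an operator can be completed from a column and a
row without essentially increasing the norm. -/
lemma exists_parrott_completion {K M L : Submodule ℂ X} [K.HasOrthogonalProjection]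
    [M.HasOrthogonalProjection] [L.HasOrthogonalProjection] (hKM : K ≤ M) (S T : X →L[ℂ] X)
    {a b : ℝ} (ha : 0 ≤ a) (hab : a < b) (hcol : ∀ z, ‖S (K.starProjection z)‖ ≤ a * ‖z‖)
    (hrow : ∀ z, ‖L.starProjection (T (M.starProjection z))‖ ≤ a * ‖z‖)
    (hcons : ∀ z, L.starProjection (S (K.starProjection z)) =
      L.starProjection (T (K.starProjection z))) :
    ∃ Y : X →L[ℂ] X, (∀ z, ‖Y z‖ ≤ b * ‖z‖) ∧
      (∀ z, Y (K.starProjection z) = S (K.starProjection z)) ∧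
      ∀ z, L.starProjection (Y (M.starProjection z)) = L.starProjection (T (M.starProjection z)) := by
  have hb : 0 < b := ha.trans_lt hab
  set C : X →L[ℂ] X := L.starProjection ∘L S ∘L K.starProjection with hC
  set D : X →L[ℂ] X := L.starProjection ∘L T ∘L (M.starProjection - K.starProjection) with hD
  have hCn : ‖C‖ ≤ a := C.opNorm_le_bound ha fun z =>
    (L.norm_starProjection_apply_le _).trans (hcol z)
  have hunit : IsUnit (1 - ((b ^ 2)⁻¹ : ℂ) • (ContinuousLinearMap.adjoint C ∘L C)) := by
    refine isUnit_one_sub_of_norm_lt_one ?_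
    rw [norm_smul]
    have h1 : ‖ContinuousLinearMap.adjoint C ∘L C‖ ≤ a ^ 2 := by
      refine (ContinuousLinearMap.opNorm_comp_le _ _).trans ?_
      rw [LinearIsometryEquiv.norm_map, sq]
      gcongr
    have h2 : ‖((b ^ 2)⁻¹ : ℂ)‖ = (b ^ 2)⁻¹ := by
      rw [norm_inv, norm_pow, Complex.norm_real, Real.norm_of_nonneg hb.le]
    rw [h2, inv_mul_lt_one₀ (by positivity)]
    nlinarith
  obtain ⟨N, hN⟩ := hunit.exists_right_inv
  set U : X →L[ℂ] X := ((b ^ 2)⁻¹ : ℂ) • (N ∘L ContinuousLinearMap.adjoint C ∘L D) with hU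
  have hCadj : ∀ v, K.starProjection (ContinuousLinearMap.adjoint C v) =
      ContinuousLinearMap.adjoint C v := by
    intro v
    refine ext_inner_right ℂ fun t => ?_
    rw [Submodule.inner_starProjection_left_eq_right, ContinuousLinearMap.adjoint_inner_left,
      ContinuousLinearMap.adjoint_inner_left]
    simp only [hC, ContinuousLinearMap.comp_apply, starProjection_starProjection_of_le le_rfl]
  have hbC : ((b : ℂ) ^ 2) ≠ 0 := by
    exact_mod_cast (pow_pos hb 2).ne'
  have hUeq : ∀ z, ((b : ℂ) ^ 2) • U z = ContinuousLinearMap.adjoint C (C (U z) + D z) := by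
    intro z
    have h1 := congrArg (fun A : X →L[ℂ] X => A (ContinuousLinearMap.adjoint C (D z))) hN
    simp only [mul_apply_eq_comp, sub_apply,
      one_apply_eq_self, smul_apply,
      ContinuousLinearMap.comp_apply] at h1
    have h2 : U z = ((b ^ 2)⁻¹ : ℂ) • N (ContinuousLinearMap.adjoint C (D z)) := rfl
    rw [map_add, ← h1, h2, smul_smul, mul_inv_cancel₀ hbC, one_smul]
    simp
  have hUK : ∀ z, K.starProjection (U z) = U z := by
    intro z
    have h := hCadj (C (U z) + D z)
    rw [← hUeq, map_smul] at h
    exact smul_right_injective X hbC h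
  have hDK : ∀ z, D (K.starProjection z) = 0 := by
    intro z
    simp [hD, starProjection_starProjection_of_ge hKM, starProjection_starProjection_of_le le_rfl]
  refine ⟨S ∘L K.starProjection + D - (S ∘L K.starProjection - C) ∘L U, ?_, ?_, ?_⟩
  · intro z
    set k := K.starProjection z with hk
    set u := U z with hu
    set y := z - k with hy
    set w := k - u with hw
    set v := C u + D z with hv
    have hKk : K.starProjection k = k := starProjection_starProjection_of_le le_rfl z
    have hKw : K.starProjection w = w := by rw [hw, map_sub, hKk, hUK]
    have hY : (S ∘L K.starProjection + D - (S ∘L K.starProjection - C) ∘L U) z =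
        (S w - L.starProjection (S w)) + (C w + v) := by
      have e1 : C u = L.starProjection (S u) := by
        simp only [hC, ContinuousLinearMap.comp_apply]; rw [hUK]
      have e2 : C w = L.starProjection (S w) := by
        simp only [hC, ContinuousLinearMap.comp_apply]; rw [hKw]
      simp only [sub_apply, add_apply,
        ContinuousLinearMap.comp_apply, e2, hv, ← hk, ← hu, e1]
      rw [hUK, hw, map_sub]
      abel
    have hCw : C w = L.starProjection (S w) := by
      simp only [hC, ContinuousLinearMap.comp_apply]; rw [hKw]
    have hmem : C w + v ∈ L := by
      refine L.add_mem (L.starProjection_apply_mem _) (L.add_mem (L.starProjection_apply_mem _)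
        (L.starProjection_apply_mem _))
    have h1 : ‖(S w - L.starProjection (S w)) + (C w + v)‖ ^ 2 =
        ‖S w - L.starProjection (S w)‖ ^ 2 + ‖C w + v‖ ^ 2 := by
      rw [sq, sq, sq]
      exact norm_add_sq_eq_norm_sq_add_norm_sq_of_inner_eq_zero _ _
        (Submodule.starProjection_inner_eq_zero _ _ hmem)
    have h2 : ‖S w - L.starProjection (S w)‖ ^ 2 + ‖C w‖ ^ 2 ≤ b ^ 2 * ‖w‖ ^ 2 := by
      have e := Submodule.norm_sq_eq_add_norm_sq_starProjection (S w) L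
      rw [Submodule.starProjection_orthogonal_val] at e
      have e' := hcol w
      rw [hKw] at e'
      have e2 : ‖S w‖ ^ 2 ≤ (b * ‖w‖) ^ 2 := by
        gcongr
        exact e'.trans (by gcongr)
      rw [hCw]
      nlinarith
    have h3 : ‖C w + v‖ ^ 2 = ‖C w‖ ^ 2 + 2 * (b ^ 2 * (inner ℂ w u).re) + ‖v‖ ^ 2 := by
      rw [norm_add_sq (𝕜 := ℂ)]
      have : inner ℂ (C w) v = ((b : ℂ) ^ 2) * inner ℂ w u := by
        rw [← ContinuousLinearMap.adjoint_inner_right, hv, ← hUeq, inner_smul_right]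
      rw [this]
      have e : RCLike.re ((b : ℂ) ^ 2 * inner ℂ w u) = b ^ 2 * (inner ℂ w u).re := by
        rw [← Complex.ofReal_pow]; exact Complex.re_ofReal_mul _ _
      rw [e]
    have h4 : ‖k‖ ^ 2 = ‖w‖ ^ 2 + 2 * (inner ℂ w u).re + ‖u‖ ^ 2 := by
      have := norm_add_sq (𝕜 := ℂ) w u
      rw [hw, sub_add_cancel] at this
      exact this
    have horth : ∀ t, K.starProjection t = t → inner ℂ t y = 0 := by
      intro t ht
      rw [← ht, Submodule.inner_starProjection_left_eq_right, hy, map_sub, hKk, ← hk, sub_self,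
        inner_zero_right]
    have h5 : ‖v‖ ^ 2 ≤ b ^ 2 * (‖u‖ ^ 2 + ‖y‖ ^ 2) := by
      have e1 : v = L.starProjection (T (M.starProjection (u + y))) := by
        have hMu : M.starProjection u = u := by
          have hKu : K.starProjection u = u := hUK z
          rw [← hKu]; exact starProjection_starProjection_of_ge hKM _
        have hMk : M.starProjection k = k := starProjection_starProjection_of_ge hKM _
        have hCu : C u = L.starProjection (T u) := by
          have := hcons u
          rw [hUK] at this
          simp only [hC, ContinuousLinearMap.comp_apply]; rw [hUK, this]
        have hDz : D z = L.starProjection (T (M.starProjection z - k)) := rfl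
        have hM : M.starProjection (u + y) = u + (M.starProjection z - k) := by
          rw [map_add, hMu, hy, map_sub, hMk]
        rw [hv, hCu, hDz, hM, map_add, map_add]
      have e2 : ‖u + y‖ ^ 2 = ‖u‖ ^ 2 + ‖y‖ ^ 2 := by
        rw [sq, sq, sq]
        exact norm_add_sq_eq_norm_sq_add_norm_sq_of_inner_eq_zero _ _ (horth u (hUK z))
      rw [e1, ← e2, ← mul_pow]
      gcongr
      exact (hrow _).trans (by gcongr)
    have h6 : ‖z‖ ^ 2 = ‖k‖ ^ 2 + ‖y‖ ^ 2 := by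
      have : z = k + y := by simp [hy]
      conv_lhs => rw [this]
      rw [sq, sq, sq]
      exact norm_add_sq_eq_norm_sq_add_norm_sq_of_inner_eq_zero _ _ (horth k hKk)
    rw [hY]
    refine (sq_le_sq₀ (norm_nonneg _) (by positivity)).1 ?_
    rw [h1, h3, mul_pow, h6, h4]
    nlinarith
  · intro z
    have : U (K.starProjection z) = 0 := by
      simp [hU, hDK]
    simp [this, hDK, starProjection_starProjection_of_le le_rfl]
  · intro z
    have hLC : ∀ x, L.starProjection (C x) = C x := fun x =>
      starProjection_starProjection_of_le le_rfl _
    have hLD : ∀ x, L.starProjection (D x) = D x := fun x =>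
      starProjection_starProjection_of_le le_rfl _
    have hLS : ∀ x, L.starProjection (S (K.starProjection x)) = C x := fun x => rfl
    simp only [sub_apply, add_apply,
        ContinuousLinearMap.comp_apply, map_sub, map_add, hLC, hLD, hLS, sub_self, sub_zero]
    have e1 : C (M.starProjection z) = L.starProjection (T (K.starProjection z)) := by
      rw [← hcons]
      simp only [hC, ContinuousLinearMap.comp_apply, starProjection_starProjection_of_le hKM]
    have e2 : D (M.starProjection z) =
        L.starProjection (T (M.starProjection z)) - L.starProjection (T (K.starProjection z)) := by
      simp [hD, starProjection_starProjection_of_le hKM, starProjection_starProjection_of_le le_rfl]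
    rw [e1, e2]; abel

/-- The distance formula for finite nests: corners can be matched by an operator of
essentially the largest norm of a corner. -/
lemma exists_corner_completion (K L : ℕ → Submodule ℂ X) [∀ k, (K k).HasOrthogonalProjection]
    [∀ k, (L k).HasOrthogonalProjection] (hK : Monotone K) (hL : Antitone L) (T : X →L[ℂ] X)
    {a : ℝ} (ha : 0 ≤ a) (n : ℕ)
    (h : ∀ k ≤ n, ∀ z, ‖(L k).starProjection (T ((K k).starProjection z))‖ ≤ a * ‖z‖) :
    ∀ b > a, ∃ Y : X →L[ℂ] X, (∀ z, ‖Y z‖ ≤ b * ‖z‖) ∧ ∀ k ≤ n, ∀ z,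
      (L k).starProjection (Y ((K k).starProjection z)) =
        (L k).starProjection (T ((K k).starProjection z)) := by
  induction n with
  | zero =>
    intro b hb
    refine ⟨(L 0).starProjection ∘L T ∘L (K 0).starProjection, fun z => ?_, fun k hk z => ?_⟩
    · exact (h 0 le_rfl z).trans (by gcongr)
    · obtain rfl : k = 0 := by omega
      simp [starProjection_starProjection_of_le le_rfl]
  | succ n ih =>
    intro b hb
    obtain ⟨b', hb', hb''⟩ := exists_between hb
    obtain ⟨S, hS, hS'⟩ := ih (fun k hk => h k (hk.trans (Nat.le_succ n))) b' hb'
    have hb0 : 0 ≤ b' := ha.trans hb'.le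
    obtain ⟨Y, hY, hYK, hYL⟩ := exists_parrott_completion (K := K n) (M := K (n + 1))
      (L := L (n + 1)) (hK (Nat.le_succ n)) S T hb0 hb''
      (fun z => (hS _).trans (by gcongr; exact (K n).norm_starProjection_apply_le z))
      (fun z => (h (n + 1) le_rfl z).trans (by gcongr))
      (fun z => by
        rw [← starProjection_starProjection_of_le (hL (Nat.le_succ n)), hS' n le_rfl,
          starProjection_starProjection_of_le (hL (Nat.le_succ n))])
    refine ⟨Y, hY, fun k hk z => ?_⟩
    rcases hk.lt_or_eq with hk | rfl
    · have hk : k ≤ n := by omega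
      rw [← starProjection_starProjection_of_ge (hK hk), hYK,
        starProjection_starProjection_of_ge (hK hk), hS' k hk]
    · exact hYL z

end Parrott

section QuasiCentral

variable {X ι : Type*} [NormedAddCommGroup X] [InnerProductSpace ℂ X] [LinearOrder ι]
  {p : ι → Submodule ℂ X} [∀ i, (p i).HasOrthogonalProjection]

lemma exists_le_le_succ {c : ℕ → ι} {n : ℕ} (h0 : ∀ i, c 0 ≤ i) (hn : ∀ i, i ≤ c n) (i : ι) :
    ∃ k, c k ≤ i ∧ i ≤ c (k + 1) := by
  classical
  have h : ∃ k, i ≤ c k := ⟨n, hn i⟩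
  rcases Nat.eq_zero_or_eq_succ_pred (Nat.find h) with h1 | h1
  · refine ⟨0, h0 i, ?_⟩
    have := Nat.find_spec h
    rw [h1] at this
    exact this.trans (h0 _)
  · refine ⟨(Nat.find h).pred, (not_le.1 (Nat.find_min h ?_)).le, ?_⟩
    · omega
    · have := Nat.find_spec h
      rwa [h1] at this

/-- A finite-dimensional space is cut into uniformly small pieces by a finite chain of an
atomless nest. -/
lemma NestFamily.exists_chain [CompleteSpace X] (hp : NestFamily p) (hd : ∀ i j, i ⋖ j → p i = p j)
    (R : Submodule ℂ X) [FiniteDimensional ℂ R] {ε : ℝ} (hε : 0 < ε) :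
    ∃ (n : ℕ) (c : ℕ → ι), Monotone c ∧ (∀ i, c 0 ≤ i) ∧ (∀ i, i ≤ c n) ∧ ∀ k, ∀ x ∈ R,
      ‖(p (c (k + 1))).starProjection x - (p (c k)).starProjection x‖ ≤ ε * ‖x‖ := by
  set b := stdOrthonormalBasis ℂ R with hb
  set d := Module.finrank ℂ R with hd'
  obtain ⟨n, c, hc, h0, hn, h⟩ := hp.exists_chain_family hd (fun j => (b j : X))
    (ε := ε / (d + 1)) (by positivity)
  refine ⟨n, c, hc, h0, hn, fun k x hx => ?_⟩
  rcases lt_or_ge k n with hk | hk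
  · have hx' : x = ∑ j, (b.repr ⟨x, hx⟩ j) • (b j : X) := by
      have := congrArg (Subtype.val) (b.sum_repr ⟨x, hx⟩)
      simpa using this.symm
    have hD : ∀ y, (p (c (k + 1))).starProjection y - (p (c k)).starProjection y =
        ((p (c (k + 1))).starProjection - (p (c k)).starProjection) y := fun y => rfl
    have hco : ∀ j, ‖b.repr ⟨x, hx⟩ j‖ ≤ ‖x‖ := fun j => by
      rw [OrthonormalBasis.repr_apply_apply]
      refine (norm_inner_le_norm _ _).trans ?_
      simp
    rw [hD]
    conv_lhs => rw [hx']
    rw [map_sum]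
    refine (norm_sum_le _ _).trans ((Finset.sum_le_card_nsmul _ _ (‖x‖ * (ε / (d + 1))) ?_).trans ?_)
    · intro j _
      rw [map_smul, norm_smul]
      exact mul_le_mul (hco j) (h k hk j) (norm_nonneg _) (norm_nonneg _)
    · simp only [Finset.card_univ, Fintype.card_fin, nsmul_eq_mul]
      have : (d : ℝ) * (ε / (d + 1)) ≤ ε := by
        rw [mul_div_assoc', div_le_iff₀ (by positivity)]; nlinarith
      calc (d : ℝ) * (‖x‖ * (ε / (d + 1))) = (d * (ε / (d + 1))) * ‖x‖ := by ring
        _ ≤ ε * ‖x‖ := by gcongr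
  · have h1 : c (k + 1) = c k := le_antisymm ((hn _).trans (hc hk)) (hc (Nat.le_succ k))
    rw [h1, sub_self, norm_zero]; positivity

/-- A finite chain of projections leaves invariant some finite-dimensional enlargement of any
finite-dimensional space. -/
lemma exists_finiteDimensional_invariant (hp : Monotone p) {c : ℕ → ι} {n : ℕ} (hc : Monotone c)
    (hn : p (c n) = ⊤) (R : Submodule ℂ X) [FiniteDimensional ℂ R] :
    ∃ R' : Submodule ℂ X, R ≤ R' ∧ FiniteDimensional ℂ R' ∧
      ∀ k, ∀ x ∈ R', (p (c k)).starProjection x ∈ R' := by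
  have htop : ∀ k, n ≤ k → p (c k) = ⊤ := fun k hk => top_le_iff.1 (hn ▸ hp (hc hk))
  refine ⟨⨆ k : Fin (n + 1), R.map ((p (c k)).starProjection : X →ₗ[ℂ] X), ?_, inferInstance, ?_⟩
  · refine le_trans ?_ (le_iSup _ (Fin.last n))
    intro x hx
    refine ⟨x, hx, ?_⟩
    exact Submodule.starProjection_eq_self_iff.2 (by simp [hn])
  · intro k x hx
    rcases lt_or_ge k n with hk | hk
    · refine Submodule.iSup_induction
        (p := fun k : Fin (n + 1) => R.map ((p (c k)).starProjection : X →ₗ[ℂ] X))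
        (motive := fun x => (p (c k)).starProjection x ∈ ⨆ k : Fin (n + 1),
          R.map ((p (c k)).starProjection : X →ₗ[ℂ] X)) hx ?_ (by simp) ?_
      · rintro l _ ⟨y, hy, rfl⟩
        rcases le_total k l with h | h
        · refine Submodule.mem_iSup_of_mem ⟨k, by omega⟩ ⟨y, hy, ?_⟩
          exact (starProjection_starProjection_of_le (hp (hc h)) y).symm
        · refine Submodule.mem_iSup_of_mem l ⟨y, hy, ?_⟩
          exact (starProjection_starProjection_of_ge (hp (hc h)) y).symm
      · intro y z hy hz
        rw [map_add]; exact add_mem hy hz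
    · rwa [Submodule.starProjection_eq_self_iff.2 (by rw [htop k hk]; trivial)]

end QuasiCentral

section Corner

variable {X : Type*} [NormedAddCommGroup X] [InnerProductSpace ℂ X] [CompleteSpace X]

/-- Adding an operator that is block diagonal with respect to `K ≤ L` to an operator with a small
block does not essentially increase the corner of a subspace between `K` and `L`. -/
lemma norm_corner_add_le {K N L : Submodule ℂ X} [K.HasOrthogonalProjection]
    [N.HasOrthogonalProjection] [L.HasOrthogonalProjection] (hKN : K ≤ N) (hNL : N ≤ L)
    (S E : X →L[ℂ] X) (hS : IsSelfAdjoint S) (hE : ∀ z, ‖E z‖ ≤ ‖z‖)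
    (hEK : ∀ z, E (K.starProjection z) = K.starProjection (E z))
    (hEL : ∀ z, E (L.starProjection z) = L.starProjection (E z)) {a η : ℝ} (ha : 1 ≤ a)
    (hη : 0 ≤ η) (hSη : ∀ z, ‖L.starProjection (S z) - K.starProjection (S z)‖ ≤ η * ‖z‖)
    (hSa : ∀ z, ‖Nᗮ.starProjection (S (N.starProjection z))‖ ≤ a * ‖z‖) (z : X) :
    ‖Nᗮ.starProjection ((S + E) (N.starProjection z))‖ ≤ (a + 2 * η) * ‖z‖ := by
  have hKL := hKN.trans hNL
  set D : X →L[ℂ] X := L.starProjection - K.starProjection with hD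
  have hDa : ∀ x, D x = L.starProjection x - K.starProjection x := fun x => rfl
  have hDD : ∀ x, D (D x) = D x := fun x => by
    simp only [hDa, map_sub, starProjection_starProjection_of_le hKL,
      starProjection_starProjection_of_ge hKL, starProjection_starProjection_of_le le_rfl]
    abel
  have hDs : ∀ x y, inner ℂ (D x) y = inner ℂ x (D y) := fun x y => by
    simp only [hDa, inner_sub_left, inner_sub_right, Submodule.inner_starProjection_left_eq_right]
  have hDadj : ContinuousLinearMap.adjoint D = D := by
    refine ((ContinuousLinearMap.eq_adjoint_iff _ _).2 fun x y => ?_).symm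
    exact hDs x y
  have horth : ∀ x y, D y = y → ‖(x - D x) + y‖ ^ 2 = ‖x - D x‖ ^ 2 + ‖y‖ ^ 2 := by
    intro x y hy
    rw [sq, sq, sq]
    refine norm_add_sq_eq_norm_sq_add_norm_sq_of_inner_eq_zero (𝕜 := ℂ) _ _ ?_
    have h0 : inner ℂ (x - D x) y = 0 := by
      rw [← hy, ← hDs, map_sub, hDD, sub_self, inner_zero_left]
    exact h0
  have hpyth : ∀ x, ‖x‖ ^ 2 = ‖x - D x‖ ^ 2 + ‖D x‖ ^ 2 := fun x => by
    rw [← horth x (D x) (hDD x), sub_add_cancel]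
  have hDle : ∀ x, ‖x - D x‖ ≤ ‖x‖ := fun x => by
    refine (sq_le_sq₀ (norm_nonneg _) (norm_nonneg _)).1 ?_
    nlinarith [hpyth x, sq_nonneg ‖D x‖]
  have hSD : ∀ x, ‖S (D x)‖ ≤ η * ‖x‖ := by
    intro x
    have h1 : ‖D ∘L S‖ ≤ η := ContinuousLinearMap.opNorm_le_bound _ hη hSη
    have h2 : ContinuousLinearMap.adjoint (D ∘L S) = S ∘L D := by
      rw [ContinuousLinearMap.adjoint_comp, hDadj, hS.adjoint_eq]
    rw [← LinearIsometryEquiv.norm_map ContinuousLinearMap.adjoint, h2] at h1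
    exact (S ∘L D).le_of_opNorm_le h1 x
  have hND : ∀ x, N.starProjection (D x) = N.starProjection x - K.starProjection x := fun x => by
    simp only [hDa, map_sub, starProjection_starProjection_of_le hNL,
      starProjection_starProjection_of_ge hKN]
  have hDN : ∀ x, D (N.starProjection x) = N.starProjection x - K.starProjection x := fun x => by
    simp only [hDa, starProjection_starProjection_of_le hKN,
      starProjection_starProjection_of_ge hNL]
  have hNc : ∀ x, Nᗮ.starProjection x = x - N.starProjection x :=
    fun x => Submodule.starProjection_orthogonal_val x
  set u := Nᗮ.starProjection (S (N.starProjection (z - D z))) with hu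
  set v := Nᗮ.starProjection (E (N.starProjection (D z))) with hv
  set w := Nᗮ.starProjection (S (D (N.starProjection z))) with hw
  have hsum : Nᗮ.starProjection ((S + E) (N.starProjection z)) = ((u - D u) + v) + (D u + w) := by
    have e1 : Nᗮ.starProjection (S (N.starProjection z)) = u + w := by
      rw [hu, hw, hDN, ← hND, map_sub, map_sub, map_sub, sub_add_cancel]
    have e2 : Nᗮ.starProjection (E (N.starProjection z)) = v := by
      rw [hv, hND, map_sub, hEK, map_sub, hNc (K.starProjection (E z)),
        starProjection_starProjection_of_ge hKN, sub_self, sub_zero]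
    rw [add_apply, map_add, e1, e2]; abel
  have hDv : D v = v := by
    have e1 : L.starProjection v = v := by
      rw [hv, hND, hNc, map_sub, map_sub, map_sub]
      simp only [map_sub, starProjection_starProjection_of_ge hNL, ← hEL,
        starProjection_starProjection_of_ge hKL]
    have e2 : K.starProjection v = 0 := by
      rw [hv, hNc, map_sub, starProjection_starProjection_of_le hKN, sub_self]
    rw [hDa, e1, e2, sub_zero]
  have hvn : ‖v‖ ≤ ‖D z‖ := (Nᗮ.norm_starProjection_apply_le _).trans
    ((hE _).trans (N.norm_starProjection_apply_le _))
  have hun : ‖u - D u‖ ≤ a * ‖z - D z‖ := (hDle u).trans (hSa _)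
  have hDu : ‖D u‖ ≤ η * ‖z‖ := by
    have : D u = Nᗮ.starProjection (D (S (N.starProjection (z - D z)))) := by
      rw [hu, hNc, hNc, map_sub, hDN, hND]
    rw [this]
    exact (Nᗮ.norm_starProjection_apply_le _).trans ((hSη _).trans (by
      gcongr; exact (N.norm_starProjection_apply_le _).trans (hDle z)))
  have hwn : ‖w‖ ≤ η * ‖z‖ := (Nᗮ.norm_starProjection_apply_le _).trans ((hSD _).trans (by
      gcongr; exact N.norm_starProjection_apply_le _))
  have huv : ‖(u - D u) + v‖ ≤ a * ‖z‖ := by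
    refine (sq_le_sq₀ (norm_nonneg _) (by positivity)).1 ?_
    rw [horth u v hDv, mul_pow, hpyth z, mul_add]
    have e1 : ‖u - D u‖ ^ 2 ≤ a ^ 2 * ‖z - D z‖ ^ 2 := by rw [← mul_pow]; gcongr
    have e2 : ‖v‖ ^ 2 ≤ a ^ 2 * ‖D z‖ ^ 2 := by
      refine le_trans ?_ (le_mul_of_one_le_left (by positivity) (one_le_pow₀ ha))
      gcongr
    linarith
  rw [hsum]
  refine (norm_add_le _ _).trans ((add_le_add huv (norm_add_le _ _)).trans ?_)
  linarith

end Corner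

section QuasiCentral

variable {X ι : Type*} [NormedAddCommGroup X] [InnerProductSpace ℂ X] [CompleteSpace X]
  [LinearOrder ι] {p : ι → Submodule ℂ X} [∀ i, (p i).HasOrthogonalProjection]

lemma NestFamily.exists_sum_projections (hp : NestFamily p) (hd : ∀ i j, i ⋖ j → p i = p j)
    (R : Submodule ℂ X) [FiniteDimensional ℂ R] {δ : ℝ} (hδ : 0 < δ) (m : ℕ) :
    ∃ S : X →L[ℂ] X, 0 ≤ S ∧ S ≤ (m : X →L[ℂ] X) ∧ FiniteDimensional ℂ (S : X →ₗ[ℂ] X).range ∧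
      (∀ r ∈ R, S r = (m : ℂ) • r) ∧
      ∀ i z, ‖(p i)ᗮ.starProjection (S ((p i).starProjection z))‖ ≤ (1 + m * δ) * ‖z‖ := by
  induction m with
  | zero =>
    refine ⟨0, le_rfl, by simp, ?_, by simp, fun i z => by simp⟩
    have : ((0 : X →L[ℂ] X) : X →ₗ[ℂ] X).range = ⊥ := by ext; simp
    rw [this]; infer_instance
  | succ m ih =>
    obtain ⟨S, hS0, hSm, hSf, hSR, hSc⟩ := ih
    obtain ⟨n, c, hc, h0, hn, hcε⟩ := hp.exists_chain hd (R ⊔ (S : X →ₗ[ℂ] X).range)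
      (ε := δ / (2 * (‖S‖ + 1))) (by positivity)
    have htop : p (c n) = ⊤ := by
      obtain ⟨u, hu⟩ := hp.exists_top
      exact top_le_iff.1 (hu.symm.le.trans (hp.mono (hn u)))
    obtain ⟨R', hR', hR'f, hR'c⟩ := exists_finiteDimensional_invariant hp.mono hc htop
      (R ⊔ (S : X →ₗ[ℂ] X).range)
    refine ⟨S + R'.starProjection, ?_, ?_, ?_, ?_, ?_⟩
    · exact add_nonneg hS0 (IsStarProjection.nonneg (isStarProjection_starProjection (U := R')))
    · rw [Nat.cast_succ]
      exact add_le_add hSm (IsStarProjection.le_one (isStarProjection_starProjection (U := R')))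
    · refine Submodule.finiteDimensional_of_le (S₂ := R') ?_
      rintro _ ⟨x, rfl⟩
      exact R'.add_mem (hR' (Submodule.mem_sup_right ⟨x, rfl⟩)) (R'.starProjection_apply_mem x)
    · intro r hr
      rw [add_apply, hSR r hr, Submodule.starProjection_eq_self_iff.2
        (hR' (Submodule.mem_sup_left hr))]
      push_cast; rw [add_smul, one_smul]
    · intro i z
      obtain ⟨k, hk, hk'⟩ := exists_le_le_succ h0 hn i
      have := norm_corner_add_le (hp.mono hk) (hp.mono hk') S R'.starProjection
        (IsSelfAdjoint.of_nonneg hS0) (fun z => R'.norm_starProjection_apply_le z)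
        (starProjection_comm_of_invariant (hR'c k))
        (starProjection_comm_of_invariant (hR'c (k + 1))) (a := 1 + m * δ) (η := δ / 2)
        (by nlinarith [m.cast_nonneg (α := ℝ)]) (by positivity) (fun z => ?_) (hSc i) z
      · refine this.trans (le_of_eq ?_)
        push_cast; ring
      · refine (hcε k _ (Submodule.mem_sup_right ⟨z, rfl⟩)).trans ?_
        have h1 : ‖S z‖ ≤ (‖S‖ + 1) * ‖z‖ := (S.le_opNorm z).trans (by gcongr; linarith)
        calc δ / (2 * (‖S‖ + 1)) * ‖S z‖ ≤ δ / (2 * (‖S‖ + 1)) * ((‖S‖ + 1) * ‖z‖) := by gcongr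
          _ = δ / 2 * ‖z‖ := by field_simp

/-- Finite rank approximate units quasi-central for an atomless nest. -/
lemma NestFamily.exists_quasicentral (hp : NestFamily p) (hd : ∀ i j, i ⋖ j → p i = p j)
    (R : Submodule ℂ X) [FiniteDimensional ℂ R] {ε : ℝ} (hε : 0 < ε) :
    ∃ F : X →L[ℂ] X, 0 ≤ F ∧ F ≤ 1 ∧ FiniteDimensional ℂ (F : X →ₗ[ℂ] X).range ∧
      (∀ r ∈ R, F r = r) ∧
      ∀ i z, ‖(p i)ᗮ.starProjection (F ((p i).starProjection z))‖ ≤ ε * ‖z‖ := by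
  obtain ⟨m, hm⟩ := exists_nat_gt (2 / ε)
  have hm0 : (0 : ℝ) < m := lt_trans (by positivity) hm
  have hm0' : (m : ℂ) ≠ 0 := by exact_mod_cast hm0.ne'
  obtain ⟨S, hS0, hSm, hSf, hSR, hSc⟩ := hp.exists_sum_projections hd R (δ := (m : ℝ)⁻¹)
    (by positivity) m
  have hinv : (0 : ℝ) ≤ (m : ℝ)⁻¹ := by positivity
  refine ⟨(m : ℝ)⁻¹ • S, smul_nonneg hinv hS0, ?_, ?_, ?_, ?_⟩
  · have := smul_le_smul_of_nonneg_left hSm hinv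
    refine this.trans (le_of_eq ?_)
    ext x
    have h1 : ((m : X →L[ℂ] X)) x = (m : ℝ) • x := by
      rw [Nat.cast_smul_eq_nsmul ℝ, ← nsmul_one m]; rfl
    rw [smul_apply, h1, smul_smul, inv_mul_cancel₀ hm0.ne', one_smul]; rfl
  · refine Submodule.finiteDimensional_of_le (S₂ := (S : X →ₗ[ℂ] X).range) ?_
    rintro _ ⟨x, rfl⟩
    refine ⟨(m : ℝ)⁻¹ • x, by simp⟩
  · intro r hr
    have h1 : (m : ℂ) • r = (m : ℝ) • r := by
      rw [Nat.cast_smul_eq_nsmul ℝ, Nat.cast_smul_eq_nsmul ℂ]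
    rw [smul_apply, hSR r hr, h1, smul_smul, inv_mul_cancel₀ hm0.ne', one_smul]
  · intro i z
    have h1 := hSc i z
    rw [mul_inv_cancel₀ hm0.ne'] at h1
    have h2 : (p i)ᗮ.starProjection (((m : ℝ)⁻¹ • S) ((p i).starProjection z)) =
        (m : ℝ)⁻¹ • (p i)ᗮ.starProjection (S ((p i).starProjection z)) := by
      rw [smul_apply]
      exact ((p i)ᗮ.starProjection.restrictScalars ℝ).map_smul _ _
    rw [h2, norm_smul, Real.norm_of_nonneg hinv]
    have h3 : (m : ℝ)⁻¹ * 2 ≤ ε := by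
      rw [inv_mul_le_iff₀ hm0]
      rw [div_lt_iff₀ hε] at hm
      exact hm.le
    calc (m : ℝ)⁻¹ * _ ≤ (m : ℝ)⁻¹ * ((1 + 1) * ‖z‖) := by gcongr
      _ = ((m : ℝ)⁻¹ * 2) * ‖z‖ := by ring
      _ ≤ ε * ‖z‖ := by gcongr

end QuasiCentral

section Approx

variable {X : Type*} [NormedAddCommGroup X] [InnerProductSpace ℂ X] [CompleteSpace X]

lemma mul_eq_left_of_mul_eq {F F' : X →L[ℂ] X} (hF : 0 ≤ F) (hF' : 0 ≤ F') (h : F' * F = F) :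
    F * F' = F := by
  have := congrArg star h
  rwa [star_mul, (IsSelfAdjoint.of_nonneg hF).star_eq, (IsSelfAdjoint.of_nonneg hF').star_eq]
    at this

lemma le_of_mul_eq {F F' : X →L[ℂ] X} (hF : 0 ≤ F) (hF1 : F ≤ 1) (hF' : 0 ≤ F')
    (h : F' * F = F) : F ≤ F' := by
  have h2 := mul_eq_left_of_mul_eq hF hF' h
  have h3 : F' - F = F' * (1 - F) := by rw [mul_sub, mul_one, h]
  rw [← sub_nonneg, h3]
  refine Commute.mul_nonneg hF' (sub_nonneg.2 hF1) ?_
  rw [Commute, SemiconjBy, mul_sub, sub_mul, h, h2, mul_one, one_mul]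

lemma norm_sq_apply_le_of_le_one {G : X →L[ℂ] X} (hG : 0 ≤ G) (hG1 : G ≤ 1) (z : X) :
    ‖G z‖ ^ 2 ≤ (inner ℂ (G z) z).re := by
  have h : 0 ≤ G * (1 - G) := Commute.mul_nonneg hG (sub_nonneg.2 hG1)
    (by rw [Commute, SemiconjBy, mul_sub, sub_mul, mul_one, one_mul])
  have h1 := ((ContinuousLinearMap.nonneg_iff_isPositive _).1 h).re_inner_nonneg_left z
  have h2 : (G * (1 - G)) z = G z - G (G z) := by simp [mul_sub]
  have h3 : inner ℂ (G (G z)) z = inner ℂ (G z) (G z) := by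
    rw [← ContinuousLinearMap.adjoint_inner_right, (IsSelfAdjoint.of_nonneg hG).adjoint_eq]
  rw [h2, inner_sub_left, map_sub, h3, inner_self_eq_norm_sq] at h1
  exact sub_nonneg.1 h1

lemma re_inner_le_of_le {F G : X →L[ℂ] X} (h : F ≤ G) (z : X) :
    (inner ℂ (F z) z).re ≤ (inner ℂ (G z) z).re := by
  have h1 := ((ContinuousLinearMap.nonneg_iff_isPositive _).1 (sub_nonneg.2 h)).re_inner_nonneg_left z
  rw [sub_apply, inner_sub_left, map_sub] at h1
  exact sub_nonneg.1 h1

lemma norm_apply_le_of_le_one {G : X →L[ℂ] X} (hG : 0 ≤ G) (hG1 : G ≤ 1) (z : X) :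
    ‖G z‖ ≤ ‖z‖ := by
  refine (sq_le_sq₀ (norm_nonneg _) (norm_nonneg _)).1 ?_
  refine (norm_sq_apply_le_of_le_one hG hG1 z).trans ((re_inner_le_of_le hG1 z).trans (le_of_eq ?_))
  exact inner_self_eq_norm_sq (𝕜 := ℂ) z

variable {ι : Type*} [LinearOrder ι] {p : ι → Submodule ℂ X}
  [∀ i, (p i).HasOrthogonalProjection]

lemma NestFamily.exists_seq_quasicentral [TopologicalSpace.SeparableSpace X] (hp : NestFamily p)
    (hd : ∀ i j, i ⋖ j → p i = p j) {ε : ℕ → ℝ} (hε : ∀ k, 0 < ε k) :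
    ∃ F : ℕ → X →L[ℂ] X, F 0 = 0 ∧ F 1 = 0 ∧ (∀ k, 0 ≤ F k) ∧ (∀ k, F k ≤ 1) ∧
      (∀ k, FiniteDimensional ℂ (F k : X →ₗ[ℂ] X).range) ∧ (∀ k, F (k + 1) * F k = F k) ∧
      (∀ k i z, ‖(p i)ᗮ.starProjection (F k ((p i).starProjection z))‖ ≤ ε k * ‖z‖) ∧
      ∀ z, Tendsto (fun k => F k z) atTop (𝓝 z) := by
  set d := TopologicalSpace.denseSeq X
  have step : ∀ (k : ℕ) (F : X →L[ℂ] X), FiniteDimensional ℂ (F : X →ₗ[ℂ] X).range →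
      ∃ F' : X →L[ℂ] X, (0 ≤ F' ∧ F' ≤ 1 ∧ FiniteDimensional ℂ (F' : X →ₗ[ℂ] X).range) ∧
        F' * F = F ∧ F' (d k) = d k ∧
        ∀ i z, ‖(p i)ᗮ.starProjection (F' ((p i).starProjection z))‖ ≤ ε (k + 2) * ‖z‖ := by
    intro k F hF
    obtain ⟨F', h0, h1, hf, hR, hc⟩ := hp.exists_quasicentral hd
      ((F : X →ₗ[ℂ] X).range ⊔ Submodule.span ℂ {d k}) (hε (k + 2))
    refine ⟨F', ⟨h0, h1, hf⟩, ?_, hR _ (Submodule.mem_sup_right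
      (Submodule.mem_span_singleton_self _)), hc⟩
    ext x
    exact hR _ (Submodule.mem_sup_left ⟨x, rfl⟩)
  choose! g hg hgF hgd hgc using step
  set Φ : ℕ → X →L[ℂ] X := fun k => Nat.rec 0 (fun k F => g k F) k with hΦ
  have hΦs : ∀ k, Φ (k + 1) = g k (Φ k) := fun k => rfl
  have hΦ0 : Φ 0 = 0 := rfl
  have hz : FiniteDimensional ℂ ((0 : X →L[ℂ] X) : X →ₗ[ℂ] X).range := by
    have : ((0 : X →L[ℂ] X) : X →ₗ[ℂ] X).range = ⊥ := by ext; simp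
    rw [this]; infer_instance
  have hΦf : ∀ k, FiniteDimensional ℂ (Φ k : X →ₗ[ℂ] X).range := by
    intro k
    induction k with
    | zero => exact hz
    | succ k ih => rw [hΦs]; exact (hg k _ ih).2.2
  set F : ℕ → X →L[ℂ] X := fun k => Φ (k - 1) with hF
  have hFs : ∀ k, F (k + 2) = g k (F (k + 1)) := fun k => rfl
  have hF0 : F 0 = 0 := rfl
  have hF1 : F 1 = 0 := rfl
  have hFn : ∀ k, 0 ≤ F k := by
    rintro (_ | _ | k)
    · exact le_rfl
    · exact le_rfl
    · exact (hg k _ (hΦf _)).1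
  have hFle : ∀ k, F k ≤ 1 := by
    rintro (_ | _ | k)
    · exact zero_le_one
    · exact zero_le_one
    · exact (hg k _ (hΦf _)).2.1
  have hFc : ∀ k, F (k + 1) * F k = F k := by
    rintro (_ | k)
    · simp [hF0]
    · exact hgF k _ (hΦf _)
  refine ⟨F, hF0, hF1, hFn, hFle, fun k => hΦf _, hFc, ?_, ?_⟩
  · rintro (_ | _ | k) i z
    · simp [hF0]; exact mul_nonneg (hε 0).le (norm_nonneg _)
    · simp [hF1]; exact mul_nonneg (hε 1).le (norm_nonneg _)
    · exact hgc k _ (hΦf _) i z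
  · intro z
    have hfix : ∀ j k, j + 2 ≤ k → F k (d j) = d j := by
      intro j k hk
      induction k, hk using Nat.le_induction with
      | base => exact hgd j _ (hΦf _)
      | succ k hk ih =>
        have := congrArg (fun T : X →L[ℂ] X => T (d j)) (hFc k)
        simp only [mul_apply_eq_comp, ih] at this
        simpa [ih] using this
    rw [Metric.tendsto_atTop]
    intro η hη
    obtain ⟨j, hj⟩ := (TopologicalSpace.denseRange_denseSeq X).exists_dist_lt z (half_pos hη)
    refine ⟨j + 2, fun k hk => ?_⟩
    have hFk : ‖F k (z - d j)‖ ≤ ‖z - d j‖ := norm_apply_le_of_le_one (hFn k) (hFle k) _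
    have : F k z - z = F k (z - d j) - (z - d j) := by
      rw [map_sub, hfix j k hk]; abel
    rw [dist_eq_norm] at hj ⊢
    rw [this]
    refine (norm_sub_le _ _).trans_lt ?_
    linarith

end Approx

section Isometry

variable {X Y : Type*} [NormedAddCommGroup X] [InnerProductSpace ℂ X]
  [NormedAddCommGroup Y] [InnerProductSpace ℂ Y]

lemma finiteDimensional_of_inf_orthogonal {D W : Submodule ℂ Y} [FiniteDimensional ℂ W]
    (h : FiniteDimensional ℂ ↥(D ⊓ Wᗮ)) : FiniteDimensional ℂ D := by
  set f : D →ₗ[ℂ] W := (W.orthogonalProjectionOnto : Y →ₗ[ℂ] W) ∘ₗ D.subtype with hf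
  have h1 : FiniteDimensional ℂ f.ker := by
    have hmem : ∀ x : f.ker, ((x : D) : Y) ∈ D ⊓ Wᗮ := fun x =>
      ⟨(x : D).2, Submodule.orthogonalProjectionOnto_eq_zero_iff.1 x.2⟩
    refine Module.Finite.of_injective
      ((D.subtype ∘ₗ f.ker.subtype).codRestrict (D ⊓ Wᗮ) hmem) fun x y hxy => ?_
    exact Subtype.ext (Subtype.ext (congrArg (fun t : ↥(D ⊓ Wᗮ) => (t : Y)) hxy))
  have h2 : FiniteDimensional ℂ (D ⧸ f.ker) :=
    Module.Finite.equiv (LinearMap.quotKerEquivRange f).symm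
  exact Module.Finite.of_submodule_quotient f.ker

lemma exists_isometryOn_of_not_finiteDimensional {S : Submodule ℂ X} [FiniteDimensional ℂ S]
    {D : Submodule ℂ Y} (hD : ¬ FiniteDimensional ℂ D) :
    ∃ V : X →L[ℂ] Y, (∀ x, V x ∈ D) ∧ ∀ x ∈ S, ‖V x‖ = ‖x‖ := by
  have hr : ((Module.finrank ℂ S : ℕ) : Cardinal) ≤ Module.rank ℂ D := by
    refine (Cardinal.natCast_lt_aleph0).le.trans ?_
    by_contra hlt
    exact hD (Module.rank_lt_aleph0_iff.1 (not_le.1 hlt))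
  obtain ⟨f, hf⟩ := exists_linearIndependent_of_le_rank hr
  have hf' : LinearIndependent ℂ (fun i => (f i : Y)) := hf.map' D.subtype D.ker_subtype
  set S' := Submodule.span ℂ (Set.range fun i => (f i : Y)) with hS'
  have hfin : Module.finrank ℂ S' = Module.finrank ℂ S := by
    rw [finrank_span_eq_card hf', Fintype.card_fin]
  have hS'D : S' ≤ D := Submodule.span_le.2 (by rintro _ ⟨i, rfl⟩; exact (f i).2)
  have : FiniteDimensional ℂ S' := .span_of_finite ℂ (Set.finite_range _)
  let e : S ≃ₗᵢ[ℂ] S' :=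
    (stdOrthonormalBasis ℂ S).equiv (stdOrthonormalBasis ℂ S') (finCongr hfin.symm)
  refine ⟨S'.subtypeL ∘L (e.toContinuousLinearEquiv : S →L[ℂ] S') ∘L S.orthogonalProjectionOnto,
    fun x => hS'D (e _).2, fun x hx => ?_⟩
  have : S.orthogonalProjectionOnto x = ⟨x, hx⟩ := by
    exact Submodule.orthogonalProjectionOnto_mem_subspace_eq_self (K := S) ⟨x, hx⟩
  change ‖e (S.orthogonalProjectionOnto x)‖ = ‖x‖
  rw [this, e.norm_map]
  rfl

variable {ι : Type*} [LinearOrder ι] {p : ι → Submodule ℂ X} {q : ι → Submodule ℂ Y}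

/-- A nest that separates at least the indices separated by an atomless nest has only
infinite-dimensional differences there. -/
lemma NestFamily.not_finiteDimensional_of_absorbs [CompleteSpace X]
    [∀ i, (p i).HasOrthogonalProjection]
    (hp : NestFamily p) (hd : ∀ i j, i ⋖ j → p i = p j) (hq : Monotone q)
    [∀ i, (q i).HasOrthogonalProjection]
    (habs : ∀ i j, i ≤ j → q i = q j → p i = p j) {i j : ι} (hij : i ≤ j) (hne : p i ≠ p j) :
    ¬ FiniteDimensional ℂ ↥(q j ⊓ (q i)ᗮ) := by
  intro hf
  induction hm : Module.finrank ℂ ↥(q j ⊓ (q i)ᗮ) using Nat.strong_induction_on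
    generalizing i j with
  | _ m ih =>
  have hlt : p i < p j := lt_of_le_of_ne (hp.mono hij) hne
  obtain ⟨y, hyj, hyi⟩ := Set.exists_of_ssubset hlt
  set r := y - (p i).starProjection y with hr
  have hrj : r ∈ p j := (p j).sub_mem hyj (hp.mono hij ((p i).starProjection_apply_mem y))
  have hri : (p i).starProjection r = 0 := by
    rw [hr, map_sub, starProjection_starProjection_of_le le_rfl, sub_self]
  have hr0 : r ≠ 0 := by
    intro h
    refine hyi ?_
    rw [sub_eq_zero.1 h]; exact (p i).starProjection_apply_mem y
  have hrp : 0 < ‖r‖ ^ 2 := by positivity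
  obtain ⟨k, hk⟩ := hp.exists_sum_norm_sq_eq hd (fun _ : Fin 1 => r) (s := ‖r‖ ^ 2 / 2)
    (by positivity) (by simp)
  simp only [Finset.univ_unique, Finset.sum_const, Finset.card_singleton, one_smul] at hk
  have hik : i < k := by
    by_contra h
    have := norm_starProjection_mono (hp.mono (not_lt.1 h)) r
    rw [hri, norm_zero, hk] at this
    linarith
  have hkj : k < j := by
    by_contra h
    have := norm_starProjection_mono (hp.mono (not_lt.1 h)) r
    rw [Submodule.starProjection_eq_self_iff.2 hrj, hk] at this
    linarith
  have hne1 : p i ≠ p k := by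
    intro h
    have h2 : (p k).starProjection r = 0 := by
      rw [← hri]; congr 1; congr 1; exact h.symm
    rw [h2, norm_zero] at hk
    linarith
  have hne2 : p k ≠ p j := by
    intro h
    rw [Submodule.starProjection_eq_self_iff.2 (h ▸ hrj)] at hk
    linarith
  have hle : q k ⊓ (q i)ᗮ ≤ q j ⊓ (q i)ᗮ := inf_le_inf_right _ (hq hkj.le)
  have hlt' : q k ⊓ (q i)ᗮ < q j ⊓ (q i)ᗮ := by
    refine lt_of_le_of_ne hle fun h => hne2 (habs k j hkj.le (le_antisymm (hq hkj.le) ?_))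
    intro y hy
    have h1 : y - (q i).starProjection y ∈ q j ⊓ (q i)ᗮ :=
      ⟨(q j).sub_mem hy (hq hij ((q i).starProjection_apply_mem y)),
        Submodule.sub_starProjection_mem_orthogonal y⟩
    rw [← h] at h1
    have := (q k).add_mem h1.1 (hq hik.le ((q i).starProjection_apply_mem y))
    rwa [sub_add_cancel] at this
  have hf' : FiniteDimensional ℂ ↥(q k ⊓ (q i)ᗮ) := Submodule.finiteDimensional_of_le hle
  exact ih _ (hm ▸ Submodule.finrank_lt_finrank_of_lt hlt') hik.le hne1 hf' rfl

/-- A finite-dimensional space embeds isometrically, compatibly with a finite chain of an atomless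
nest and orthogonally to a given finite-dimensional space. -/
lemma NestFamily.exists_isometryOn_chain [CompleteSpace X] [∀ i, (p i).HasOrthogonalProjection]
    [∀ i, (q i).HasOrthogonalProjection]
    (hp : NestFamily p) (hd : ∀ i j, i ⋖ j → p i = p j) (hq : Monotone q)
    (habs : ∀ i j, i ≤ j → q i = q j → p i = p j) {c : ℕ → ι} {n : ℕ} (hc : Monotone c)
    (h0 : p (c 0) = ⊥) (hn : p (c n) = ⊤) (R : Submodule ℂ X) [FiniteDimensional ℂ R]
    (W : Submodule ℂ Y)
    [FiniteDimensional ℂ W] :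
    ∃ V : X →L[ℂ] Y, (∀ x, V x ∈ Wᗮ) ∧ (∀ x ∈ R, ‖V x‖ = ‖x‖) ∧
      (∀ k, ∀ x ∈ p (c k), V x ∈ q (c k)) ∧ ∀ k, ∀ x ∈ (p (c k))ᗮ, V x ∈ (q (c k))ᗮ := by
  have hpc : ∀ k, p (c k) ≤ p (c (k + 1)) := fun k => hp.mono (hc (Nat.le_succ k))
  set Δ : ℕ → X →L[ℂ] X := fun k => (p (c (k + 1))).starProjection - (p (c k)).starProjection
    with hΔ
  have hΔa : ∀ k x, Δ k x = (p (c (k + 1))).starProjection x - (p (c k)).starProjection x :=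
    fun k x => rfl
  have step : ∀ k, ∃ V : X →L[ℂ] Y, (∀ x, V x ∈ q (c (k + 1)) ⊓ (q (c k))ᗮ ⊓ Wᗮ) ∧
      ∀ x ∈ R.map (Δ k : X →ₗ[ℂ] X), ‖V x‖ = ‖x‖ := by
    intro k
    by_cases hk : p (c k) = p (c (k + 1))
    · refine ⟨0, fun x => by simp, ?_⟩
      rintro _ ⟨x, -, rfl⟩
      have : Δ k x = 0 := by
        rw [hΔa, sub_eq_zero]; congr 1; congr 1; exact hk.symm
      simp [this]
    · have h1 := hp.not_finiteDimensional_of_absorbs hd hq habs (hc (Nat.le_succ k)) hk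
      exact exists_isometryOn_of_not_finiteDimensional
        fun h => h1 (finiteDimensional_of_inf_orthogonal h)
  choose V hV hVn using step
  set U : ℕ → X →L[ℂ] Y := fun m => ∑ k ∈ Finset.range m, V k ∘L Δ k with hU
  have hUs : ∀ m x, U (m + 1) x = U m x + V m (Δ m x) := fun m x => by
    simp [hU, Finset.sum_range_succ]
  have hUa : ∀ m x, U m x = ∑ k ∈ Finset.range m, V k (Δ k x) := fun m x => by
    simp [hU, sum_apply]
  have hUq : ∀ m x, U m x ∈ q (c m) := by
    intro m x
    rw [hUa]
    refine Submodule.sum_mem _ fun k hk => ?_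
    exact hq (hc (Finset.mem_range.1 hk)) (hV k _).1.1
  have hUn : ∀ m, ∀ x ∈ R, ‖U m x‖ ^ 2 = ‖(p (c m)).starProjection x‖ ^ 2 := by
    intro m x hx
    induction m with
    | zero =>
      have : (p (c 0)).starProjection x = 0 :=
        (Submodule.mem_bot ℂ).1 (h0 ▸ (p (c 0)).starProjection_apply_mem x)
      simp [hU, this]
    | succ m ih =>
      have h1 : ‖U m x + V m (Δ m x)‖ ^ 2 = ‖U m x‖ ^ 2 + ‖V m (Δ m x)‖ ^ 2 := by
        rw [sq, sq, sq]
        exact norm_add_sq_eq_norm_sq_add_norm_sq_of_inner_eq_zero (𝕜 := ℂ) _ _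
          (Submodule.inner_right_of_mem_orthogonal (hUq m x) (hV m _).1.2)
      have h2 : ‖V m (Δ m x)‖ = ‖Δ m x‖ := hVn m _ ⟨x, hx, rfl⟩
      rw [hUs, h1, ih, h2, hΔa, norm_sq_starProjection_sub (hpc m)]
      ring
  refine ⟨U n, ?_, ?_, ?_, ?_⟩
  · intro x
    rw [hUa]
    exact Submodule.sum_mem _ fun k hk => (hV k _).2
  · intro x hx
    have h1 := hUn n x hx
    rw [Submodule.starProjection_eq_self_iff (K := p (c n)) |>.2 (by simp [hn])] at h1
    exact (sq_eq_sq₀ (norm_nonneg _) (norm_nonneg _)).1 h1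
  · intro k x hx
    rw [hUa]
    refine Submodule.sum_mem _ fun l hl => ?_
    rcases lt_or_ge l k with h | h
    · exact hq (hc h) (hV l _).1.1
    · have h2 : Δ l x = 0 := by
        rw [hΔa, Submodule.starProjection_eq_self_iff.2 (hp.mono (hc h) hx),
          Submodule.starProjection_eq_self_iff.2 (hp.mono (hc (h.trans (Nat.le_succ l))) hx),
          sub_self]
      rw [h2, map_zero]; exact zero_mem _
  · intro k x hx
    rw [hUa]
    refine Submodule.sum_mem _ fun l hl => ?_
    rcases lt_or_ge l k with h | h
    · have h2 : ∀ m, m ≤ k → (p (c m)).starProjection x = 0 := fun m hm =>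
        (p (c m)).starProjection_apply_eq_zero_iff.2
          (Submodule.orthogonal_le (hp.mono (hc hm)) hx)
      rw [hΔa, h2 _ h, h2 _ h.le, sub_self, map_zero]; exact zero_mem _
    · exact Submodule.orthogonal_le (hq (hc h)) (hV l _).1.2

end Isometry

section Block

variable {X Y : Type*} [NormedAddCommGroup X] [InnerProductSpace ℂ X] [CompleteSpace X]
  [NormedAddCommGroup Y] [InnerProductSpace ℂ Y]
  {ι : Type*} [LinearOrder ι] {p : ι → Submodule ℂ X} {q : ι → Submodule ℂ Y}
  [∀ i, (p i).HasOrthogonalProjection] [∀ i, (q i).HasOrthogonalProjection]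

/-- A self-adjoint finite rank contraction with small corners has a small perturbation which is
strictly triangular relative to a fine chain. -/
lemma exists_strictly_triangular (hp : Monotone p) {c : ℕ → ι} {n : ℕ} (hc : Monotone c)
    (hn : p (c n) = ⊤) {R R' : Submodule ℂ X} [FiniteDimensional ℂ R'] (hRR' : R ≤ R')
    (hR' : ∀ k, ∀ x ∈ R', (p (c k)).starProjection x ∈ R') {ε : ℝ} (hε : 0 < ε)
    (hRε : ∀ k, ∀ x ∈ R,
      ‖(p (c (k + 1))).starProjection x - (p (c k)).starProjection x‖ ≤ ε * ‖x‖)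
    (G : X →L[ℂ] X) (hG : IsSelfAdjoint G) (hG1 : ∀ z, ‖G z‖ ≤ ‖z‖) (hGR : ∀ z, G z ∈ R)
    (hGε : ∀ i z, ‖(p i)ᗮ.starProjection (G ((p i).starProjection z))‖ ≤ ε * ‖z‖) :
    ∃ G' : X →L[ℂ] X, (∀ z, G' z ∈ R') ∧ (∀ z, ContinuousLinearMap.adjoint G' z ∈ R') ∧
      ‖G' - G‖ ≤ 3 * ε ∧ (∀ k, ∀ x ∈ p (c (k + 1)), G' x ∈ p (c k)) ∧
      ∀ k, ∀ x ∈ (p (c k))ᗮ, ContinuousLinearMap.adjoint G' x ∈ (p (c (k + 1)))ᗮ := by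
  have hcorner : ∀ k ≤ n, ∀ z, ‖(p (c k))ᗮ.starProjection
      (G ((p (c (k + 1))).starProjection z))‖ ≤ (2 * ε) * ‖z‖ := by
    intro k _ z
    set y := G ((p (c (k + 1))).starProjection z) with hy
    have h1 : (p (c k))ᗮ.starProjection y = (p (c (k + 1)))ᗮ.starProjection y +
        ((p (c (k + 1))).starProjection y - (p (c k)).starProjection y) := by
      rw [Submodule.starProjection_orthogonal_val, Submodule.starProjection_orthogonal_val]
      abel
    have h2 : ‖y‖ ≤ ‖z‖ := (hG1 _).trans ((p (c (k + 1))).norm_starProjection_apply_le z)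
    rw [h1]
    refine (norm_add_le _ _).trans ((add_le_add (hGε _ z) ((hRε k y (hGR _)).trans
      (mul_le_mul_of_nonneg_left h2 hε.le))).trans (le_of_eq (by ring)))
  obtain ⟨D, hD, hDc⟩ := exists_corner_completion (fun k => p (c (k + 1))) (fun k => (p (c k))ᗮ)
    (fun i j hij => hp (hc (Nat.add_le_add_right hij 1)))
    (fun i j hij => Submodule.orthogonal_le (hp (hc hij))) G (a := 2 * ε) (by positivity) n hcorner
    (3 * ε) (by linarith)
  set E := R'.starProjection with hE
  have hEG : ∀ z, E (G z) = G z := fun z => Submodule.starProjection_eq_self_iff.2 (hRR' (hGR z))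
  have hGE : ∀ z, G (E z) = G z := by
    intro z
    refine ext_inner_right ℂ fun w => ?_
    have hs : ∀ x y, inner ℂ (G x) y = inner ℂ x (G y) := fun x y => by
      rw [← ContinuousLinearMap.adjoint_inner_right, hG.adjoint_eq]
    rw [hs, hE, Submodule.inner_starProjection_left_eq_right, ← hE, hEG, hs]
  have hcomm : ∀ k z, E ((p (c k)).starProjection z) = (p (c k)).starProjection (E z) :=
    fun k => starProjection_comm_of_invariant (hR' k)
  set G' : X →L[ℂ] X := E ∘L (G - D) ∘L E with hG'
  have hG'a : ∀ z, G' z = E (G (E z) - D (E z)) := fun z => rfl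
  have hadj : ∀ z, ContinuousLinearMap.adjoint G' z ∈ R' := by
    intro z
    have : ContinuousLinearMap.adjoint G' z =
        E (ContinuousLinearMap.adjoint (E ∘L (G - D)) z) := by
      have h1 : ContinuousLinearMap.adjoint E = E :=
        (ContinuousLinearMap.isSelfAdjoint_iff'.1 (isSelfAdjoint_starProjection R'))
      have h2 : G' = (E ∘L (G - D)) ∘L E := rfl
      rw [h2, ContinuousLinearMap.adjoint_comp, h1]; rfl
    rw [this]
    exact R'.starProjection_apply_mem _
  have htri : ∀ k, ∀ x ∈ p (c (k + 1)), G' x ∈ p (c k) := by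
    intro k x hx
    rcases le_or_gt k n with hk | hk
    · have h1 := hDc k hk (E x)
      rw [← hcomm, Submodule.starProjection_eq_self_iff.2 hx] at h1
      have h2 : (p (c k))ᗮ.starProjection (G' x) = 0 := by
        have h3 : ∀ y, (p (c k))ᗮ.starProjection (E y) = E ((p (c k))ᗮ.starProjection y) := by
          intro y
          rw [Submodule.starProjection_orthogonal_val, Submodule.starProjection_orthogonal_val,
            map_sub, hcomm]
        rw [hG'a, h3, map_sub, h1, sub_self, map_zero]
      rw [Submodule.starProjection_orthogonal_val, sub_eq_zero] at h2
      rw [h2]; exact (p (c k)).starProjection_apply_mem _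
    · have : p (c k) = ⊤ := top_le_iff.1 (hn ▸ hp (hc hk.le))
      rw [this]; trivial
  refine ⟨G', fun z => R'.starProjection_apply_mem _, hadj, ?_, htri, ?_⟩
  · refine ContinuousLinearMap.opNorm_le_bound _ (by positivity) fun z => ?_
    have : (G' - G) z = - E (D (E z)) := by
      rw [sub_apply, hG'a, map_sub, hGE, hEG]; abel
    rw [this, norm_neg]
    exact (R'.norm_starProjection_apply_le _).trans ((hD _).trans
      (mul_le_mul_of_nonneg_left (R'.norm_starProjection_apply_le _) (by positivity)))
  · intro k x hx
    rw [Submodule.mem_orthogonal]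
    intro y hy
    rw [ContinuousLinearMap.adjoint_inner_right]
    exact Submodule.inner_right_of_mem_orthogonal (htri k y hy) hx

/-- A pair of quasi-central finite rank contractions can be transplanted, up to a small error,
into a space whose nest absorbs the atomless nest, away from a given finite-dimensional space. -/
lemma NestFamily.exists_transplant (hp : NestFamily p) (hd : ∀ i j, i ⋖ j → p i = p j)
    (hq : Monotone q) (habs : ∀ i j, i ≤ j → q i = q j → p i = p j) {ε : ℝ} (hε : 0 < ε)
    (hε1 : ε ≤ 1) (G G' : X →L[ℂ] X) (hG : IsSelfAdjoint G) (hG' : IsSelfAdjoint G')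
    (hG1 : ∀ z, ‖G z‖ ≤ ‖z‖) (hG1' : ∀ z, ‖G' z‖ ≤ ‖z‖)
    (hGf : FiniteDimensional ℂ (G : X →ₗ[ℂ] X).range)
    (hGf' : FiniteDimensional ℂ (G' : X →ₗ[ℂ] X).range)
    (hGε : ∀ i z, ‖(p i)ᗮ.starProjection (G ((p i).starProjection z))‖ ≤ ε * ‖z‖)
    (hGε' : ∀ i z, ‖(p i)ᗮ.starProjection (G' ((p i).starProjection z))‖ ≤ ε * ‖z‖)
    (W : Submodule ℂ Y) [FiniteDimensional ℂ W] :
    ∃ (T T' : X →L[ℂ] Y) (W' : Submodule ℂ Y), FiniteDimensional ℂ W' ∧ W' ≤ Wᗮ ∧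
      (∀ z, T z ∈ W') ∧ (∀ z, T' z ∈ W') ∧ (∀ i, ∀ z ∈ p i, T z ∈ q i) ∧
      (∀ i, ∀ z ∈ (p i)ᗮ, T' z ∈ (q i)ᗮ) ∧ (∀ z, ‖T z‖ ≤ ‖G z‖ + 3 * ε * ‖z‖) ∧
      (∀ z, ‖T' z‖ ≤ ‖G' z‖ + 3 * ε * ‖z‖) ∧
      ∀ z w, ‖inner ℂ (T z) (T' w) - inner ℂ (G z) (G' w)‖ ≤ 15 * ε * (‖z‖ * ‖w‖) := by
  set R := (G : X →ₗ[ℂ] X).range ⊔ (G' : X →ₗ[ℂ] X).range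
  obtain ⟨n, c, hc, h0, hn, hcε⟩ := hp.exists_chain hd R hε
  have hbot : p (c 0) = ⊥ := by
    obtain ⟨b, hb⟩ := hp.exists_bot
    exact le_bot_iff.1 ((hp.mono (h0 b)).trans hb.le)
  have htop : p (c n) = ⊤ := by
    obtain ⟨u, hu⟩ := hp.exists_top
    exact top_le_iff.1 (hu.symm.le.trans (hp.mono (hn u)))
  obtain ⟨R', hRR', hR'f, hR'⟩ := exists_finiteDimensional_invariant hp.mono hc htop R
  obtain ⟨A, hAR, -, hAG, hAt, -⟩ := exists_strictly_triangular hp.mono hc htop hRR' hR' hε hcε G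
    hG hG1 (fun z => Submodule.mem_sup_left ⟨z, rfl⟩) hGε
  obtain ⟨B, -, hBR, hBG, -, hBt⟩ := exists_strictly_triangular hp.mono hc htop hRR' hR' hε hcε G'
    hG' hG1' (fun z => Submodule.mem_sup_right ⟨z, rfl⟩) hGε'
  obtain ⟨V, hVW, hVn, hVq, hVq'⟩ := hp.exists_isometryOn_chain hd hq habs hc hbot htop R' W
  set C := ContinuousLinearMap.adjoint B with hC
  have hCG : ‖C - G'‖ ≤ 3 * ε := by
    have : C - G' = ContinuousLinearMap.adjoint (B - G') := by
      rw [map_sub, hG'.adjoint_eq]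
    rw [this, LinearIsometryEquiv.norm_map]; exact hBG
  have hAG' : ∀ z, ‖A z - G z‖ ≤ 3 * ε * ‖z‖ := (A - G).le_of_opNorm_le hAG
  have hCG' : ∀ z, ‖C z - G' z‖ ≤ 3 * ε * ‖z‖ := (C - G').le_of_opNorm_le hCG
  have hVi : ∀ x ∈ R', ∀ y ∈ R', inner ℂ (V x) (V y) = inner ℂ x y := by
    intro x hx y hy
    let J : R' →ₗᵢ[ℂ] Y := ⟨(V : X →ₗ[ℂ] Y) ∘ₗ R'.subtype, fun x => hVn x x.2⟩
    exact J.inner_map_map ⟨x, hx⟩ ⟨y, hy⟩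
  refine ⟨V ∘L A, V ∘L C, R'.map (V : X →ₗ[ℂ] Y), inferInstance, ?_, fun z => ⟨_, hAR z, rfl⟩,
    fun z => ⟨_, hBR z, rfl⟩, ?_, ?_, ?_, ?_, ?_⟩
  · rintro _ ⟨x, -, rfl⟩; exact hVW x
  · intro i z hz
    obtain ⟨k, hk, hk'⟩ := exists_le_le_succ h0 hn i
    exact hq hk (hVq k _ (hAt k z (hp.mono hk' hz)))
  · intro i z hz
    obtain ⟨k, hk, hk'⟩ := exists_le_le_succ h0 hn i
    exact Submodule.orthogonal_le (hq hk')
      (hVq' (k + 1) _ (hBt k z (Submodule.orthogonal_le (hp.mono hk) hz)))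
  · intro z
    have h1 : ‖V (A z)‖ = ‖A z‖ := hVn _ (hAR z)
    rw [ContinuousLinearMap.comp_apply, h1]
    exact (norm_le_norm_add_norm_sub' _ (G z)).trans (by gcongr; exact hAG' z)
  · intro z
    have h1 : ‖V (C z)‖ = ‖C z‖ := hVn _ (hBR z)
    rw [ContinuousLinearMap.comp_apply, h1]
    exact (norm_le_norm_add_norm_sub' _ (G' z)).trans (by gcongr; exact hCG' z)
  · intro z w
    rw [ContinuousLinearMap.comp_apply, ContinuousLinearMap.comp_apply, hVi _ (hAR z) _ (hBR w)]
    have h1 : inner ℂ (A z) (C w) - inner ℂ (G z) (G' w) =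
        inner ℂ (A z - G z) (C w) + inner ℂ (G z) (C w - G' w) := by
      rw [inner_sub_left, inner_sub_right]; ring
    have h2 : ‖C w‖ ≤ 4 * ‖w‖ := by
      have h3 := norm_le_norm_add_norm_sub' (C w) (G' w)
      nlinarith [hCG' w, hG1' w, norm_nonneg w]
    rw [h1]
    refine (norm_add_le _ _).trans ((add_le_add (norm_inner_le_norm _ _)
      (norm_inner_le_norm _ _)).trans ?_)
    have h4 : ‖A z - G z‖ * ‖C w‖ ≤ (3 * ε * ‖z‖) * (4 * ‖w‖) :=
      mul_le_mul (hAG' z) h2 (norm_nonneg _) (by positivity)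
    have h5 : ‖G z‖ * ‖C w - G' w‖ ≤ ‖z‖ * (3 * ε * ‖w‖) :=
      mul_le_mul (hG1 z) (hCG' w) (norm_nonneg _) (by positivity)
    refine (add_le_add h4 h5).trans (le_of_eq ?_)
    ring

end Block

section StrongSum

variable {X Y : Type*} [NormedAddCommGroup X] [InnerProductSpace ℂ X] [CompleteSpace X]
  [NormedAddCommGroup Y] [InnerProductSpace ℂ Y] [CompleteSpace Y]

/-- Operators with pairwise orthogonal ranges which are square summable on each vector have a
strongly convergent sum. -/
lemma exists_hasSum_of_orthogonal_ranges {W : ℕ → Submodule ℂ Y}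
    (hW : Pairwise fun i j => W i ⟂ W j) (T : ℕ → X →L[ℂ] Y) (hT : ∀ k z, T k z ∈ W k)
    (hs : ∀ z, Summable fun k => ‖T k z‖ ^ 2) :
    ∃ B : X →L[ℂ] Y, ∀ z, HasSum (fun k => T k z) (B z) := by
  have hO : OrthogonalFamily ℂ (fun i => W i) (fun i => (W i).subtypeₗᵢ) :=
    OrthogonalFamily.of_pairwise hW
  have hsum : ∀ z, Summable fun k => T k z := fun z =>
    (hO.summable_iff_norm_sq_summable fun k => (⟨T k z, hT k z⟩ : W k)).2 (hs z)
  refine ⟨continuousLinearMapOfTendsto (l := atTop) (fun n => ∑ k ∈ Finset.range n, T k)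
    (f := fun z => ∑' k, T k z) (tendsto_pi_nhds.2 fun z => ?_), fun z => (hsum z).hasSum⟩
  simpa [sum_apply] using (hsum z).hasSum.tendsto_sum_nat

/-- An operator close to the identity has an inverse preserving the invariant closed subspaces. -/
lemma exists_inverse_of_norm_sub_one_lt {T : X →L[ℂ] X} (h : ‖1 - T‖ < 1) :
    ∃ S : X →L[ℂ] X, S * T = 1 ∧ ∀ K : Submodule ℂ X, IsClosed (K : Set X) →
      (∀ x ∈ K, T x ∈ K) → ∀ x ∈ K, S x ∈ K := by
  refine ⟨∑' n : ℕ, (1 - T) ^ n, ?_, fun K hK hT x hx => ?_⟩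
  · have := geom_series_mul_neg (1 - T) h
    rwa [sub_sub_cancel] at this
  · have h1 := (summable_geometric_of_norm_lt_one h).hasSum.mapL
      (ContinuousLinearMap.apply ℂ X x)
    refine hK.mem_of_tendsto h1.tendsto_sum_nat (Eventually.of_forall fun n => ?_)
    refine K.sum_mem fun k hk => ?_
    clear hk
    change ((1 - T) ^ k) x ∈ K
    induction k with
    | zero => simpa
    | succ k ih =>
      rw [pow_succ', mul_apply_eq_comp, sub_apply, one_apply_eq_self]
      exact K.sub_mem ih (hT _ ih)

variable {ι : Type*} [LinearOrder ι] {p : ι → Submodule ℂ X} {q : ι → Submodule ℂ Y}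

/-- **Absorption**: a space with an atomless nest is a nested complemented part of any space
whose nest separates at least the same indices. -/
theorem NestFamily.exists_absorb [TopologicalSpace.SeparableSpace X] (hp : NestFamily p)
    (hd : ∀ i j, i ⋖ j → p i = p j) (hq : Monotone q) (hqc : ∀ i, IsClosed (q i : Set Y))
    (habs : ∀ i j, i ≤ j → q i = q j → p i = p j) :
    ∃ (B : X →L[ℂ] Y) (A : Y →L[ℂ] X), (∀ i, ∀ x ∈ p i, B x ∈ q i) ∧
      (∀ i, ∀ y ∈ q i, A y ∈ p i) ∧ ∀ x, A (B x) = x := by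
  have hpo : ∀ i, (p i).HasOrthogonalProjection := hp.hasOrthogonalProjection
  have hqo : ∀ i, (q i).HasOrthogonalProjection := fun i => by
    have : CompleteSpace (q i) := (hqc i).completeSpace_coe
    infer_instance
  set e : ℕ → ℝ := fun k => 1 / 60 * (1 / 2) ^ k with he
  have he0 : ∀ k, 0 < e k := fun k => by positivity
  have hem : Antitone e := fun i j hij => by
    simp only [he]
    gcongr ?_ * ?_
    exact pow_le_pow_of_le_one (by norm_num) (by norm_num) hij
  have he1 : ∀ k, e k ≤ 1 := fun k => (hem (Nat.zero_le k)).trans (by norm_num [he])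
  have hes : HasSum e (1 / 30) := by
    have h2 : (1 / 60 : ℝ) * 2 = 1 / 30 := by norm_num
    rw [← h2]
    exact hasSum_geometric_two.mul_left _
  obtain ⟨F, hF0, hF1, hFn, hFle, hFf, hFF, hFε, hFt⟩ := hp.exists_seq_quasicentral hd
    (ε := fun k => e k / 2) (fun k => half_pos (he0 k))
  have hFm : Monotone F := monotone_nat_of_le_succ fun k =>
    le_of_mul_eq (hFn k) (hFle k) (hFn (k + 1)) (hFF k)
  have hsub : ∀ i j, i ≤ j → 0 ≤ F j - F i ∧ F j - F i ≤ 1 := fun i j hij =>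
    ⟨sub_nonneg.2 (hFm hij), (sub_le_self _ (hFn i)).trans (hFle j)⟩
  have hFF' : ∀ i j, i < j → F j * F i = F i := by
    intro i j hij
    induction j, hij using Nat.le_induction with
    | base => exact hFF i
    | succ j hj ih => rw [← ih, ← mul_assoc, hFF]
  set G : ℕ → X →L[ℂ] X := fun k => F (k + 2) - F (k + 1) with hG
  set G' : ℕ → X →L[ℂ] X := fun k => F (k + 3) - F k with hG'
  have hGG : ∀ k, G' k * G k = G k := by
    intro k
    have h2 : ∀ i j, i < j → F i * F j = F i := fun i j hij =>
      mul_eq_left_of_mul_eq (hFn i) (hFn j) (hFF' i j hij)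
    simp only [hG, hG', sub_mul, mul_sub]
    rw [hFF' (k + 2) (k + 3) (by omega), hFF' (k + 1) (k + 3) (by omega),
      h2 k (k + 2) (by omega), h2 k (k + 1) (by omega)]
    abel
  have hfin : ∀ i j, FiniteDimensional ℂ ((F i - F j : X →L[ℂ] X) : X →ₗ[ℂ] X).range := by
    intro i j
    have := hFf i
    have := hFf j
    refine Submodule.finiteDimensional_of_le
      (S₂ := (F i : X →ₗ[ℂ] X).range ⊔ (F j : X →ₗ[ℂ] X).range) ?_
    rintro _ ⟨x, rfl⟩
    exact sub_mem (Submodule.mem_sup_left ⟨x, rfl⟩) (Submodule.mem_sup_right ⟨x, rfl⟩)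
  have hcorner : ∀ k a b, k ≤ a → k ≤ b → ∀ i z,
      ‖(p i)ᗮ.starProjection ((F a - F b) ((p i).starProjection z))‖ ≤ e k * ‖z‖ := by
    intro k a b ha hb i z
    rw [sub_apply, map_sub]
    refine (norm_sub_le _ _).trans ((add_le_add (hFε a i z) (hFε b i z)).trans ?_)
    have := hem ha
    have := hem hb
    rw [← add_mul]
    gcongr
    linarith
  have step : ∀ (k : ℕ) (W : Submodule ℂ Y), FiniteDimensional ℂ W →
      ∃ (T T' : X →L[ℂ] Y) (W' : Submodule ℂ Y), FiniteDimensional ℂ W' ∧ W' ≤ Wᗮ ∧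
      (∀ z, T z ∈ W') ∧ (∀ z, T' z ∈ W') ∧ (∀ i, ∀ z ∈ p i, T z ∈ q i) ∧
      (∀ i, ∀ z ∈ (p i)ᗮ, T' z ∈ (q i)ᗮ) ∧ (∀ z, ‖T z‖ ≤ ‖G k z‖ + 3 * e k * ‖z‖) ∧
      (∀ z, ‖T' z‖ ≤ ‖G' k z‖ + 3 * e k * ‖z‖) ∧
      ∀ z w, ‖inner ℂ (T z) (T' w) - inner ℂ (G k z) (G' k w)‖ ≤ 15 * e k * (‖z‖ * ‖w‖) := by
    intro k W hW
    have h1 := hsub (k + 1) (k + 2) (by omega)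
    have h2 := hsub k (k + 3) (by omega)
    exact hp.exists_transplant hd hq habs (he0 k) (he1 k) (G k) (G' k)
      (IsSelfAdjoint.of_nonneg h1.1) (IsSelfAdjoint.of_nonneg h2.1)
      (norm_apply_le_of_le_one h1.1 h1.2) (norm_apply_le_of_le_one h2.1 h2.2) (hfin _ _) (hfin _ _)
      (hcorner k _ _ (by omega) (by omega)) (hcorner k _ _ (by omega) (by omega)) W
  choose! t t' w hwf hwW htw htw' htq htq' htn htn' hin using step
  set V : ℕ → Submodule ℂ Y := fun k => Nat.rec ⊥ (fun k W => W ⊔ w k W) k with hV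
  have hVs : ∀ k, V (k + 1) = V k ⊔ w k (V k) := fun k => rfl
  have hVf : ∀ k, FiniteDimensional ℂ (V k) := by
    intro k
    induction k with
    | zero => exact inferInstanceAs (FiniteDimensional ℂ (⊥ : Submodule ℂ Y))
    | succ k ih =>
      have := hwf k _ ih
      rw [hVs]; infer_instance
  have hVm : Monotone V := monotone_nat_of_le_succ fun k => by rw [hVs]; exact le_sup_left
  have hlt : ∀ i j, i < j → w i (V i) ⟂ w j (V j) := by
    intro i j hij
    have h1 : w i (V i) ≤ V j := (hVs i ▸ le_sup_right : _ ≤ V (i + 1)).trans (hVm hij)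
    exact (Submodule.isOrtho_iff_le.2 ((hwW j _ (hVf j)).trans
      (Submodule.orthogonal_le h1))).symm
  have hort : Pairwise fun i j => w i (V i) ⟂ w j (V j) := by
    intro i j hij
    rcases lt_or_gt_of_ne hij with h | h
    · exact hlt i j h
    · exact (hlt j i h).symm
  set T : ℕ → X →L[ℂ] Y := fun k => t k (V k) with hT
  set T' : ℕ → X →L[ℂ] Y := fun k => t' k (V k) with hT'
  have hsq : ∀ (f : ℕ → ℝ) (g : ℕ → ℝ) (z : X) (c : ℝ), (∀ k, 0 ≤ g k) → (∀ k, 0 ≤ f k) →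
      (∀ k, f k ≤ g k + 3 * e k * ‖z‖) →
      (∀ n, ∑ k ∈ Finset.range n, g k ^ 2 ≤ c) → Summable fun k => f k ^ 2 := by
    intro f g z c hg hf hfg hc
    have h1 : Summable fun k => g k ^ 2 :=
      summable_of_sum_range_le (fun k => by positivity) hc
    have h2 : Summable fun k => 18 * ‖z‖ ^ 2 * e k := hes.summable.mul_left _
    refine Summable.of_nonneg_of_le (fun k => by positivity) (fun k => ?_)
      ((h1.mul_left 2).add h2)
    have h3 : f k ^ 2 ≤ (g k + 3 * e k * ‖z‖) ^ 2 := pow_le_pow_left₀ (hf k) (hfg k) 2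
    have h4 : e k ^ 2 ≤ e k := by nlinarith [he0 k, he1 k]
    have h5 : e k ^ 2 * ‖z‖ ^ 2 ≤ e k * ‖z‖ ^ 2 := by gcongr
    nlinarith [sq_nonneg (g k - 3 * e k * ‖z‖)]
  have hFre : ∀ k z, 0 ≤ (inner ℂ (F k z) z).re ∧ (inner ℂ (F k z) z).re ≤ ‖z‖ ^ 2 := by
    intro k z
    constructor
    · have := re_inner_le_of_le (hFn k) z
      simpa using this
    · exact (re_inner_le_of_le (hFle k) z).trans (le_of_eq (inner_self_eq_norm_sq (𝕜 := ℂ) z))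
  have hsubre : ∀ i j z, (inner ℂ ((F j - F i) z) z).re =
      (inner ℂ (F j z) z).re - (inner ℂ (F i z) z).re := fun i j z => by
    rw [sub_apply, inner_sub_left, Complex.sub_re]
  obtain ⟨B, hB⟩ := exists_hasSum_of_orthogonal_ranges hort T (fun k z => htw k _ (hVf k) z)
    (fun z => hsq _ (fun k => ‖G k z‖) z (‖z‖ ^ 2) (fun _ => norm_nonneg _)
      (fun _ => norm_nonneg _) (fun k => htn k _ (hVf k) z) fun n => by
        have h1 : ∀ k, ‖G k z‖ ^ 2 ≤ (inner ℂ (F (k + 2) z) z).re - (inner ℂ (F (k + 1) z) z).re :=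
          fun k => by
            have h2 := hsub (k + 1) (k + 2) (by omega)
            rw [← hsubre]; exact norm_sq_apply_le_of_le_one h2.1 h2.2 z
        refine (Finset.sum_le_sum fun k _ => h1 k).trans ?_
        rw [Finset.sum_range_sub (fun k => (inner ℂ (F (k + 1) z) z).re)]
        linarith [(hFre (n + 1) z).2, (hFre (0 + 1) z).1])
  obtain ⟨C, hC⟩ := exists_hasSum_of_orthogonal_ranges hort T' (fun k z => htw' k _ (hVf k) z)
    (fun z => hsq _ (fun k => ‖G' k z‖) z (3 * ‖z‖ ^ 2) (fun _ => norm_nonneg _)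
      (fun _ => norm_nonneg _) (fun k => htn' k _ (hVf k) z) fun n => by
        have h1 : ∀ k, ‖G' k z‖ ^ 2 ≤ (inner ℂ (F (k + 3) z) z).re - (inner ℂ (F k z) z).re :=
          fun k => by
            have h2 := hsub k (k + 3) (by omega)
            rw [← hsubre]; exact norm_sq_apply_le_of_le_one h2.1 h2.2 z
        have h3 : ∑ k ∈ Finset.range n, ‖G' k z‖ ^ 2 ≤ (inner ℂ (F n z) z).re +
            (inner ℂ (F (n + 1) z) z).re + (inner ℂ (F (n + 2) z) z).re := by
          induction n with
          | zero => simpa using add_nonneg (add_nonneg (hFre 0 z).1 (hFre 1 z).1) (hFre 2 z).1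
          | succ n ih =>
            rw [Finset.sum_range_succ]
            have := h1 n
            have e1 : n + 1 + 1 = n + 2 := rfl
            have e2 : n + 1 + 2 = n + 3 := rfl
            rw [e1, e2]
            linarith
        linarith [(hFre n z).2, (hFre (n + 1) z).2, (hFre (n + 2) z).2])
  set A := ContinuousLinearMap.adjoint C with hA
  have hBq : ∀ i, ∀ x ∈ p i, B x ∈ q i := fun i x hx =>
    (hqc i).mem_of_tendsto (hB x).tendsto_sum_nat
      (Eventually.of_forall fun n => (q i).sum_mem fun k _ => htq k _ (hVf k) i x hx)
  have hCq : ∀ i, ∀ x ∈ (p i)ᗮ, C x ∈ (q i)ᗮ := fun i x hx =>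
    (q i).isClosed_orthogonal.mem_of_tendsto (hC x).tendsto_sum_nat
      (Eventually.of_forall fun n => (q i)ᗮ.sum_mem fun k _ => htq' k _ (hVf k) i x hx)
  have hAq : ∀ i, ∀ y ∈ q i, A y ∈ p i := by
    intro i y hy
    rw [← Submodule.orthogonal_orthogonal (p i), Submodule.mem_orthogonal]
    intro x hx
    rw [hA, ContinuousLinearMap.adjoint_inner_right]
    exact Submodule.inner_left_of_mem_orthogonal hy (hCq i x hx)
  have hortT : ∀ i j, i ≠ j → ∀ x y, inner ℂ (T i x) (T' j y) = 0 := fun i j hij x y =>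
    (Submodule.isOrtho_iff_inner_eq.1 (hort hij)) _ (htw i _ (hVf i) x) _ (htw' j _ (hVf j) y)
  have hbound : ∀ z y, ‖inner ℂ (A (B z)) y - inner ℂ z y‖ ≤ 1 / 2 * (‖z‖ * ‖y‖) := by
    intro z y
    have h1 : Tendsto (fun n => inner ℂ (∑ k ∈ Finset.range n, T k z)
        (∑ k ∈ Finset.range n, T' k y)) atTop (𝓝 (inner ℂ (A (B z)) y)) := by
      rw [hA, ContinuousLinearMap.adjoint_inner_left]
      exact (hB z).tendsto_sum_nat.inner (hC y).tendsto_sum_nat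
    have h2 : Tendsto (fun n => ∑ k ∈ Finset.range n, inner ℂ (G k z) (G' k y)) atTop
        (𝓝 (inner ℂ z y)) := by
      have h3 : ∀ n, ∑ k ∈ Finset.range n, inner ℂ (G k z) (G' k y) =
          inner ℂ (F (n + 1) z) y := by
        intro n
        have h4 : ∀ k, inner ℂ (G k z) (G' k y) =
            inner ℂ (F (k + 1 + 1) z) y - inner ℂ (F (k + 1) z) y := by
          intro k
          have h5 : ContinuousLinearMap.adjoint (G' k) = G' k :=
            (IsSelfAdjoint.of_nonneg (hsub k (k + 3) (by omega)).1).adjoint_eq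
          rw [← ContinuousLinearMap.adjoint_inner_left, h5, ← mul_apply_eq_comp, hGG,
            ← inner_sub_left]
          rfl
        simp only [h4]
        rw [Finset.sum_range_sub (fun k => inner ℂ (F (k + 1) z) y), zero_add, hF1]
        simp
      simp only [h3]
      exact ((tendsto_add_atTop_iff_nat 1).2 (hFt z)).inner tendsto_const_nhds
    refine le_of_tendsto' (h1.sub h2).norm fun n => ?_
    have h6 : inner ℂ (∑ k ∈ Finset.range n, T k z) (∑ k ∈ Finset.range n, T' k y) =
        ∑ k ∈ Finset.range n, inner ℂ (T k z) (T' k y) := by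
      rw [sum_inner]
      refine Finset.sum_congr rfl fun k hk => ?_
      rw [inner_sum]
      exact Finset.sum_eq_single_of_mem k hk fun l _ hl => hortT k l hl.symm z y
    rw [h6, ← Finset.sum_sub_distrib]
    refine (norm_sum_le _ _).trans ((Finset.sum_le_sum fun k _ =>
      hin k _ (hVf k) z y).trans ?_)
    rw [← Finset.sum_mul, ← Finset.mul_sum]
    gcongr
    have := sum_le_hasSum (Finset.range n) (fun k _ => (he0 k).le) hes
    linarith
  have hAB : ‖1 - A ∘L B‖ < 1 := by
    refine lt_of_le_of_lt (b := 1 / 2) ?_ (by norm_num)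
    refine ContinuousLinearMap.opNorm_le_bound _ (by norm_num) fun z => ?_
    set v := (1 - A ∘L B) z with hv
    have h1 := hbound z v
    have h2 : inner ℂ (A (B z)) v - inner ℂ z v = - inner ℂ v v := by
      rw [← inner_sub_left, ← inner_neg_left, hv]
      simp
    rw [h2, norm_neg, inner_self_eq_norm_sq_to_K] at h1
    have h3 : ‖((‖v‖ : ℂ)) ^ 2‖ = ‖v‖ * ‖v‖ := by simp [sq]
    have h4 : ‖v‖ * ‖v‖ ≤ 1 / 2 * (‖z‖ * ‖v‖) := h3 ▸ h1
    rcases (norm_nonneg v).eq_or_lt with h0 | h0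
    · rw [← h0]; positivity
    · refine le_of_mul_le_mul_right (h4.trans (le_of_eq (by ring))) h0
  obtain ⟨S, hS, hSK⟩ := exists_inverse_of_norm_sub_one_lt hAB
  refine ⟨B, S ∘L A, hBq, fun i y hy => ?_, fun x => ?_⟩
  · exact hSK (p i) (hp.closed i) (fun x hx => hAq i _ (hBq i x hx)) _ (hAq i y hy)
  · exact congrArg (fun U : X →L[ℂ] X => U x) hS

end StrongSum

section NestIso

/-- Two families of subspaces are *similar* if some invertible operator carries each of them into
the other. -/
def NestIso {X Y ι : Type*} [NormedAddCommGroup X] [NormedSpace ℂ X] [NormedAddCommGroup Y]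
    [NormedSpace ℂ Y] (p : ι → Submodule ℂ X) (q : ι → Submodule ℂ Y) : Prop :=
  ∃ (f : X →L[ℂ] Y) (g : Y →L[ℂ] X), (∀ i, ∀ x ∈ p i, f x ∈ q i) ∧
    (∀ i, ∀ y ∈ q i, g y ∈ p i) ∧ (∀ x, g (f x) = x) ∧ ∀ y, f (g y) = y

namespace NestIso

variable {X Y Z ι : Type*} [NormedAddCommGroup X] [NormedSpace ℂ X] [NormedAddCommGroup Y]
  [NormedSpace ℂ Y] [NormedAddCommGroup Z] [NormedSpace ℂ Z]
  {p : ι → Submodule ℂ X} {q : ι → Submodule ℂ Y} {r : ι → Submodule ℂ Z}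

lemma symm (h : NestIso p q) : NestIso q p := by
  obtain ⟨f, g, hf, hg, hgf, hfg⟩ := h
  exact ⟨g, f, hg, hf, hfg, hgf⟩

lemma trans (h : NestIso p q) (h' : NestIso q r) : NestIso p r := by
  obtain ⟨f, g, hf, hg, hgf, hfg⟩ := h
  obtain ⟨f', g', hf', hg', hgf', hfg'⟩ := h'
  exact ⟨f' ∘L f, g ∘L g', fun i x hx => hf' i _ (hf i x hx), fun i x hx => hg i _ (hg' i x hx),
    fun x => by simp [hgf', hgf], fun x => by simp [hfg', hfg]⟩

end NestIso

end NestIso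

section Resolution

variable {X Y ι J : Type*} [NormedAddCommGroup X] [InnerProductSpace ℂ X]
  [NormedAddCommGroup Y] [InnerProductSpace ℂ Y] [LinearOrder ι] {p : ι → Submodule ℂ X}

/-- A space resolved into pieces of a nested space inherits the nest. -/
lemma NestFamily.of_resolution (hp : NestFamily p) {q : ι → Submodule ℂ Y} (u : J → Y →L[ℂ] X)
    (v : J → X →L[ℂ] Y) (hq : ∀ i y, y ∈ q i ↔ ∀ k, u k y ∈ p i)
    (hv : ∀ k i, ∀ x ∈ p i, v k x ∈ q i) (huv : ∀ y, HasSum (fun k => v k (u k y)) y) :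
    NestFamily q where
  closed i := by
    have : (q i : Set Y) = ⋂ k, (u k) ⁻¹' (p i : Set X) := by
      ext y; simp [hq]
    rw [this]
    exact isClosed_iInter fun k => (hp.closed i).preimage (u k).continuous
  mono i j hij y hy := (hq j y).2 fun k => hp.mono hij ((hq i y).1 hy k)
  exists_bot := by
    obtain ⟨i, hi⟩ := hp.exists_bot
    refine ⟨i, (Submodule.eq_bot_iff _).2 fun y hy => ?_⟩
    have h1 : ∀ k, u k y = 0 := fun k => (Submodule.mem_bot ℂ).1 (hi ▸ (hq i y).1 hy k)
    have h2 := huv y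
    simp only [h1, map_zero] at h2
    exact h2.unique hasSum_zero
  exists_top := by
    obtain ⟨i, hi⟩ := hp.exists_top
    exact ⟨i, (Submodule.eq_top_iff').2 fun y => (hq i y).2 fun k => hi ▸ trivial⟩
  sup S hS := by
    obtain ⟨t, ht, htp⟩ := hp.sup S hS
    refine ⟨t, ht, fun y hy => ?_⟩
    have h1 : ∀ k, v k (u k y) ∈ (⨆ i : S, q i).topologicalClosure := by
      intro k
      have h2 : (⨆ i : S, p i).topologicalClosure ≤
          ((⨆ i : S, q i).topologicalClosure).comap (v k : X →ₗ[ℂ] Y) := by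
        refine Submodule.topologicalClosure_minimal _ (iSup_le fun i x hx => ?_)
          ((Submodule.isClosed_topologicalClosure _).preimage (v k).continuous)
        exact Submodule.le_topologicalClosure _ (le_iSup (fun i : S => q i) i (hv k i x hx))
      exact h2 (htp ((hq t y).1 hy k))
    exact (Submodule.isClosed_topologicalClosure _).mem_of_tendsto (huv y)
      (Eventually.of_forall fun s => Submodule.sum_mem _ fun k _ => h1 k)
  inf S hS := by
    obtain ⟨t, ht, htp⟩ := hp.inf S hS
    refine ⟨t, ht, fun y hy => (hq t y).2 fun k => htp ?_⟩
    rw [Submodule.mem_iInf] at hy ⊢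
    exact fun i => (hq i y).1 (hy i) k

end Resolution

section Amplification

variable {X ι : Type*} [NormedAddCommGroup X] [InnerProductSpace ℂ X]

/-- The Hilbert sum of copies of a subspace. -/
def ampl (J : Type*) (p : Submodule ℂ X) : Submodule ℂ (lp (fun _ : J => X) 2) where
  carrier := {f | ∀ k, f k ∈ p}
  add_mem' hf hg k := p.add_mem (hf k) (hg k)
  zero_mem' _ := p.zero_mem
  smul_mem' c _ hf k := p.smul_mem c (hf k)

lemma single_mem_ampl {J : Type*} [DecidableEq J] {p : Submodule ℂ X} (k : J) {x : X}
    (hx : x ∈ p) : lp.single 2 k x ∈ ampl J p := by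
  intro l
  rw [lp.single_apply]
  by_cases h : l = k
  · subst h; simpa
  · simp [h]

lemma NestFamily.amplify [LinearOrder ι] {p : ι → Submodule ℂ X} (hp : NestFamily p) (J : Type*)
    [DecidableEq J] : NestFamily (fun i => ampl J (p i)) :=
  hp.of_resolution (fun k => lp.evalCLM ℂ (fun _ : J => X) 2 k)
    (fun k => lp.singleContinuousLinearMap ℂ (fun _ : J => X) 2 k) (fun i y => Iff.rfl)
    (fun k i x hx => single_mem_ampl k hx)
    (fun y => lp.hasSum_single (by norm_num) y)

lemma separableSpace_ampl [TopologicalSpace.SeparableSpace X] (J : Type*) [Countable J]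
    [DecidableEq J] : TopologicalSpace.SeparableSpace (lp (fun _ : J => X) 2) := by
  have h1 : TopologicalSpace.IsSeparable (⋃ k : J,
      Set.range (lp.singleContinuousLinearMap ℂ (fun _ : J => X) 2 k)) :=
    .iUnion fun k => TopologicalSpace.isSeparable_range
      (lp.singleContinuousLinearMap ℂ (fun _ : J => X) 2 k).continuous
  have h2 := (h1.span (R := ℂ)).closure
  rw [← TopologicalSpace.isSeparable_univ_iff]
  refine h2.mono fun f _ => ?_
  refine mem_closure_of_tendsto (lp.hasSum_single (by norm_num) f)
    (Eventually.of_forall fun s => ?_)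
  exact Submodule.sum_mem _ fun k _ => Submodule.subset_span (Set.mem_iUnion.2 ⟨k, f k, rfl⟩)

/-- The left shift on the Hilbert sum of countably many copies of a space. -/
lemma exists_left_shift : ∃ T : lp (fun _ : ℕ => X) 2 →L[ℂ] lp (fun _ : ℕ => X) 2,
    ∀ f k, T f k = f (k + 1) := by
  have h2 : (0 : ℝ) < (2 : ENNReal).toReal := by norm_num
  have hm : ∀ f : lp (fun _ : ℕ => X) 2, Memℓp (fun k => f (k + 1)) 2 := fun f =>
    memℓp_gen ((summable_nat_add_iff 1).2 ((lp.memℓp f).summable h2))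
  let L : lp (fun _ : ℕ => X) 2 →ₗ[ℂ] lp (fun _ : ℕ => X) 2 :=
    { toFun := fun f => ⟨fun k => f (k + 1), hm f⟩
      map_add' := fun f g => by ext k; rfl
      map_smul' := fun c f => by ext k; rfl }
  refine ⟨L.mkContinuous 1 fun f => ?_, fun f k => rfl⟩
  rw [one_mul]
  refine lp.norm_le_of_tsum_le h2 (norm_nonneg f) ?_
  rw [lp.norm_rpow_eq_tsum h2 f, ((lp.memℓp f).summable h2).tsum_eq_zero_add]
  exact le_add_of_nonneg_left (by positivity)

/-- The right shift on the Hilbert sum of countably many copies of a space. -/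
lemma exists_right_shift : ∃ T : lp (fun _ : ℕ => X) 2 →L[ℂ] lp (fun _ : ℕ => X) 2,
    ∀ f, T f 0 = 0 ∧ ∀ k, T f (k + 1) = f k := by
  have h2 : (0 : ℝ) < (2 : ENNReal).toReal := by norm_num
  let t : lp (fun _ : ℕ => X) 2 → ℕ → X := fun f k => Nat.casesOn k 0 fun k => f k
  have hm : ∀ f : lp (fun _ : ℕ => X) 2, Memℓp (t f) 2 := fun f =>
    memℓp_gen ((summable_nat_add_iff 1).1 ((lp.memℓp f).summable h2))
  let L : lp (fun _ : ℕ => X) 2 →ₗ[ℂ] lp (fun _ : ℕ => X) 2 :=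
    { toFun := fun f => ⟨t f, hm f⟩
      map_add' := fun f g => by ext k; cases k with
        | zero => exact (add_zero (0 : X)).symm
        | succ k => rfl
      map_smul' := fun c f => by ext k; cases k with
        | zero => exact (smul_zero c).symm
        | succ k => rfl }
  refine ⟨L.mkContinuous 1 fun f => ?_, fun f => ⟨rfl, fun k => rfl⟩⟩
  rw [one_mul]
  refine lp.norm_le_of_tsum_le h2 (norm_nonneg f) ?_
  have h3 : ‖t f 0‖ ^ (2 : ENNReal).toReal = 0 := by simp [t]
  rw [lp.norm_rpow_eq_tsum h2 f]
  refine le_of_eq ((((hm f).summable h2).tsum_eq_zero_add).trans ?_)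
  rw [h3, zero_add]

end Amplification

section Swindle

variable {X Y ι : Type*} [NormedAddCommGroup X] [InnerProductSpace ℂ X] [CompleteSpace X]
  [NormedAddCommGroup Y] [InnerProductSpace ℂ Y] [CompleteSpace Y]
  [LinearOrder ι] {p : ι → Submodule ℂ X} {q : ι → Submodule ℂ Y}

/-- A space with an atomless nest can be swallowed by any space whose nest separates at least the
same indices. -/
theorem NestFamily.nestIso_prod [TopologicalSpace.SeparableSpace X] (hp : NestFamily p)
    (hd : ∀ i j, i ⋖ j → p i = p j) (hq : Monotone q) (hqc : ∀ i, IsClosed (q i : Set Y))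
    (habs : ∀ i j, i ≤ j → q i = q j → p i = p j) :
    NestIso (fun i => (q i).prod (p i)) q := by
  have := separableSpace_ampl (X := X) ℕ
  obtain ⟨B, A, hB, hA, hAB⟩ := (hp.amplify ℕ).exists_absorb
    (fun i j hij => by rw [hd i j hij]) hq hqc (fun i j hij h => by rw [habs i j hij h])
  obtain ⟨s, hs⟩ := exists_right_shift (X := X)
  obtain ⟨t, ht⟩ := exists_left_shift (X := X)
  let j := lp.singleContinuousLinearMap ℂ (fun _ : ℕ => X) 2 0
  let e := lp.evalCLM ℂ (fun _ : ℕ => X) 2 0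
  have hts : ∀ z, t (s z) = z := fun z => by
    ext k; rw [ht, (hs z).2]
  have hes : ∀ z, e (s z) = 0 := fun z => (hs z).1
  have hej : ∀ x, e (j x) = x := fun x => lp.single_apply_self (E := fun _ : ℕ => X) 2 0 x
  have htj : ∀ x, t (j x) = 0 := fun x => by
    ext k
    rw [ht]
    exact lp.single_apply_ne (E := fun _ : ℕ => X) 2 0 x (by omega)
  have hst : ∀ z, s (t z) + j (e z) = z := fun z => by
    ext k
    rw [lp.coeFn_add, Pi.add_apply]
    cases k with
    | zero => rw [(hs _).1, zero_add]; exact lp.single_apply_self (E := fun _ : ℕ => X) 2 0 _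
    | succ k =>
      rw [(hs _).2, ht]
      have : (j (e z) : ∀ _ : ℕ, X) (k + 1) = 0 := lp.single_apply_ne (E := fun _ : ℕ => X) 2 0 _ (by omega)
      rw [this, add_zero]
  have hsp : ∀ i, ∀ z ∈ ampl ℕ (p i), s z ∈ ampl ℕ (p i) := fun i z hz k => by
    cases k with
    | zero => rw [(hs _).1]; exact zero_mem _
    | succ k => rw [(hs _).2]; exact hz k
  have htp : ∀ i, ∀ z ∈ ampl ℕ (p i), t z ∈ ampl ℕ (p i) := fun i z hz k => by
    rw [ht]; exact hz _
  let F : Y × X →L[ℂ] Y := ((1 - B ∘L A) + B ∘L s ∘L A).coprod (B ∘L j)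
  let G : Y →L[ℂ] Y × X := ((1 - B ∘L A) + B ∘L t ∘L A).prod (e ∘L A)
  have hF : ∀ y x, F (y, x) = y - B (A y) + B (s (A y)) + B (j x) := fun y x => by simp [F]
  have hG : ∀ y, G y = (y - B (A y) + B (t (A y)), e (A y)) := fun y => by simp [G]
  refine ⟨F, G, fun i x hx => ?_, fun i y hy => ?_, fun x => ?_, fun y => ?_⟩
  · rw [← Prod.mk.eta (p := x), hF]
    exact add_mem (add_mem (sub_mem hx.1 (hB i _ (hA i _ hx.1))) (hB i _ (hsp i _ (hA i _ hx.1))))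
      (hB i _ (single_mem_ampl 0 hx.2))
  · rw [hG]
    exact ⟨add_mem (sub_mem hy (hB i _ (hA i _ hy))) (hB i _ (htp i _ (hA i _ hy))), hA i _ hy 0⟩
  · obtain ⟨y, x⟩ := x
    rw [hF, hG]
    simp [hAB, hts, hes, hej, htj]
  · rw [hG, hF]
    simp only [map_add, map_sub, hAB, sub_self, zero_add]
    have h := congrArg B (hst (A y))
    rw [map_add] at h
    linear_combination (norm := module) h

end Swindle

section Reducing

variable {X ι : Type*} [NormedAddCommGroup X] [InnerProductSpace ℂ X]
  {p : ι → Submodule ℂ X}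

/-- The family induced on a subspace. -/
abbrev traceFamily (R : Submodule ℂ X) (p : ι → Submodule ℂ X) (i : ι) : Submodule ℂ R :=
  (p i).comap R.subtype

lemma NestFamily.trace [LinearOrder ι] (hp : NestFamily p) (R : Submodule ℂ X) [R.HasOrthogonalProjection]
    (hR : ∀ i, ∀ x ∈ p i, R.starProjection x ∈ p i) : NestFamily (traceFamily R p) :=
  hp.of_resolution (fun _ : Unit => R.subtypeL) (fun _ => R.orthogonalProjectionOnto)
    (fun i y => ⟨fun h _ => h, fun h => h ()⟩) (fun _ i x hx => hR i x hx)
    (fun y => by simp)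

lemma nestIso_trace_prod (R : Submodule ℂ X) [R.HasOrthogonalProjection]
    (hR : ∀ i, ∀ x ∈ p i, R.starProjection x ∈ p i) :
    NestIso p (fun i => (traceFamily R p i).prod (traceFamily Rᗮ p i)) := by
  have hR' : ∀ i, ∀ x ∈ p i, Rᗮ.starProjection x ∈ p i := fun i x hx => by
    rw [Submodule.starProjection_orthogonal_val]
    exact sub_mem hx (hR i x hx)
  refine ⟨R.orthogonalProjectionOnto.prod Rᗮ.orthogonalProjectionOnto, R.subtypeL.coprod Rᗮ.subtypeL,
    fun i x hx => ⟨hR i x hx, hR' i x hx⟩, fun i y hy => add_mem hy.1 hy.2, fun x => ?_,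
    fun y => ?_⟩
  · exact R.starProjection_add_starProjection_orthogonal x
  · obtain ⟨y, z⟩ := y
    refine Prod.ext ?_ ?_ <;> simp

end Reducing

section AtomicPart

variable {X ι : Type*} [NormedAddCommGroup X] [InnerProductSpace ℂ X] [LinearOrder ι]

/-- The difference of two members of a nest. -/
noncomputable def gap (p : ι → Submodule ℂ X) (i j : ι) : Submodule ℂ X := p j ⊓ (p i)ᗮ

/-- The closed span of the atoms of a nest. -/
noncomputable def atomicPart (p : ι → Submodule ℂ X) : Submodule ℂ X :=
  (⨆ c : {c : ι × ι // c.1 ⋖ c.2}, gap p c.1.1 c.1.2).topologicalClosure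

variable {p : ι → Submodule ℂ X}

lemma gap_le_atomicPart {i j : ι} (h : i ⋖ j) : gap p i j ≤ atomicPart p :=
  (le_iSup (fun c : {c : ι × ι // c.1 ⋖ c.2} => gap p c.1.1 c.1.2) ⟨(i, j), h⟩).trans
    (Submodule.le_topologicalClosure _)

/-- An atom lies below or above each member of the nest. -/
lemma gap_le_or_le_orthogonal (hp : Monotone p) {i j : ι} (h : i ⋖ j) (k : ι) :
    (j ≤ k ∧ gap p i j ≤ p k) ∨ gap p i j ≤ (p k)ᗮ := by
  rcases le_or_gt j k with hk | hk
  · exact Or.inl ⟨hk, inf_le_left.trans (hp hk)⟩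
  · exact Or.inr (inf_le_right.trans (Submodule.orthogonal_le (hp (h.le_of_lt hk))))

lemma gap_isOrtho (hp : Monotone p) {c d : {c : ι × ι // c.1 ⋖ c.2}} (h : c ≠ d) :
    gap p c.1.1 c.1.2 ⟂ gap p d.1.1 d.1.2 := by
  obtain ⟨⟨i, j⟩, hij⟩ := c
  obtain ⟨⟨k, l⟩, hkl⟩ := d
  rcases lt_trichotomy j l with hl | hl | hl
  · exact (Submodule.isOrtho_iff_le.2 (inf_le_right.trans (Submodule.orthogonal_le
      (inf_le_left.trans (hp (hkl.le_of_lt hl)))))).symm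
  · refine absurd ?_ h
    have : i = k := by
      dsimp only at hl hij hkl
      subst hl
      exact hij.unique_left hkl
    simp_all
  · exact Submodule.isOrtho_iff_le.2 (inf_le_right.trans (Submodule.orthogonal_le
      (inf_le_left.trans (hp (hij.le_of_lt hl)))))

section Basis

variable {X' : Type*} [NormedAddCommGroup X'] [InnerProductSpace ℂ X'] {p' : ι → Submodule ℂ X'}

lemma mem_of_hilbertBasis_atomicPart (hp : Monotone p) (hp' : Monotone p')
    (hc : ∀ i, IsClosed (p' i : Set X')) {d : {c : ι × ι // c.1 ⋖ c.2} → ℕ}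
    {b : HilbertBasis (Σ c, Fin (d c)) ℂ (atomicPart p)}
    {b' : HilbertBasis (Σ c, Fin (d c)) ℂ (atomicPart p')}
    (hb : ∀ k, (b k : X) ∈ gap p k.1.1.1 k.1.1.2)
    (hb' : ∀ k, (b' k : X') ∈ gap p' k.1.1.1 k.1.1.2) (i : ι) (x : atomicPart p)
    (hx : x ∈ traceFamily (atomicPart p) p i) :
    b'.repr.symm (b.repr x) ∈ traceFamily (atomicPart p') p' i := by
  have h1 := b'.hasSum_repr_symm (b.repr x)
  have h2 : IsClosed (traceFamily (atomicPart p') p' i : Set (atomicPart p')) :=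
    (hc i).preimage continuous_subtype_val
  refine h2.mem_of_tendsto h1 (Eventually.of_forall fun s => Submodule.sum_mem _ fun k _ => ?_)
  rw [b.repr_apply_apply]
  rcases gap_le_or_le_orthogonal hp k.1.2 i with h | h
  · exact Submodule.smul_mem _ _ (hp' h.1 (hb' k).1 : (b' k : X') ∈ p' i)
  · have h3 : inner ℂ (b k) x = 0 := Submodule.inner_left_of_mem_orthogonal
      (K := p i) (v := (b k : X)) (u := (x : X)) hx (h (hb k))
    rw [h3, zero_smul]
    exact zero_mem _

end Basis

variable [CompleteSpace X]

instance : (atomicPart p).HasOrthogonalProjection := by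
  have : CompleteSpace (atomicPart p) :=
    (Submodule.isClosed_topologicalClosure _).completeSpace_coe
  infer_instance

lemma NestFamily.starProjection_atomicPart_mem (hp : NestFamily p) (i : ι) (x : X) (hx : x ∈ p i) :
    (atomicPart p).starProjection x ∈ p i := by
  have := hp.hasOrthogonalProjection
  have h1 : atomicPart p ≤ (atomicPart p).comap ((p i).starProjection : X →ₗ[ℂ] X) := by
    refine Submodule.topologicalClosure_minimal _ (iSup_le fun c x hx => ?_)
      ((Submodule.isClosed_topologicalClosure _).preimage (p i).starProjection.continuous)
    change (p i).starProjection x ∈ atomicPart p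
    rcases gap_le_or_le_orthogonal hp.mono c.2 i with h | h
    · rw [Submodule.starProjection_eq_self_iff.2 (h.2 hx)]
      exact gap_le_atomicPart c.2 hx
    · rw [(Submodule.starProjection_apply_eq_zero_iff _).2 (h hx)]
      exact zero_mem _
  have h2 := starProjection_comm_of_invariant h1 x
  rw [Submodule.starProjection_eq_self_iff.2 hx] at h2
  rw [h2]
  exact (p i).starProjection_apply_mem _

lemma NestFamily.starProjection_atomicPart_orthogonal_mem (hp : NestFamily p) (i : ι) (x : X)
    (hx : x ∈ p i) : (atomicPart p)ᗮ.starProjection x ∈ p i := by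
  rw [Submodule.starProjection_orthogonal_val]
  exact sub_mem hx (hp.starProjection_atomicPart_mem i x hx)

lemma NestFamily.trace_atomicPart_orthogonal_eq (hp : NestFamily p) (i j : ι) (h : i ⋖ j) :
    traceFamily (atomicPart p)ᗮ p i = traceFamily (atomicPart p)ᗮ p j := by
  have := hp.hasOrthogonalProjection
  refine le_antisymm (fun x hx => hp.mono h.le hx) fun x hx => ?_
  have h1 : (x : X) - (p i).starProjection x ∈ gap p i j :=
    ⟨sub_mem hx (hp.mono h.le ((p i).starProjection_apply_mem _)),
      Submodule.sub_starProjection_mem_orthogonal _⟩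
  have h2 := gap_le_atomicPart h h1
  have h3 : inner ℂ ((x : X) - (p i).starProjection x) (x : X) = 0 :=
    Submodule.inner_right_of_mem_orthogonal h2 x.2
  have h4 : inner ℂ ((x : X) - (p i).starProjection x) ((p i).starProjection (x : X)) = 0 :=
    Submodule.starProjection_inner_eq_zero _ _ ((p i).starProjection_apply_mem _)
  have h5 : inner ℂ ((x : X) - (p i).starProjection x) ((x : X) - (p i).starProjection x) =
      (0 : ℂ) := by
    rw [inner_sub_right, h3, h4, sub_zero]
  have h6 := sub_eq_zero.1 (inner_self_eq_zero.1 h5)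
  change (x : X) ∈ p i
  rw [h6]
  exact (p i).starProjection_apply_mem _

/-- If each interval contains a nonzero atom, then a nested space is similar to its atomic part. -/
lemma NestFamily.nestIso_atomicPart [TopologicalSpace.SeparableSpace X] (hp : NestFamily p)
    (hsep : ∀ i j, i < j → ∃ k l, i ≤ k ∧ k ⋖ l ∧ l ≤ j ∧ gap p k l ≠ ⊥) :
    NestIso p (traceFamily (atomicPart p) p) := by
  have : CompleteSpace (atomicPart p) :=
    (Submodule.isClosed_topologicalClosure _).completeSpace_coe
  refine (nestIso_trace_prod (atomicPart p) hp.starProjection_atomicPart_mem).trans ?_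
  have hY := hp.trace _ hp.starProjection_atomicPart_mem
  refine (hp.trace _ hp.starProjection_atomicPart_orthogonal_mem).nestIso_prod
    hp.trace_atomicPart_orthogonal_eq hY.mono hY.closed fun i j hij h => ?_
  rcases hij.eq_or_lt with rfl | hij
  · rfl
  · obtain ⟨k, l, hik, hkl, hlj, hne⟩ := hsep i j hij
    refine absurd ((Submodule.eq_bot_iff _).2 fun x hx => ?_) hne
    have h1 : (⟨x, gap_le_atomicPart hkl hx⟩ : atomicPart p) ∈ traceFamily (atomicPart p) p i :=
      h ▸ (hp.mono hlj hx.1 : x ∈ p j)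
    exact inner_self_eq_zero.1
      (Submodule.inner_right_of_mem_orthogonal (hp.mono hik h1 : x ∈ p k) hx.2)

/-- Orthonormal bases of the atoms combine to a Hilbert basis of the atomic part. -/
lemma exists_hilbertBasis_atomicPart (hp : Monotone p) {d : {c : ι × ι // c.1 ⋖ c.2} → ℕ}
    (hf : ∀ i j, i ⋖ j → FiniteDimensional ℂ (gap p i j))
    (hd : ∀ c, Module.finrank ℂ (gap p c.1.1 c.1.2) = d c) :
    ∃ b : HilbertBasis (Σ c, Fin (d c)) ℂ (atomicPart p),
      ∀ k, (b k : X) ∈ gap p k.1.1.1 k.1.1.2 := by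
  have hf' : ∀ c : {c : ι × ι // c.1 ⋖ c.2}, FiniteDimensional ℂ (gap p c.1.1 c.1.2) :=
    fun c => hf _ _ c.2
  let e : ∀ c : {c : ι × ι // c.1 ⋖ c.2}, OrthonormalBasis (Fin (d c)) ℂ (gap p c.1.1 c.1.2) :=
    fun c => (stdOrthonormalBasis ℂ _).reindex (finCongr (hd c))
  let v : (Σ c, Fin (d c)) → atomicPart p := fun k =>
    ⟨e k.1 k.2, gap_le_atomicPart k.1.2 (e k.1 k.2).2⟩
  have hv : Orthonormal ℂ v := by
    classical
    rw [orthonormal_iff_ite]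
    rintro ⟨c, k⟩ ⟨c', k'⟩
    by_cases h : c = c'
    · subst h
      have := orthonormal_iff_ite.1 (e c).orthonormal k k'
      refine Eq.trans this ?_
      simp
    · rw [if_neg (fun h' => h (congrArg Sigma.fst h'))]
      exact Submodule.isOrtho_iff_inner_eq.1 (gap_isOrtho hp h) _ (e c k).2 _ (e c' k').2
  have hv' : (Submodule.span ℂ (Set.range v))ᗮ = ⊥ := by
    refine (Submodule.eq_bot_iff _).2 fun y hy => ?_
    have h1 : atomicPart p ≤ (Submodule.span ℂ {(y : X)})ᗮ := by
      refine Submodule.topologicalClosure_minimal _ (iSup_le fun c x hx => ?_)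
        (Submodule.isClosed_orthogonal _)
      rw [Submodule.mem_orthogonal_singleton_iff_inner_right]
      have h2 := (e c).sum_repr ⟨x, hx⟩
      have h3 : x = ∑ k, (e c).repr ⟨x, hx⟩ k • ((e c k : gap p c.1.1 c.1.2) : X) := by
        have := congrArg Subtype.val h2
        rw [Submodule.coe_sum] at this
        exact this.symm
      rw [h3, inner_sum]
      refine Finset.sum_eq_zero fun k _ => ?_
      rw [inner_smul_right]
      have h4 : inner ℂ y (v ⟨c, k⟩) = 0 :=
        Submodule.inner_left_of_mem_orthogonal
        (Submodule.subset_span (Set.mem_range_self (f := v) ⟨c, k⟩)) hy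
      have h5 : inner ℂ (y : X) ((e c k : gap p c.1.1 c.1.2) : X) = 0 := h4
      rw [h5, mul_zero]
    have h2 := Submodule.mem_orthogonal_singleton_iff_inner_right.1 (h1 y.2)
    exact Subtype.ext (inner_self_eq_zero.1 h2)
  have : CompleteSpace (atomicPart p) :=
    (Submodule.isClosed_topologicalClosure _).completeSpace_coe
  refine ⟨HilbertBasis.mkOfOrthogonalEqBot hv hv', fun k => ?_⟩
  rw [HilbertBasis.coe_mkOfOrthogonalEqBot]
  exact (e k.1 k.2).2

variable {X' : Type*} [NormedAddCommGroup X'] [InnerProductSpace ℂ X'] [CompleteSpace X']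
  {p' : ι → Submodule ℂ X'}

/-- Two nested spaces over the same order, with equal finite atom dimensions and with a nonzero atom
in each interval, are similar. -/
theorem NestFamily.nestIso_of_finrank_eq [TopologicalSpace.SeparableSpace X]
    [TopologicalSpace.SeparableSpace X'] (hp : NestFamily p) (hp' : NestFamily p')
    (hf : ∀ i j, i ⋖ j → FiniteDimensional ℂ (gap p i j))
    (hf' : ∀ i j, i ⋖ j → FiniteDimensional ℂ (gap p' i j))
    (hd : ∀ i j, i ⋖ j → Module.finrank ℂ (gap p i j) = Module.finrank ℂ (gap p' i j))
    (hsep : ∀ i j, i < j → ∃ k l, i ≤ k ∧ k ⋖ l ∧ l ≤ j ∧ gap p k l ≠ ⊥)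
    (hsep' : ∀ i j, i < j → ∃ k l, i ≤ k ∧ k ⋖ l ∧ l ≤ j ∧ gap p' k l ≠ ⊥) :
    NestIso p p' := by
  refine (hp.nestIso_atomicPart hsep).trans (NestIso.trans ?_ (hp'.nestIso_atomicPart hsep').symm)
  obtain ⟨b, hb⟩ := exists_hilbertBasis_atomicPart hp.mono hf (fun c => hd _ _ c.2)
  obtain ⟨b', hb'⟩ := exists_hilbertBasis_atomicPart hp'.mono hf' (fun c => rfl)
  let U := b.repr.trans b'.repr.symm
  refine ⟨U.toContinuousLinearEquiv, U.symm.toContinuousLinearEquiv,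
    mem_of_hilbertBasis_atomicPart hp.mono hp'.mono hp'.closed hb hb',
    mem_of_hilbertBasis_atomicPart hp'.mono hp.mono hp.closed hb' hb,
    U.symm_apply_apply, U.apply_symm_apply⟩

end AtomicPart

section GapMap

variable {ι X Y Z : Type*} [NormedAddCommGroup X] [InnerProductSpace ℂ X]
  [NormedAddCommGroup Y] [InnerProductSpace ℂ Y] [NormedAddCommGroup Z] [InnerProductSpace ℂ Z]
  {p : ι → Submodule ℂ X} {q : ι → Submodule ℂ Y} {r : ι → Submodule ℂ Z} {i j : ι}

/-- `L` is the compression of `T` to the difference of two members of a nest. -/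
def IsGapMap (p : ι → Submodule ℂ X) (q : ι → Submodule ℂ Y) (i j : ι) (T : X →L[ℂ] Y)
    (L : gap p i j →ₗ[ℂ] gap q i j) : Prop :=
  ∀ x : gap p i j, T x - L x ∈ q i

lemma exists_isGapMap [LinearOrder ι] (hq : Monotone q) [(q i).HasOrthogonalProjection] (h : i ≤ j)
    {T : X →L[ℂ] Y} (hT : ∀ i, ∀ x ∈ p i, T x ∈ q i) :
    ∃ L : gap p i j →ₗ[ℂ] gap q i j, IsGapMap p q i j T L := by
  refine ⟨(((q i)ᗮ.starProjection ∘L T : X →ₗ[ℂ] Y) ∘ₗ (gap p i j).subtype).codRestrict _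
    fun x => ?_, fun x => ?_⟩
  · refine ⟨?_, Submodule.starProjection_apply_mem _ _⟩
    have : (q i)ᗮ.starProjection (T x) = T x - (q i).starProjection (T x) :=
      Submodule.starProjection_orthogonal_val _
    change (q i)ᗮ.starProjection (T x) ∈ q j
    rw [this]
    exact sub_mem (hT j x x.2.1) (hq h ((q i).starProjection_apply_mem _))
  · change T x - (q i)ᗮ.starProjection (T x) ∈ q i
    rw [Submodule.starProjection_orthogonal_val, sub_sub_cancel]
    exact (q i).starProjection_apply_mem _

namespace IsGapMap

lemma unique {T : X →L[ℂ] Y} {L L' : gap p i j →ₗ[ℂ] gap q i j} (hL : IsGapMap p q i j T L)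
    (hL' : IsGapMap p q i j T L') : L = L' := by
  ext x
  have h1 : (L x : Y) - L' x ∈ q i := by
    have := sub_mem (hL' x) (hL x)
    rwa [sub_sub_sub_cancel_left] at this
  have h2 : (L x : Y) - L' x ∈ (q i)ᗮ := sub_mem (L x).2.2 (L' x).2.2
  exact sub_eq_zero.1 (inner_self_eq_zero.1 (Submodule.inner_right_of_mem_orthogonal h1 h2))

lemma comp {T : X →L[ℂ] Y} {T' : Y →L[ℂ] Z} {L : gap p i j →ₗ[ℂ] gap q i j}
    {L' : gap q i j →ₗ[ℂ] gap r i j} (hL : IsGapMap p q i j T L) (hL' : IsGapMap q r i j T' L')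
    (hT' : ∀ i, ∀ x ∈ q i, T' x ∈ r i) : IsGapMap p r i j (T' ∘L T) (L' ∘ₗ L) := fun x => by
  have := add_mem (hT' i _ (hL x)) (hL' (L x))
  rwa [map_sub, sub_add_sub_cancel] at this

lemma add {T T' : X →L[ℂ] Y} {L L' : gap p i j →ₗ[ℂ] gap q i j} (hL : IsGapMap p q i j T L)
    (hL' : IsGapMap p q i j T' L') : IsGapMap p q i j (T + T') (L + L') := fun x => by
  have := add_mem (hL x) (hL' x)
  rwa [sub_add_sub_comm] at this

lemma id : IsGapMap p p i j (.id ℂ X) .id := fun x => by simp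

lemma zero : IsGapMap p q i j 0 0 := fun x => by simp

end IsGapMap

end GapMap

section Kernel

variable {ι X H : Type*} [NormedAddCommGroup X] [InnerProductSpace ℂ X]
  [NormedAddCommGroup H] [InnerProductSpace ℂ H]
  {P : ι → Submodule ℂ X} {p : ι → Submodule ℂ H} {A : X →L[ℂ] H} {C : H →L[ℂ] X}

/-- The projection of a space onto the kernel of a right invertible operator. -/
lemma exists_retraction_ker (hA : ∀ i, ∀ x ∈ P i, A x ∈ p i) (hC : ∀ i, ∀ x ∈ p i, C x ∈ P i)
    (hAC : ∀ x, A (C x) = x) : ∃ R : X →L[ℂ] A.ker,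
      (∀ i, ∀ x ∈ P i, R x ∈ traceFamily A.ker P i) ∧ (∀ x, (R x : X) = x - C (A x)) ∧
      (∀ x : A.ker, R x = x) ∧ ∀ x, R (C x) = 0 := by
  have h0 : ∀ x, x - C (A x) ∈ A.ker := fun x => by simp [hAC]
  refine ⟨(1 - C ∘L A).codRestrict A.ker h0, fun i x hx => sub_mem hx (hC i _ (hA i x hx)),
    fun x => rfl, fun x => Subtype.ext ?_, fun x => Subtype.ext ?_⟩
  · have : A x = 0 := x.2
    change (x : X) - C (A x) = x
    rw [this, map_zero, sub_zero]
  · change C x - C (A (C x)) = 0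
    rw [hAC, sub_self]

/-- Operators extending a right invertible operator to an automorphism. -/
lemma NestIso.exists_extension {A₀ : X →L[ℂ] H} {C₀ : H →L[ℂ] X}
    (hA : ∀ i, ∀ x ∈ P i, A x ∈ p i) (hC : ∀ i, ∀ x ∈ p i, C x ∈ P i) (hAC : ∀ x, A (C x) = x)
    (hA₀ : ∀ i, ∀ x ∈ P i, A₀ x ∈ p i) (hC₀ : ∀ i, ∀ x ∈ p i, C₀ x ∈ P i)
    (hAC₀ : ∀ x, A₀ (C₀ x) = x)
    (hK : NestIso (traceFamily A.ker P) (traceFamily A₀.ker P)) :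
    ∃ S T : X →L[ℂ] X, (∀ i, ∀ x ∈ P i, S x ∈ P i) ∧ (∀ i, ∀ x ∈ P i, T x ∈ P i) ∧
      (∀ x, S (T x) = x) ∧ (∀ x, T (S x) = x) ∧ (∀ x, A₀ (S x) = A x) ∧ ∀ x, T (C₀ x) = C x := by
  obtain ⟨R, hR, hRe, hR', hRC⟩ := exists_retraction_ker hA hC hAC
  obtain ⟨R₀, hR₀, hRe₀, hR₀', hRC₀⟩ := exists_retraction_ker hA₀ hC₀ hAC₀
  obtain ⟨f, g, hf, hg, hgf, hfg⟩ := hK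
  have hA' : ∀ x : A.ker, A x = 0 := fun x => x.2
  have hA₀' : ∀ x : A₀.ker, A₀ x = 0 := fun x => x.2
  refine ⟨C₀ ∘L A + A₀.ker.subtypeL ∘L f ∘L R, C ∘L A₀ + A.ker.subtypeL ∘L g ∘L R₀,
    fun i x hx => add_mem (hC₀ i _ (hA i x hx)) (hf i _ (hR i x hx)),
    fun i x hx => add_mem (hC i _ (hA₀ i x hx)) (hg i _ (hR₀ i x hx)), fun x => ?_, fun x => ?_,
    fun x => ?_, fun x => ?_⟩
  · simp [hAC, hA', hRC, hR', hfg, hRe₀]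
  · simp [hAC₀, hA₀', hRC₀, hR₀', hgf, hRe]
  · simp [hAC₀, hA₀']
  · simp [hAC₀, hRC₀]

variable [LinearOrder ι]

lemma NestFamily.trace_ker (hP : NestFamily P) (hA : ∀ i, ∀ x ∈ P i, A x ∈ p i)
    (hC : ∀ i, ∀ x ∈ p i, C x ∈ P i) (hAC : ∀ x, A (C x) = x) :
    NestFamily (traceFamily A.ker P) := by
  obtain ⟨R, hR, -, hR', -⟩ := exists_retraction_ker hA hC hAC
  exact hP.of_resolution (fun _ : Unit => A.ker.subtypeL) (fun _ => R)
    (fun i y => ⟨fun h _ => h, fun h => h ()⟩) (fun _ => hR) (fun y => by simp [hR'])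

variable [CompleteSpace X] [CompleteSpace H]

/-- Each atom of a nested space splits along a right invertible operator. -/
lemma NestFamily.nonempty_gap_equiv (hP : NestFamily P) (hp : NestFamily p)
    (hA : ∀ i, ∀ x ∈ P i, A x ∈ p i)
    (hC : ∀ i, ∀ x ∈ p i, C x ∈ P i) (hAC : ∀ x, A (C x) = x) {i j : ι} (h : i ≤ j) :
    Nonempty (gap P i j ≃ₗ[ℂ] gap p i j × gap (traceFamily A.ker P) i j) := by
  have hK := hP.trace_ker hA hC hAC
  obtain ⟨R, hR, hRe, hR', hRC⟩ := exists_retraction_ker hA hC hAC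
  have : CompleteSpace A.ker := A.isClosed_ker.completeSpace_coe
  have := hP.hasOrthogonalProjection
  have := hp.hasOrthogonalProjection
  have := hK.hasOrthogonalProjection
  have hI : ∀ i, ∀ x ∈ traceFamily A.ker P i, A.ker.subtypeL x ∈ P i := fun i x hx => hx
  obtain ⟨a, ha⟩ := exists_isGapMap hp.mono h hA
  obtain ⟨c, hc⟩ := exists_isGapMap hP.mono h hC
  obtain ⟨r, hr⟩ := exists_isGapMap hK.mono h hR
  obtain ⟨e, he⟩ := exists_isGapMap hP.mono h hI
  have hac : a ∘ₗ c = .id := by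
    refine (hc.comp ha hA).unique ?_
    have : A ∘L C = .id ℂ H := ContinuousLinearMap.ext hAC
    rw [this]
    exact .id
  have hrc : r ∘ₗ c = 0 := by
    refine (hc.comp hr hR).unique ?_
    have : R ∘L C = 0 := ContinuousLinearMap.ext hRC
    rw [this]
    exact .zero
  have hre : r ∘ₗ e = .id := by
    refine (he.comp hr hR).unique ?_
    have : R ∘L A.ker.subtypeL = .id ℂ A.ker := ContinuousLinearMap.ext hR'
    rw [this]
    exact .id
  have hae : a ∘ₗ e = 0 := by
    refine (he.comp ha hA).unique ?_
    have : A ∘L A.ker.subtypeL = 0 := ContinuousLinearMap.ext fun x => x.2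
    rw [this]
    exact .zero
  have hce : c ∘ₗ a + e ∘ₗ r = .id := by
    refine ((ha.comp hc hC).add (hr.comp he hI)).unique ?_
    have : C ∘L A + A.ker.subtypeL ∘L R = .id ℂ X := ContinuousLinearMap.ext fun x => by
      simp [hRe]
    rw [this]
    exact .id
  refine ⟨.ofLinearMap (a.prod r) (c.coprod e) ?_ ?_⟩
  · refine LinearMap.ext fun x => Prod.ext ?_ ?_
    · simpa using congr($hac x.1 + $hae x.2)
    · simpa using congr($hrc x.1 + $hre x.2)
  · refine LinearMap.ext fun x => ?_
    simpa using congr($hce x)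

end Kernel

section Amplification

variable {ι H : Type*} [NormedAddCommGroup H] [InnerProductSpace ℂ H] {p : ι → Submodule ℂ H}

/-- The atoms of a finite amplification are finite powers. -/
lemma nonempty_gap_ampl_equiv (J : Type*) [Fintype J] [DecidableEq J] (i j : ι) :
    Nonempty (gap (fun i => ampl J (p i)) i j ≃ₗ[ℂ] (J → gap p i j)) := by
  have h1 : ∀ f ∈ gap (fun i => ampl J (p i)) i j, ∀ k, f k ∈ gap p i j := fun f hf k => by
    refine ⟨hf.1 k, (Submodule.mem_orthogonal _ _).2 fun x hx => ?_⟩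
    rw [← lp.inner_single_left (𝕜 := ℂ) k x f]
    exact Submodule.inner_right_of_mem_orthogonal (single_mem_ampl k hx) hf.2
  let L : gap (fun i => ampl J (p i)) i j →ₗ[ℂ] (J → gap p i j) :=
    { toFun := fun f k => ⟨f.1 k, h1 f.1 f.2 k⟩
      map_add' := fun f g => rfl
      map_smul' := fun c f => rfl }
  refine ⟨.ofBijective L ⟨fun f g h => ?_, fun g => ?_⟩⟩
  · refine Subtype.ext (lp.ext (funext fun k => ?_))
    exact congrArg Subtype.val (congrFun h k)
  · let f : lp (fun _ : J => H) 2 := ⟨fun k => g k, Memℓp.all _⟩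
    refine ⟨⟨f, fun k => (g k).2.1, (Submodule.mem_orthogonal _ _).2 fun x hx => ?_⟩, rfl⟩
    rw [lp.inner_eq_tsum]
    refine (tsum_congr fun k => ?_).trans tsum_zero
    exact Submodule.inner_right_of_mem_orthogonal (hx k) (g k).2.2

variable [CompleteSpace H] [LinearOrder ι]

lemma NestFamily.finrank_gap_trace_ker (hp : NestFamily p) {n : ℕ}
    {A : lp (fun _ : Fin n => H) 2 →L[ℂ] H} {C : H →L[ℂ] lp (fun _ : Fin n => H) 2}
    (hA : ∀ i, ∀ x ∈ ampl (Fin n) (p i), A x ∈ p i)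
    (hC : ∀ i, ∀ x ∈ p i, C x ∈ ampl (Fin n) (p i)) (hAC : ∀ x, A (C x) = x) {i j : ι}
    (h : i ≤ j) (hf : FiniteDimensional ℂ (gap p i j)) :
    FiniteDimensional ℂ (gap (traceFamily A.ker fun i => ampl (Fin n) (p i)) i j) ∧
    n * Module.finrank ℂ (gap p i j) = Module.finrank ℂ (gap p i j) +
      Module.finrank ℂ (gap (traceFamily A.ker fun i => ampl (Fin n) (p i)) i j) := by
  obtain ⟨e⟩ := (hp.amplify (Fin n)).nonempty_gap_equiv hp hA hC hAC h
  obtain ⟨e'⟩ := nonempty_gap_ampl_equiv (p := p) (Fin n) i j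
  have h1 := e'.symm.trans e
  have h2 : FiniteDimensional ℂ
      (gap p i j × gap (traceFamily A.ker fun i => ampl (Fin n) (p i)) i j) := h1.finiteDimensional
  have h3 : FiniteDimensional ℂ (gap (traceFamily A.ker fun i => ampl (Fin n) (p i)) i j) :=
    .of_surjective (LinearMap.snd ℂ (gap p i j) _) Prod.snd_surjective
  refine ⟨h3, ?_⟩
  have := h1.finrank_eq
  rwa [Module.finrank_prod, Module.finrank_pi_fintype, Finset.sum_const, Finset.card_univ,
    Fintype.card_fin, smul_eq_mul] at this

/-- A right invertible row over the algebra of a nest with finite-dimensional, dense atoms is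
completed to an invertible matrix. -/
theorem NestFamily.exists_matrix [TopologicalSpace.SeparableSpace H] (hp : NestFamily p)
    (hf : ∀ i j, i ⋖ j → FiniteDimensional ℂ (gap p i j))
    (hsep : ∀ i j, i < j → ∃ k l, i ≤ k ∧ k ⋖ l ∧ l ≤ j ∧ gap p k l ≠ ⊥) {n : ℕ} (hn : 2 ≤ n)
    (o : Fin n) (a c : Fin n → H →L[ℂ] H) (ha : ∀ k i, ∀ x ∈ p i, a k x ∈ p i)
    (hc : ∀ k i, ∀ x ∈ p i, c k x ∈ p i) (hac : ∑ k, a k * c k = 1) :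
    ∃ W W' : Matrix (Fin n) (Fin n) (H →L[ℂ] H),
      (∀ k l i, ∀ x ∈ p i, W k l x ∈ p i) ∧ (∀ k l i, ∀ x ∈ p i, W' k l x ∈ p i) ∧
      W * W' = 1 ∧ W' * W = 1 ∧ (∀ l, W o l = a l) ∧ ∀ k, W' k o = c k := by
  let P : ι → Submodule ℂ (lp (fun _ : Fin n => H) 2) := fun i => ampl (Fin n) (p i)
  have hP : NestFamily P := hp.amplify (Fin n)
  have hsX := separableSpace_ampl (X := H) (Fin n)
  let ev : Fin n → lp (fun _ : Fin n => H) 2 →L[ℂ] H := fun k => lp.evalCLM ℂ (fun _ => H) 2 k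
  let sg : Fin n → H →L[ℂ] lp (fun _ : Fin n => H) 2 := fun k =>
    lp.singleContinuousLinearMap ℂ (fun _ => H) 2 k
  have hev : ∀ k i, ∀ x ∈ P i, ev k x ∈ p i := fun k i x hx => hx k
  have hsg : ∀ k i, ∀ x ∈ p i, sg k x ∈ P i := fun k i x hx => single_mem_ampl k hx
  have hes : ∀ k l x, ev k (sg l x) = if k = l then x else 0 := fun k l x => by
    split_ifs with h
    · subst h; exact lp.single_apply_self (E := fun _ : Fin n => H) 2 k x
    · exact lp.single_apply_ne (E := fun _ : Fin n => H) 2 l x h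
  have hse : ∀ x, ∑ k, sg k (ev k x) = x := fun x =>
    (hasSum_fintype _).unique (lp.hasSum_single (by norm_num) x)
  let A : lp (fun _ : Fin n => H) 2 →L[ℂ] H := ∑ k, a k ∘L ev k
  let C : H →L[ℂ] lp (fun _ : Fin n => H) 2 := ∑ k, sg k ∘L c k
  have hAe : ∀ x, A x = ∑ k, a k (ev k x) := fun x => by simp [A, sum_apply]
  have hCe : ∀ x, C x = ∑ k, sg k (c k x) := fun x => by simp [C, sum_apply]
  have hA : ∀ i, ∀ x ∈ P i, A x ∈ p i := fun i x hx => by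
    rw [hAe]; exact sum_mem fun k _ => ha k i _ (hev k i x hx)
  have hC : ∀ i, ∀ x ∈ p i, C x ∈ P i := fun i x hx => by
    rw [hCe]; exact sum_mem fun k _ => hsg k i _ (hc k i x hx)
  have hevC : ∀ k x, ev k (C x) = c k x := fun k x => by
    rw [hCe, map_sum]; simp [hes]
  have hAsg : ∀ l x, A (sg l x) = a l x := fun l x => by
    rw [hAe]; simp [hes, apply_ite]
  have hAC : ∀ x, A (C x) = x := fun x => by
    rw [hAe]
    simp only [hevC]
    simpa [sum_apply] using congr($hac x)
  have hAC₀ : ∀ x, ev o (sg o x) = x := fun x => by simp [hes]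
  have hdim := fun i j (h : i ⋖ j) => hp.finrank_gap_trace_ker hA hC hAC h.le (hf i j h)
  have hdim₀ := fun i j (h : i ⋖ j) =>
    hp.finrank_gap_trace_ker (hev o) (hsg o) hAC₀ h.le (hf i j h)
  have hne : ∀ {B : lp (fun _ : Fin n => H) 2 →L[ℂ] H}, (∀ i j, i ⋖ j →
      FiniteDimensional ℂ (gap (traceFamily B.ker P) i j) ∧ n * Module.finrank ℂ (gap p i j) =
        Module.finrank ℂ (gap p i j) + Module.finrank ℂ (gap (traceFamily B.ker P) i j)) →
      ∀ i j, i < j → ∃ k l, i ≤ k ∧ k ⋖ l ∧ l ≤ j ∧ gap (traceFamily B.ker P) k l ≠ ⊥ := by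
    intro B hB i j hij
    obtain ⟨k, l, hik, hkl, hlj, h⟩ := hsep i j hij
    refine ⟨k, l, hik, hkl, hlj, fun h0 => h ?_⟩
    have h1 := (hB k l hkl).2
    have := hf k l hkl
    rw [h0, finrank_bot, add_zero] at h1
    refine Submodule.finrank_eq_zero.1 ?_
    nlinarith
  have hiso : NestIso (traceFamily A.ker P) (traceFamily (ev o).ker P) := by
    have : CompleteSpace A.ker := A.isClosed_ker.completeSpace_coe
    have : CompleteSpace (ev o).ker := (ev o).isClosed_ker.completeSpace_coe
    refine (hP.trace_ker hA hC hAC).nestIso_of_finrank_eq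
      (hP.trace_ker (hev o) (hsg o) hAC₀) (fun i j h => (hdim i j h).1)
      (fun i j h => (hdim₀ i j h).1) (fun i j h => ?_) (hne hdim) (hne hdim₀)
    have h1 := (hdim i j h).2
    have h2 := (hdim₀ i j h).2
    exact Nat.add_left_cancel (h1.symm.trans h2)
  obtain ⟨S, T, hS, hT, hST, hTS, hS', hT'⟩ :=
    hiso.exists_extension hA hC hAC (hev o) (hsg o) hAC₀
  have hmul : ∀ U V : lp (fun _ : Fin n => H) 2 →L[ℂ] lp (fun _ : Fin n => H) 2,
      (∀ x, U (V x) = x) → (Matrix.of fun k l => ev k ∘L U ∘L sg l :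
        Matrix (Fin n) (Fin n) (H →L[ℂ] H)) * Matrix.of (fun k l => ev k ∘L V ∘L sg l) = 1 := by
    intro U V hUV
    ext k l x
    simp only [Matrix.mul_apply, Matrix.of_apply, sum_apply, mul_apply_eq_comp,
      ContinuousLinearMap.comp_apply]
    rw [← map_sum, ← map_sum, hse, hUV, hes, Matrix.one_apply]
    split_ifs <;> rfl
  refine ⟨.of fun k l => ev k ∘L S ∘L sg l, .of fun k l => ev k ∘L T ∘L sg l,
    fun k l i x hx => hev k i _ (hS i _ (hsg l i x hx)),
    fun k l i x hx => hev k i _ (hT i _ (hsg l i x hx)), hmul S T hST, hmul T S hTS,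
    fun l => ?_, fun k => ?_⟩
  · ext x
    exact (hS' _).trans (hAsg l x)
  · ext x
    exact congr(ev k $(hT' x)).trans (hevC k x)

end Amplification

section Doubling

lemma HilbertBasis.clm_ext {ι E F : Type*} [NormedAddCommGroup E] [InnerProductSpace ℂ E]
    [NormedAddCommGroup F] [NormedSpace ℂ F] (b : HilbertBasis ι ℂ E) {S T : E →L[ℂ] F}
    (h : ∀ i, S (b i) = T (b i)) : S = T :=
  ContinuousLinearMap.ext_on (Submodule.dense_iff_topologicalClosure_eq_top.2 b.dense_span)
    (by rintro _ ⟨i, rfl⟩; exact h i)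

/-- An infinite-dimensional Hilbert space is isomorphic to its square. -/
lemma exists_doubling {E : Type*} [NormedAddCommGroup E] [InnerProductSpace ℂ E] [CompleteSpace E]
    (h : ¬FiniteDimensional ℂ E) : ∃ (f : E →L[ℂ] E × E) (g : E × E →L[ℂ] E),
      (∀ x, g (f x) = x) ∧ ∀ y, f (g y) = y := by
  obtain ⟨w, b, -⟩ := exists_hilbertBasis ℂ E
  have hw : Infinite w := by
    refine not_finite_iff_infinite.1 fun hw => h ?_
    have h1 : FiniteDimensional ℂ (Submodule.span ℂ (Set.range b)) :=
      FiniteDimensional.span_of_finite ℂ (Set.finite_range b)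
    have h2 := b.dense_span
    rw [(Submodule.closed_of_finiteDimensional _).submodule_topologicalClosure_eq] at h2
    rw [h2] at h1
    exact (Submodule.topEquiv : (⊤ : Submodule ℂ E) ≃ₗ[ℂ] E).finiteDimensional
  obtain ⟨e⟩ : Nonempty (w ⊕ w ≃ w) := by
    refine Cardinal.eq.1 ?_
    rw [Cardinal.mk_sum, Cardinal.lift_id]
    exact Cardinal.add_eq_self (Cardinal.aleph0_le_mk w)
  have key : ∀ v : w → w, Function.Injective v → ∃ s : E →L[ℂ] E, (∀ i, s (b i) = b (v i)) ∧
      ∀ x, s.adjoint (s x) = x := by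
    intro v hv
    let S := (b.orthonormal.comp v hv).orthogonalFamily.linearIsometry.comp
      b.repr.toLinearIsometry
    refine ⟨S.toContinuousLinearMap, fun i => ?_, fun x => ?_⟩
    · change (b.orthonormal.comp v hv).orthogonalFamily.linearIsometry (b.repr (b i)) = _
      classical
      rw [b.repr_self, OrthogonalFamily.linearIsometry_apply_single]
      simp
    · exact congr($(S.toContinuousLinearMap.norm_map_iff_adjoint_comp_self.1 S.norm_map) x)
  obtain ⟨s, hs, hs'⟩ := key (fun i => e (.inl i)) (e.injective.comp Sum.inl_injective)
  obtain ⟨t, ht, ht'⟩ := key (fun i => e (.inr i)) (e.injective.comp Sum.inr_injective)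
  have hzero : ∀ x : E, (∀ i, inner ℂ (b i) x = 0) → x = 0 := fun x hx => by
    have : innerSL ℂ x = 0 := b.clm_ext fun i => by
      simpa using inner_eq_zero_symm.1 (hx i)
    exact (inner_self_eq_zero (𝕜 := ℂ)).1 congr($this x)
  have hst : ∀ x, s.adjoint (t x) = 0 := fun x => by
    have : s.adjoint ∘L t = 0 := b.clm_ext fun i => hzero _ fun j => by
      rw [ContinuousLinearMap.comp_apply, ContinuousLinearMap.adjoint_inner_right, hs, ht]
      exact b.orthonormal.2 (by simp)
    exact congr($this x)
  have hts : ∀ x, t.adjoint (s x) = 0 := fun x => by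
    have : t.adjoint ∘L s = 0 := b.clm_ext fun i => hzero _ fun j => by
      rw [ContinuousLinearMap.comp_apply, ContinuousLinearMap.adjoint_inner_right, hs, ht]
      exact b.orthonormal.2 (by simp)
    exact congr($this x)
  refine ⟨s.adjoint.prod t.adjoint, s.coprod t, fun x => ?_, fun x => Prod.ext ?_ ?_⟩
  · have : s ∘L s.adjoint + t ∘L t.adjoint = .id ℂ E := b.clm_ext fun i => by
      obtain ⟨i, rfl⟩ := e.surjective i
      rcases i with i | i
      · rw [← hs i]; simp [hs', hts]
      · rw [← ht i]; simp [ht', hst]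
    exact congr($this x)
  · simp [hs', hst]
  · simp [ht', hts]

end Doubling

section Gap

variable {ι H : Type*} [NormedAddCommGroup H] [InnerProductSpace ℂ H] [CompleteSpace H]
  [LinearOrder ι] {p : ι → Submodule ℂ H}

lemma NestFamily.completeSpace_gap (hp : NestFamily p) (i j : ι) : CompleteSpace (gap p i j) :=
  ((hp.closed j).inter (p i).isClosed_orthogonal).completeSpace_coe

lemma NestFamily.starProjection_gap_mem (hp : NestFamily p) {i j : ι}
    [(gap p i j).HasOrthogonalProjection] (h : i ≤ j) (k : ι) (x : H) (hx : x ∈ p k) :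
    (gap p i j).starProjection x ∈ p k := by
  have := hp.hasOrthogonalProjection
  have h1 : (p j).starProjection x - (p i).starProjection x = (gap p i j).starProjection x := by
    refine (Submodule.eq_starProjection_of_mem_of_inner_eq_zero (K := gap p i j)
      (Submodule.mem_inf.2 ⟨?_, ?_⟩) fun y hy => ?_).symm
    · exact sub_mem ((p j).starProjection_apply_mem x)
        (hp.mono h ((p i).starProjection_apply_mem x))
    · rw [← starProjection_starProjection_of_le (hp.mono h)]
      exact Submodule.sub_starProjection_mem_orthogonal _
    · rw [← sub_add, inner_add_left, Submodule.starProjection_inner_eq_zero _ _ hy.1,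
        Submodule.inner_right_of_mem_orthogonal ((p i).starProjection_apply_mem x) hy.2, add_zero]
  have h2 : ∀ l, (p l).starProjection x ∈ p k := fun l => by
    rcases le_total k l with h | h
    · rwa [Submodule.starProjection_eq_self_iff.2 (hp.mono h hx)]
    · exact hp.mono h ((p l).starProjection_apply_mem x)
  rw [← h1]
  exact sub_mem (h2 j) (h2 i)

/-- Over an interval isomorphic to its square there is a row which is already invertible, hence has
no completion. -/
theorem NestFamily.gap_eq_bot (hp : NestFamily p) {i j : ι} (h : i ≤ j)
    (hE : NestIso (traceFamily (gap p i j) p)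
      (fun k => (traceFamily (gap p i j) p k).prod (traceFamily (gap p i j) p k)))
    (hext : ∀ a c : Fin 2 → H →L[ℂ] H, (∀ k i, ∀ x ∈ p i, a k x ∈ p i) →
      (∀ k i, ∀ x ∈ p i, c k x ∈ p i) → ∑ k, a k * c k = 1 →
      ∃ W W' : Matrix (Fin 2) (Fin 2) (H →L[ℂ] H),
      (∀ k l i, ∀ x ∈ p i, W k l x ∈ p i) ∧ (∀ k l i, ∀ x ∈ p i, W' k l x ∈ p i) ∧
      W * W' = 1 ∧ ∀ k, W' k 0 = c k) : gap p i j = ⊥ := by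
  have := hp.completeSpace_gap i j
  have := hp.hasOrthogonalProjection
  set E := gap p i j with hEdef
  obtain ⟨f, g, hf, hg, hgf, hfg⟩ := hE
  have hPE : ∀ k, ∀ x ∈ p k, E.starProjection x ∈ p k := hp.starProjection_gap_mem h
  let s : Fin 2 → E →L[ℂ] E := ![g ∘L .inl ℂ E E, g ∘L .inr ℂ E E]
  let t : Fin 2 → E →L[ℂ] E := ![.fst ℂ E E ∘L f, .snd ℂ E E ∘L f]
  have hs : ∀ l k, ∀ x ∈ traceFamily E p k, s l x ∈ traceFamily E p k := fun l k x hx => by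
    fin_cases l
    · exact hg k _ ⟨hx, zero_mem _⟩
    · exact hg k _ ⟨zero_mem _, hx⟩
  have ht : ∀ l k, ∀ x ∈ traceFamily E p k, t l x ∈ traceFamily E p k := fun l k x hx => by
    fin_cases l
    · exact (hf k x hx).1
    · exact (hf k x hx).2
  have hts : ∀ k l x, t k (s l x) = if k = l then x else 0 := fun k l x => by
    fin_cases k <;> fin_cases l <;> simp [s, t, hfg]
  have hst : ∀ x, s 0 (t 0 x) + s 1 (t 1 x) = x := fun x => by
    change g ((f x).1, 0) + g (0, (f x).2) = x
    rw [← map_add]; simp [hgf]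
  let Q : H →L[ℂ] E := E.orthogonalProjectionOnto
  have hQ : ∀ x : E, Q x = x := fun x => by simp [Q]
  have hQ' : ∀ x, (Q x : H) = E.starProjection x := fun x => rfl
  let r : Fin 2 → H →L[ℂ] H := ![1 - E.starProjection, 0]
  have hr : ∀ l k, ∀ x ∈ p k, r l x ∈ p k := fun l k x hx => by
    fin_cases l
    · exact sub_mem hx (hPE k x hx)
    · exact zero_mem _
  have hrE : ∀ l, ∀ x : E, r l x = 0 := fun l x => by
    fin_cases l
    · have : E.starProjection (x : H) = x := Submodule.starProjection_eq_self_iff.2 x.2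
      change (x : H) - E.starProjection (x : H) = 0
      rw [this, sub_self]
    · rfl
  have hQr : ∀ l x, Q (r l x) = 0 := fun l x => by
    fin_cases l
    · change Q (x - E.starProjection x) = 0
      rw [map_sub, ← hQ', hQ, sub_self]
    · exact map_zero Q
  let Λ : (E →L[ℂ] E) → H →L[ℂ] H := fun T => E.subtypeL ∘L T ∘L Q
  have hlift : ∀ T : E →L[ℂ] E, (∀ k, ∀ x ∈ traceFamily E p k, T x ∈ traceFamily E p k) →
      ∀ k, ∀ x ∈ p k, Λ T x ∈ p k := fun T hT k x hx => hT k _ (hPE k x hx)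
  obtain ⟨W, W', hW, hW', hWW', hW'c⟩ := hext (fun l => Λ (s l) + r l) (fun l => Λ (t l) + r l)
    (fun l k x hx => add_mem (hlift _ (hs l) k x hx) (hr l k x hx))
    (fun l k x hx => add_mem (hlift _ (ht l) k x hx) (hr l k x hx)) (by
      ext x
      simp only [Fin.sum_univ_two, add_apply, mul_apply_eq_comp, map_add, one_apply_eq_self]
      have h1 : ∀ l y, Λ (s l) (r l y) = 0 := fun l y => by
        simp [Λ, hQr]
      have h2 : ∀ l y, Λ (s l) (Λ (t l) y) = (s l (t l (Q y)) : H) := fun l y => by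
        simp [Λ, hQ]
      have h3 : ∀ l y, r l (Λ (t l) y) = 0 := fun l y => hrE l _
      have h4 : (s 0 (t 0 (Q x)) : H) + s 1 (t 1 (Q x)) = E.starProjection x := by
        rw [← hQ', ← Submodule.coe_add, hst]
      have h5 : r 0 (r 0 x) = x - E.starProjection x := by
        change (x - E.starProjection x) - E.starProjection (x - E.starProjection x) = _
        rw [← hQ' (x - _), map_sub, ← hQ' x, hQ, sub_self]
        simp
      have h6 : r 1 (r 1 x) = 0 := rfl
      rw [h1, h1, h2, h2, h3, h3, h5, h6]
      linear_combination (norm := module) h4)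
  have hWE : ∀ l, ∀ x : E, W 1 l x = 0 := fun l x => by
    have h1 := congr($hWW' 1 0 (s l x : H))
    simp only [Matrix.mul_apply, Fin.sum_univ_two, hW'c, add_apply, mul_apply_eq_comp,
      hrE, add_zero] at h1
    have h2 : ∀ k, Λ (t k) (s l x : H) = if k = l then (x : H) else 0 := fun k => by
      simp only [Λ, ContinuousLinearMap.comp_apply, hQ, hts]
      split_ifs <;> simp
    rw [h2, h2] at h1
    fin_cases l <;> simpa using h1
  refine (Submodule.eq_bot_iff _).2 fun x hx => ?_
  have h1 := congr($hWW' 1 1 x)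
  simp only [Matrix.mul_apply, Fin.sum_univ_two, add_apply, mul_apply_eq_comp,
    Matrix.one_apply_eq, one_apply_eq_self] at h1
  have h2 : ∀ k, W 1 k (W' k 1 x) ∈ p i := fun k => by
    have h3 : W' k 1 x ∈ p j := hW' _ _ _ _ hx.1
    have h4 : W' k 1 x - (p i).starProjection (W' k 1 x) ∈ E :=
      ⟨sub_mem h3 (hp.mono h ((p i).starProjection_apply_mem _)),
        Submodule.sub_starProjection_mem_orthogonal _⟩
    have h5 := hWE k ⟨_, h4⟩
    rw [map_sub, sub_eq_zero] at h5
    rw [h5]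
    exact hW _ _ _ _ ((p i).starProjection_apply_mem _)
  have h6 : x ∈ p i := h1 ▸ add_mem (h2 0) (h2 1)
  exact inner_self_eq_zero.1 (Submodule.inner_right_of_mem_orthogonal h6 hx.2)

lemma NestFamily.nestIso_gap_of_covBy (hp : NestFamily p) {i j : ι} (h : i ⋖ j)
    (hf : ¬FiniteDimensional ℂ (gap p i j)) :
    NestIso (traceFamily (gap p i j) p)
      (fun k => (traceFamily (gap p i j) p k).prod (traceFamily (gap p i j) p k)) := by
  have := hp.completeSpace_gap i j
  obtain ⟨f, g, hgf, hfg⟩ := exists_doubling hf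
  have key : ∀ k, traceFamily (gap p i j) p k = ⊥ ∨ traceFamily (gap p i j) p k = ⊤ := fun k => by
    rcases le_or_gt j k with hk | hk
    · exact Or.inr (Submodule.eq_top_iff'.2 fun x => hp.mono hk x.2.1)
    · refine Or.inl ((Submodule.eq_bot_iff _).2 fun x hx => ?_)
      exact Subtype.ext ((inner_self_eq_zero (𝕜 := ℂ)).1
        (Submodule.inner_right_of_mem_orthogonal (hp.mono (h.le_of_lt hk) hx) x.2.2))
  refine ⟨f, g, fun k x hx => ?_, fun k x hx => ?_, hgf, hfg⟩
  · change _ ∈ (traceFamily (gap p i j) p k).prod (traceFamily (gap p i j) p k)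
    rcases key k with h | h
    · rw [h] at hx ⊢
      rw [(Submodule.mem_bot ℂ).1 hx, map_zero]
      exact zero_mem _
    · rw [h]; exact ⟨trivial, trivial⟩
  · change x ∈ (traceFamily (gap p i j) p k).prod (traceFamily (gap p i j) p k) at hx
    rcases key k with h | h
    · rw [h] at hx ⊢
      have : x = 0 := Prod.ext hx.1 hx.2
      rw [this, map_zero]
      exact zero_mem _
    · rw [h]; trivial

lemma NestFamily.nestIso_gap_of_atomless [TopologicalSpace.SeparableSpace H] (hp : NestFamily p)
    {i j : ι} (hij : i ≤ j) (h : ∀ k l, i ≤ k → l ≤ j → ¬k ⋖ l) :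
    NestIso (traceFamily (gap p i j) p)
      (fun k => (traceFamily (gap p i j) p k).prod (traceFamily (gap p i j) p k)) := by
  have := hp.completeSpace_gap i j
  have hE := hp.trace (gap p i j) (hp.starProjection_gap_mem hij)
  refine (hE.nestIso_prod (fun k l hkl => ?_) hE.mono hE.closed fun k l _ hkl => hkl).symm
  refine le_antisymm (hE.mono hkl.le) fun x hx => ?_
  rcases le_or_gt i k with h1 | h1
  · have h2 : j ≤ k := hkl.le_of_lt (not_le.1 fun h2 => h k l h1 h2 hkl)
    exact hp.mono h2 x.2.1
  · have h2 : l ≤ i := hkl.ge_of_gt h1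
    have : x = 0 := Subtype.ext (inner_self_eq_zero.1
      (Submodule.inner_right_of_mem_orthogonal (hp.mono h2 hx) x.2.2))
    rw [this]
    exact zero_mem _

end Gap

section Nest

variable {H : Type*} [NormedAddCommGroup H] [InnerProductSpace ℂ H]

lemma IsNest.exists_family.{u} {H : Type u} [NormedAddCommGroup H] [InnerProductSpace ℂ H]
    {𝒩 : Set (Submodule ℂ H)} (h𝒩 : IsNest 𝒩) :
    ∃ (ι : Type u) (_ : LinearOrder ι) (p : ι → Submodule ℂ H),
      (∀ i j, i < j ↔ p i < p j) ∧ Set.range p = 𝒩 ∧ NestFamily p := by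
  classical
  refine ⟨𝒩, h𝒩.chain.linearOrder, Subtype.val, fun M N => Iff.rfl, Subtype.range_coe, ?_⟩
  let := h𝒩.chain.linearOrder
  have himg : ∀ S : Set 𝒩, Subtype.val '' S ⊆ 𝒩 := by
    rintro S _ ⟨N, -, rfl⟩
    exact N.2
  refine ⟨fun N => h𝒩.closed _ N.2, fun _ _ h => h, ⟨⟨⊥, h𝒩.bot_mem⟩, rfl⟩,
    ⟨⟨⊤, h𝒩.top_mem⟩, rfl⟩, fun S hS => ?_, fun S hS => ?_⟩
  · refine ⟨⟨_, h𝒩.closure_sSup_mem _ (himg S) (hS.image _)⟩, ⟨fun N hN => ?_, fun N hN => ?_⟩, ?_⟩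
    · exact (le_sSup (Set.mem_image_of_mem _ hN)).trans (Submodule.le_topologicalClosure _)
    · refine Submodule.topologicalClosure_minimal _ (sSup_le ?_) (h𝒩.closed _ N.2)
      rintro _ ⟨M, hM, rfl⟩
      exact hN hM
    · exact Submodule.topologicalClosure_mono sSup_image'.le
  · refine ⟨⟨_, h𝒩.sInf_mem _ (himg S) (hS.image _)⟩, ⟨fun N hN => ?_, fun N hN => ?_⟩, ?_⟩
    · exact sInf_le (a := N.1) (Set.mem_image_of_mem Subtype.val hN)
    · refine le_sInf (a := N.1) ?_
      rintro _ ⟨M, hM, rfl⟩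
      exact hN hM
    · exact sInf_image'.ge

lemma NestFamily.gap_ne_bot [CompleteSpace H] {ι : Type*} [LinearOrder ι] {p : ι → Submodule ℂ H}
    (hp : NestFamily p) {i j : ι} (h : p i < p j) : gap p i j ≠ ⊥ := fun h0 => by
  have := hp.hasOrthogonalProjection
  refine h.not_ge fun x hx => ?_
  have h1 : x - (p i).starProjection x ∈ gap p i j :=
    ⟨sub_mem hx (h.le ((p i).starProjection_apply_mem x)),
      Submodule.sub_starProjection_mem_orthogonal _⟩
  rw [h0, Submodule.mem_bot, sub_eq_zero] at h1
  rw [h1]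
  exact (p i).starProjection_apply_mem x

end Nest

/-- **Theorem.**  For a nest `𝒩` on a separable complex Hilbert space the
following are equivalent: (i) for every `n ≥ 2`, every right-invertible row
over `T(𝒩)` together with a prescribed right inverse column extends to an
invertible matrix over `T(𝒩)` whose first row is the given row and whose
inverse has the given column as first column; (ii) every atom of `𝒩` is finite
dimensional and every non-empty interval of `𝒩` contains an atom. -/
theorem nestAlgebra_extend_with_column_iff
    {H : Type*} [NormedAddCommGroup H] [InnerProductSpace ℂ H]
    [CompleteSpace H] [TopologicalSpace.SeparableSpace H]
    {𝒩 : Set (Submodule ℂ H)} (h𝒩 : IsNest 𝒩) :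
    (∀ (n : ℕ) (hn : 2 ≤ n) (a c : Fin n → (H →L[ℂ] H)),
        (∀ i, a i ∈ nestAlg 𝒩) → (∀ i, c i ∈ nestAlg 𝒩) →
        ∑ i, a i * c i = 1 →
        ∃ W W' : Matrix (Fin n) (Fin n) (H →L[ℂ] H),
          (∀ i j, W i j ∈ nestAlg 𝒩) ∧ (∀ i j, W' i j ∈ nestAlg 𝒩) ∧
          W * W' = 1 ∧ W' * W = 1 ∧
          (∀ j, W ⟨0, by omega⟩ j = a j) ∧
          (∀ i, W' i ⟨0, by omega⟩ = c i)) ↔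
      ((∀ M ∈ 𝒩, ∀ N ∈ 𝒩, M < N → (∀ L ∈ 𝒩, ¬(M < L ∧ L < N)) →
          FiniteDimensional ℂ ↥(N ⊓ Mᗮ)) ∧
       (∀ M ∈ 𝒩, ∀ N ∈ 𝒩, M < N →
          ∃ M' ∈ 𝒩, ∃ N' ∈ 𝒩, M ≤ M' ∧ M' < N' ∧ N' ≤ N ∧
            ∀ L ∈ 𝒩, ¬(M' < L ∧ L < N'))) := by
  obtain ⟨ι, _, p, hlt, rfl, hp⟩ := h𝒩.exists_family
  have hle : ∀ i j, i ≤ j ↔ p i ≤ p j := fun i j =>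
    ⟨fun h => hp.mono h, fun h => not_lt.1 fun h' => ((hlt j i).1 h').not_ge h⟩
  simp only [nestAlg, Set.mem_ofPred_eq, Set.forall_mem_range, Set.exists_range_iff, ← hlt, ← hle]
  constructor
  · intro H1
    have hext : ∀ a c : Fin 2 → H →L[ℂ] H, (∀ k i, ∀ x ∈ p i, a k x ∈ p i) →
        (∀ k i, ∀ x ∈ p i, c k x ∈ p i) → ∑ k, a k * c k = 1 →
        ∃ W W' : Matrix (Fin 2) (Fin 2) (H →L[ℂ] H),
        (∀ k l i, ∀ x ∈ p i, W k l x ∈ p i) ∧ (∀ k l i, ∀ x ∈ p i, W' k l x ∈ p i) ∧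
        W * W' = 1 ∧ ∀ k, W' k 0 = c k := by
      intro a c ha hc hac
      obtain ⟨W, W', hW, hW', h1, -, -, h2⟩ := H1 2 le_rfl a c ha hc hac
      exact ⟨W, W', hW, hW', h1, h2⟩
    refine ⟨fun i j hij hL => ?_, fun i j hij => ?_⟩
    · by_contra hf
      have hcov : i ⋖ j := ⟨hij, fun k h1 h2 => hL k ⟨h1, h2⟩⟩
      exact hp.gap_ne_bot ((hlt i j).1 hij)
        (hp.gap_eq_bot hij.le (hp.nestIso_gap_of_covBy hcov hf) hext)
    · by_contra! hno
      refine hp.gap_ne_bot ((hlt i j).1 hij) (hp.gap_eq_bot hij.le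
        (hp.nestIso_gap_of_atomless hij.le fun k l hk hl hkl => ?_) hext)
      obtain ⟨m, h1, h2⟩ := hno k l hk hkl.lt hl
      exact hkl.2 h1 h2
  · rintro ⟨hfin, hsep⟩ n hn a c ha hc hac
    refine hp.exists_matrix (fun i j hij => hfin i j hij.lt fun k hk => hij.2 hk.1 hk.2)
      (fun i j hij => ?_) hn ⟨0, by omega⟩ a c ha hc hac
    obtain ⟨k, l, h1, h2, h3, h4⟩ := hsep i j hij
    exact ⟨k, l, h1, ⟨h2, fun m h5 h6 => h4 m ⟨h5, h6⟩⟩, h3, hp.gap_ne_bot ((hlt k l).1 h2)⟩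
end

section
/- Let (N_k)_{k≥0} give a nest 𝒩 of order type ω with finite-rank atoms of dimensions n_k on an infinite-dimensional separable complex Hilbert space H. If the sequence (n_k) is monotone increasing and liminf_{k→∞} n_k^{1/k} = 1, then rtsr(T(𝒩)) = ∞: for every n ≥ 1, the set Rg_n(T(𝒩)) is not dense in T(𝒩)^n. -/
/-- A nest of order type `ω` with finite-rank atoms on `H`, given by a strictly
increasing sequence of finite-dimensional subspaces starting at `{0}` with
dense union. -/
structure IsOmegaNest {H : Type*} [NormedAddCommGroup H] [InnerProductSpace ℂ H]
    (N : ℕ → Submodule ℂ H) : Prop where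
  strictMono : StrictMono N
  bot : N 0 = ⊥
  finiteDim : ∀ k, FiniteDimensional ℂ ↥(N k)
  dense : Dense (⋃ k, (N k : Set H))

/-- The nest algebra of the nest determined by the sequence `N`. -/
def seqNestAlg {H : Type*} [NormedAddCommGroup H] [InnerProductSpace ℂ H]
    (N : ℕ → Submodule ℂ H) : Set (H →L[ℂ] H) :=
  {T | ∀ k, ∀ x ∈ N k, T x ∈ N k}

/-- Density of the right-invertible `n`-tuples `Rg_n(S)` in `S^n`. -/
def RgDenseIn {A : Type*} [NormedRing A] (S : Set A) (n : ℕ) : Prop :=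
  ∀ a : Fin n → A, (∀ i, a i ∈ S) → ∀ ε : ℝ, 0 < ε →
    ∃ b c : Fin n → A, (∀ i, b i ∈ S) ∧ (∀ i, c i ∈ S) ∧
      (∀ i, ‖a i - b i‖ < ε) ∧ ∑ i, b i * c i = 1

/-- The dimension `n_k = dim N_k − dim N_{k−1}` of the `k`-th atom (`k ≥ 1`). -/
noncomputable def atomDim {H : Type*} [NormedAddCommGroup H] [InnerProductSpace ℂ H]
    (N : ℕ → Submodule ℂ H) (k : ℕ) : ℕ :=
  Module.finrank ℂ ↥(N k) - Module.finrank ℂ ↥(N (k - 1))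

open scoped InnerProductSpace

theorem exists_forall_le_ge_subexp
    {d : ℕ → ℕ} (hpos : ∀ k, 0 < d k) (hmono : Monotone d)
    (hlim : Filter.liminf (fun k : ℕ => (d (k - 1) : ℝ) ^ ((k : ℝ)⁻¹)) Filter.atTop = 1)
    {T : ℕ} (hT : 0 < T) (a : ℕ) : ∃ k, a ≤ k ∧ d (k + T) ≤ 2 * d k := by
  by_contra! hcon
  have hpow : ∀ j, 2 ^ j ≤ d (a + j * T) := by
    intro j
    induction j with
    | zero => simpa [Nat.one_le_iff_ne_zero] using (hpos a).ne'
    | succ j ih =>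
      have := hcon (a + j * T) (by omega)
      rw [show a + (j + 1) * T = a + j * T + T by ring, pow_succ]
      omega
  set r : ℝ := 2 ^ ((2 * T : ℝ)⁻¹) with hr
  have hr1 : 1 < r := Real.one_lt_rpow (by norm_num) (by positivity)
  have hev : ∀ᶠ k : ℕ in Filter.atTop, r ≤ (d (k - 1) : ℝ) ^ ((k : ℝ)⁻¹) := by
    filter_upwards [Filter.eventually_ge_atTop (2 * (a + 1 + T))] with k hk
    have hk0 : (0 : ℝ) < k := by
      have : 0 < k := by omega
      exact_mod_cast this
    set j := (k - 1 - a) / T with hj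
    have h1 : j * T ≤ k - 1 - a := Nat.div_mul_le_self _ _
    have h2 : k - 1 - a < (j + 1) * T := by
      rw [mul_comm]; exact Nat.lt_mul_div_succ _ hT
    have h3 : 2 ^ j ≤ d (k - 1) := (hpow j).trans (hmono (by omega))
    have h4 : k ≤ 2 * T * j := by
      have : (j + 1) * T = j * T + T := by ring
      have : 2 * T * j = 2 * (j * T) := by ring
      omega
    have h5 : ((2 : ℝ) ^ j) ≤ d (k - 1) := by exact_mod_cast h3
    have h4' : (k : ℝ) ≤ 2 * T * j := by exact_mod_cast h4
    have hT' : (0 : ℝ) < T := by exact_mod_cast hT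
    calc r ≤ (2 : ℝ) ^ ((j : ℝ) * (k : ℝ)⁻¹) := by
          apply Real.rpow_le_rpow_of_exponent_le (by norm_num)
          rw [← div_eq_mul_inv, inv_eq_one_div, div_le_div_iff₀ (by positivity) hk0]
          linarith
      _ = ((2 : ℝ) ^ j) ^ ((k : ℝ)⁻¹) := by
          rw [Real.rpow_mul (by norm_num), Real.rpow_natCast]
      _ ≤ _ := Real.rpow_le_rpow (by positivity) h5 (by positivity)
  rw [Filter.liminf_eq] at hlim
  by_cases hb : BddAbove {x : ℝ | ∀ᶠ k : ℕ in Filter.atTop, x ≤ (d (k - 1) : ℝ) ^ ((k : ℝ)⁻¹)}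
  · have := le_csSup hb hev
    linarith
  · rw [Real.sSup_of_not_bddAbove hb] at hlim
    norm_num at hlim

theorem HilbertBasis.exists_partial_shift {ι D H : Type*} [NormedAddCommGroup H]
    [InnerProductSpace ℂ H] [CompleteSpace H] (b : HilbertBasis ι ℂ H) {p q : D → ι}
    (hp : p.Injective) (hq : q.Injective) :
    ∃ R : H →L[ℂ] H, (∀ e, R (b (p e)) = b (q e)) ∧ ∀ i, i ∉ Set.range p → R (b i) = 0 := by
  classical
  let V := (b.orthonormal.comp p hp).orthogonalFamily.linearIsometry
  let W := (b.orthonormal.comp q hq).orthogonalFamily.linearIsometry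
  have hV : ∀ e, V (lp.single 2 e (1 : ℂ)) = b (p e) := fun e => by
    simp [V, OrthogonalFamily.linearIsometry_apply_single]
  have hW : ∀ e, W (lp.single 2 e (1 : ℂ)) = b (q e) := fun e => by
    simp [W, OrthogonalFamily.linearIsometry_apply_single]
  refine ⟨W.toContinuousLinearMap ∘L V.toContinuousLinearMap.adjoint, fun e => ?_, fun i hi => ?_⟩
  · have : V.toContinuousLinearMap.adjoint (V (lp.single 2 e (1 : ℂ)))
        = lp.single 2 e (1 : ℂ) := by
      have h := V.adjoint_comp_self
      exact congrArg (fun f => f (lp.single 2 e (1 : ℂ))) h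
    rw [ContinuousLinearMap.comp_apply, ← hV, this]
    exact hW e
  · have : V.toContinuousLinearMap.adjoint (b i) = 0 := by
      ext e
      have h : ⟪lp.single 2 e (1 : ℂ), V.toContinuousLinearMap.adjoint (b i)⟫_ℂ = 0 := by
        rw [ContinuousLinearMap.adjoint_inner_right]
        change ⟪V (lp.single 2 e (1 : ℂ)), b i⟫_ℂ = 0
        rw [hV]
        exact b.orthonormal.2 fun h => hi ⟨e, h⟩
      rw [lp.inner_single_left] at h
      simpa using h
    rw [ContinuousLinearMap.comp_apply, this, map_zero]

theorem IsOmegaNest.exists_hilbertBasis {H : Type*} [NormedAddCommGroup H]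
    [InnerProductSpace ℂ H] [CompleteSpace H] {N : ℕ → Submodule ℂ H} (hN : IsOmegaNest N) :
    ∃ b : HilbertBasis (Σ k, Fin (atomDim N (k + 1))) ℂ H,
      ∀ k x, x ∈ N k ↔ ∀ i : Σ k, Fin (atomDim N (k + 1)), k ≤ i.1 → ⟪b i, x⟫_ℂ = 0 := by
  have := hN.finiteDim
  let V : ℕ → Submodule ℂ H := fun k => (N k)ᗮ ⊓ N (k + 1)
  have hle : ∀ k, N k ≤ N (k + 1) := fun k => hN.strictMono.monotone (Nat.le_succ k)
  have hVle : ∀ {i k}, i < k → V i ≤ N k := fun h =>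
    inf_le_right.trans (hN.strictMono.monotone h)
  have hVperp : ∀ {i k}, k ≤ i → V i ≤ (N k)ᗮ := fun h =>
    inf_le_left.trans (Submodule.orthogonal_le (hN.strictMono.monotone h))
  have : ∀ k, FiniteDimensional ℂ (V k) := fun k =>
    Submodule.finiteDimensional_of_le (inf_le_right : V k ≤ N (k + 1))
  have hrank : ∀ k, Module.finrank ℂ (V k) = atomDim N (k + 1) := fun k => by
    have := Submodule.finrank_add_inf_finrank_orthogonal (hle k)
    have h : atomDim N (k + 1) = Module.finrank ℂ (N (k + 1)) - Module.finrank ℂ (N k) := rfl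
    rw [h, ← this, Nat.add_sub_cancel_left]
  have hV : OrthogonalFamily ℂ (fun k => V k) fun k => (V k).subtypeₗᵢ := by
    refine OrthogonalFamily.of_pairwise fun i j hij => ?_
    rcases lt_or_gt_of_ne hij with h | h
    · exact (Submodule.isOrtho_orthogonal_right (N j)).mono (hVle h) (hVperp le_rfl)
    · exact (Submodule.isOrtho_orthogonal_left (N i)).mono (hVperp le_rfl) (hVle h)
  let f : ∀ k, OrthonormalBasis (Fin (atomDim N (k + 1))) ℂ (V k) := fun k =>
    (stdOrthonormalBasis ℂ (V k)).reindex (finCongr (hrank k))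
  have hon : Orthonormal ℂ fun i : Σ k, Fin (atomDim N (k + 1)) => (f i.1 i.2 : H) :=
    hV.orthonormal_sigma_orthonormal fun k => (f k).orthonormal
  have hNspan : ∀ k, N k ≤ Submodule.span ℂ
      (Set.range fun i : Σ k, Fin (atomDim N (k + 1)) => (f i.1 i.2 : H)) := by
    intro k
    induction k with
    | zero => rw [hN.bot]; exact bot_le
    | succ k ih =>
      rw [← Submodule.sup_orthogonal_inf_of_hasOrthogonalProjection (hle k)]
      refine sup_le ih fun x hx => ?_
      have hsum := congrArg (Subtype.val) ((f k).sum_repr ⟨x, hx⟩)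
      simp only [Submodule.coe_sum, Submodule.coe_smul] at hsum
      rw [← hsum]
      exact Submodule.sum_mem _ fun i _ => Submodule.smul_mem _ _
        (Submodule.subset_span ⟨⟨k, i⟩, rfl⟩)
  let b := HilbertBasis.mk hon (by
    intro x _
    rw [← SetLike.mem_coe, Submodule.topologicalClosure_coe]
    exact closure_mono (Set.iUnion_subset fun k => hNspan k) (hN.dense x))
  have hb : ∀ i, b i = (f i.1 i.2 : H) := fun i => by simp [b]
  have hperp : ∀ k x, x ∈ N k → ∀ i : Σ k, Fin (atomDim N (k + 1)), k ≤ i.1 →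
      ⟪b i, x⟫_ℂ = 0 := fun k x hx i hi => by
    rw [hb]
    exact Submodule.inner_left_of_mem_orthogonal hx (hVperp hi (f i.1 i.2).2)
  refine ⟨b, fun k x => ⟨hperp k x, fun h => ?_⟩⟩
  have hz : x - (N k).starProjection x = 0 := by
    apply b.repr.injective
    ext i
    rw [b.repr_apply_apply, map_zero, lp.coeFn_zero, Pi.zero_apply]
    rcases lt_or_ge i.1 k with hi | hi
    · rw [hb]
      exact Submodule.inner_right_of_mem_orthogonal (hVle hi (f i.1 i.2).2)
        (Submodule.sub_starProjection_mem_orthogonal x)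
    · rw [inner_sub_right, h i hi, hperp k _ (Submodule.starProjection_apply_mem _ x) i hi,
        sub_zero]
  rw [sub_eq_zero] at hz
  rw [hz]
  exact Submodule.starProjection_apply_mem _ x

/-- A sequence of disjoint blocks of levels, the `L`-th of which splits into `L + 2` windows of
geometrically growing length, carries an injective downward-shifting partial map. -/
theorem exists_window_shift {d : ℕ → ℕ} (hpos : ∀ k, 0 < d k) (hmono : Monotone d)
    (hgrow : ∀ T, 0 < T → ∀ a, ∃ k, a ≤ k ∧ d (k + T) ≤ 2 * d k) {n : ℕ} (hn : 1 ≤ n) :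
    ∃ (D : Type) (φ : Fin n × D → Σ k, Fin (d k)) (q : D → Σ k, Fin (d k)),
      φ.Injective ∧ q.Injective ∧ (∀ t e, (φ (t, e)).1 ≤ (q e).1) ∧
      ∀ L, ∃ c : ℕ → ℕ, (∀ j, c (j + 1) ≤ c j) ∧
        (∃ i : Σ k, Fin (d k), c 1 ≤ i.1 ∧ i.1 < c 0 ∧ i ∉ Set.range φ) ∧
        ∀ j < L, ∀ i : Σ k, Fin (d k), c (j + 1) ≤ i.1 → i.1 < c 0 →
          ∃ e, q e = i ∧ ∀ t, c (j + 2) ≤ (φ (t, e)).1 ∧ (φ (t, e)).1 < c 0 := by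
  set m := 2 * n with hm
  have hm2 : 2 ≤ m := by omega
  have hmpos : ∀ j, 0 < m ^ j := fun j => by positivity
  have hmlt : ∀ {i j}, i < j → m ^ i < m ^ j := fun h => Nat.pow_lt_pow_right (by omega) h
  have hmle : ∀ {i j}, i ≤ j → m ^ i ≤ m ^ j := fun h => Nat.pow_le_pow_right (by omega) h
  choose g hg1 hg2 using fun L => hgrow (m ^ (L + 1)) (hmpos _)
  let s : ℕ → ℕ := fun L => Nat.rec (g 0 0) (fun L sL => g (L + 1) (sL + m ^ (L + 1))) L
  have hs1 : ∀ L, s L + m ^ (L + 1) ≤ s (L + 1) := fun L => hg1 _ _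
  have hs2 : ∀ L, d (s L + m ^ (L + 1)) ≤ 2 * d (s L) := fun L => by
    cases L <;> exact hg2 _ _
  have hsmono : Monotone s := monotone_nat_of_le_succ fun L => by have := hs1 L; omega
  have hslt : ∀ {L L'}, L < L' → s L + m ^ (L + 1) ≤ s L' := fun h =>
    (hs1 _).trans (hsmono h)
  let c : ℕ → ℕ → ℕ := fun L j => s L + (m ^ (L + 1) - m ^ j)
  have hcanti : ∀ L, Antitone (c L) := fun L i j hij => by
    have := hmle hij
    simp only [c]; omega
  let W : ℕ → ℕ → Finset (Σ k, Fin (d k)) := fun L j =>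
    (Finset.Ico (c L (j + 1)) (c L j)).sigma fun _ => Finset.univ
  have hW : ∀ L j i, i ∈ W L j ↔ c L (j + 1) ≤ i.1 ∧ i.1 < c L j := fun L j i => by
    simp [W]
  have hcard : ∀ L j, (W L j).card = ∑ k ∈ Finset.Ico (c L (j + 1)) (c L j), d k := fun L j => by
    simp [W, Finset.card_sigma]
  have hlen : ∀ L j, j ≤ L → c L j - c L (j + 1) = m ^ j * (m - 1) := fun L j hj => by
    have h1 := hmlt (Nat.lt_succ_self j)
    have h2 := hmle (Nat.succ_le_succ hj)
    rw [Nat.mul_sub, mul_one, ← pow_succ]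
    simp only [c]; simp only [Nat.succ_eq_add_one] at *; omega
  have hWcard : ∀ L j, j < L → n * (W L j).card ≤ (W L (j + 1)).card := by
    intro L j hj
    have h1 : (W L j).card ≤ m ^ j * (m - 1) * d (s L + m ^ (L + 1)) := by
      rw [hcard, ← hlen L j hj.le, ← Nat.card_Ico, ← smul_eq_mul]
      refine Finset.sum_le_card_nsmul _ _ _ fun k hk => hmono ?_
      rw [Finset.mem_Ico] at hk
      simp only [c] at hk; omega
    have h2 : m ^ (j + 1) * (m - 1) * d (s L) ≤ (W L (j + 1)).card := by
      rw [hcard, ← hlen L (j + 1) hj, ← Nat.card_Ico, ← smul_eq_mul]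
      refine Finset.card_nsmul_le_sum _ _ _ fun k hk => hmono ?_
      rw [Finset.mem_Ico] at hk
      simp only [c] at hk; omega
    calc n * (W L j).card ≤ n * (m ^ j * (m - 1) * (2 * d (s L))) := by
          gcongr; exact h1.trans (by gcongr; exact hs2 L)
      _ = m ^ (j + 1) * (m - 1) * d (s L) := by rw [pow_succ, hm]; ring
      _ ≤ _ := h2
  have hemb : ∀ L (j : Fin L), Nonempty (Fin n × W L j ↪ W L (j + 1)) := fun L j =>
    Function.Embedding.nonempty_of_card_le (by simpa using hWcard L j j.2)
  let emb := fun L j => (hemb L j).some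
  have hdisj : ∀ {L j L' j'} {i}, j ≤ L → j' ≤ L' → i ∈ W L j → i ∈ W L' j' →
      L = L' ∧ j = j' := by
    intro L j L' j' i hj hj' h h'
    rw [hW] at h h'
    have e1 : c L j ≤ s L + m ^ (L + 1) := by simp only [c]; omega
    have e2 : c L' j' ≤ s L' + m ^ (L' + 1) := by simp only [c]; omega
    have e3 : s L ≤ c L (j + 1) := Nat.le_add_right _ _
    have e4 : s L' ≤ c L' (j' + 1) := Nat.le_add_right _ _
    have hL : L = L' := by
      rcases lt_trichotomy L L' with hl | hl | hl
      · have := hslt hl; omega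
      · exact hl
      · have := hslt hl; omega
    subst hL
    refine ⟨rfl, ?_⟩
    rcases lt_trichotomy j j' with hl | hl | hl
    · have := hcanti L (Nat.succ_le_of_lt hl); simp only [Nat.succ_eq_add_one] at this; omega
    · exact hl
    · have := hcanti L (Nat.succ_le_of_lt hl); simp only [Nat.succ_eq_add_one] at this; omega
  let φ : Fin n × (Σ L, Σ j : Fin L, W L j) → Σ k, Fin (d k) := fun e =>
    (emb e.2.1 e.2.2.1 (e.1, e.2.2.2)).1
  have hφ : ∀ t L (j : Fin L) (i : W L j), φ (t, ⟨L, j, i⟩) ∈ W L (j + 1) := fun t L j i =>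
    (emb L j (t, i)).2
  refine ⟨Σ L, Σ j : Fin L, W L j, φ, fun e => e.2.2.1, ?_, ?_, ?_, fun L => ?_⟩
  · rintro ⟨t, L, j, i⟩ ⟨t', L', j', i'⟩ h
    have hmem := hφ t L j i
    rw [h] at hmem
    obtain ⟨hL, hj⟩ := hdisj j.2 j'.2 hmem (hφ t' L' j' i')
    subst hL
    obtain rfl : j = j' := Fin.ext (by omega)
    have := (emb L j).injective (Subtype.ext h)
    simp only [Prod.mk.injEq] at this
    rw [this.1, this.2]
  · rintro ⟨L, j, i⟩ ⟨L', j', i'⟩ h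
    have h : i.1 = i'.1 := h
    have hmem := i.2
    rw [h] at hmem
    obtain ⟨hL, hj⟩ := hdisj j.2.le j'.2.le hmem i'.2
    subst hL
    obtain rfl : j = j' := Fin.ext hj
    rw [Subtype.ext h]
  · rintro t ⟨L, j, i⟩
    have h1 := (hW _ _ _).1 (hφ t L j i)
    have h2 := (hW _ _ _).1 i.2
    exact h1.2.le.trans h2.1
  · refine ⟨c L, fun j => hcanti L (Nat.le_succ j), ⟨⟨c L 1, ⟨0, hpos _⟩⟩, le_rfl, ?_, ?_⟩, ?_⟩
    · have := hlen L 0 (Nat.zero_le _)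
      simp only [pow_zero, one_mul, zero_add] at this
      change c L 1 < c L 0
      omega
    · rintro ⟨⟨t, L', j, i⟩, h⟩
      have hmem := hφ t L' j i
      rw [h] at hmem
      have h0 : (⟨c L 1, ⟨0, hpos _⟩⟩ : Σ k, Fin (d k)) ∈ W L 0 := by
        rw [hW]
        refine ⟨le_rfl, ?_⟩
        have := hlen L 0 (Nat.zero_le _)
        simp only [pow_zero, one_mul, zero_add] at this
        change c L 1 < c L 0
        omega
      have := (hdisj (Nat.zero_le _) j.2 h0 hmem).2
      omega
    · intro j hj i hi1 hi2
      have : ∃ l ≤ j, i ∈ W L l := by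
        induction j with
        | zero => exact ⟨0, le_rfl, (hW _ _ _).2 ⟨hi1, hi2⟩⟩
        | succ j ih =>
          rcases lt_or_ge i.1 (c L (j + 1)) with h | h
          · exact ⟨j + 1, le_rfl, (hW _ _ _).2 ⟨hi1, h⟩⟩
          · obtain ⟨l, hl, hil⟩ := ih (by omega) h
            exact ⟨l, by omega, hil⟩
      obtain ⟨l, hl, hil⟩ := this
      refine ⟨⟨L, ⟨l, by omega⟩, ⟨i, hil⟩⟩, rfl, fun t => ?_⟩
      have h1 := (hW _ _ _).1 (hφ t L ⟨l, by omega⟩ ⟨i, hil⟩)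
      exact ⟨(hcanti L (show l + 2 ≤ j + 2 by omega)).trans h1.1,
        h1.2.trans_le (hcanti L (Nat.zero_le _))⟩

/-- A triangular right inverse `C` of a triangular row `B` close to the adjoints of the shifts `R`
has mass at least one in each of the windows cut out by `c`. -/
theorem le_sum_norm_sq_of_shift {H D : Type*} [NormedAddCommGroup H] [InnerProductSpace ℂ H]
    [CompleteSpace H] {N : ℕ → Submodule ℂ H} {d : ℕ → ℕ}
    (b : HilbertBasis (Σ k, Fin (d k)) ℂ H)
    (hb : ∀ k x, x ∈ N k ↔ ∀ i : Σ k, Fin (d k), k ≤ i.1 → ⟪b i, x⟫_ℂ = 0)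
    {n : ℕ} (hn : 1 ≤ n) {φ : Fin n × D → Σ k, Fin (d k)} {q : D → Σ k, Fin (d k)}
    (hφ : φ.Injective) {R : Fin n → H →L[ℂ] H}
    (hR : ∀ t e, R t (b (φ (t, e))) = b (q e))
    (hR0 : ∀ t i, i ∉ Set.range (fun e => φ (t, e)) → R t (b i) = 0)
    {B C : Fin n → H →L[ℂ] H} (hB : ∀ t, B t ∈ seqNestAlg N) (hC : ∀ t, C t ∈ seqNestAlg N)
    (hA : ∀ t, ContinuousLinearMap.adjoint (R t) ∈ seqNestAlg N)
    (hclose : ∀ t, ‖ContinuousLinearMap.adjoint (R t) - B t‖ < (n : ℝ)⁻¹)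
    (hBC : ∑ t, B t * C t = 1) {L : ℕ} {c : ℕ → ℕ} (hc : ∀ j, c (j + 1) ≤ c j)
    {i₀ : Σ k, Fin (d k)} (hi₀ : c 1 ≤ i₀.1) (hi₀' : i₀.1 < c 0) (hi₀φ : i₀ ∉ Set.range φ)
    (hstep : ∀ j < L, ∀ i : Σ k, Fin (d k), c (j + 1) ≤ i.1 → i.1 < c 0 →
      ∃ e, q e = i ∧ ∀ t, c (j + 2) ≤ (φ (t, e)).1 ∧ (φ (t, e)).1 < c 0) :
    (L : ℝ) ≤ ∑ t, ‖C t‖ ^ 2 := by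
  classical
  let v : Fin n → H := fun t => C t (b i₀)
  let G : Fin n → H →L[ℂ] H := fun t => ContinuousLinearMap.adjoint (R t) - B t
  let g : H := ∑ t, G t (v t)
  let F : ℕ → Finset (Σ k, Fin (d k)) := fun j =>
    (Finset.Ico (c (j + 1)) (c 0)).sigma fun _ => Finset.univ
  have hF : ∀ j i, i ∈ F j ↔ c (j + 1) ≤ i.1 ∧ i.1 < c 0 := fun j i => by simp [F]
  have hcanti : Antitone c := antitone_nat_of_succ_le hc
  let S : ℕ → ℝ := fun j => ∑ t, ∑ i ∈ F j, ‖⟪b i, v t⟫_ℂ‖ ^ 2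
  have hv : ∀ t, v t ∈ N (c 0) := fun t => hC t _ _ <| (hb _ _).2 fun i hi =>
    b.orthonormal.2 fun h => by rw [h] at hi; omega
  have hG : ∀ t, G t ∈ seqNestAlg N := fun t k x hx =>
    Submodule.sub_mem _ (hA t k x hx) (hB t k x hx)
  have hg : g = ∑ t, ContinuousLinearMap.adjoint (R t) (v t) - b i₀ := by
    have h := congrArg (fun f : H →L[ℂ] H => f (b i₀)) hBC
    simp only [sum_apply, one_apply_eq_self] at h
    rw [← h]
    simp [g, G, v, Finset.sum_sub_distrib]
  have hginner : ∀ i, ⟪b i, g⟫_ℂ = ∑ t, ⟪R t (b i), v t⟫_ℂ - ⟪b i, b i₀⟫_ℂ := fun i => by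
    rw [hg, inner_sub_right, inner_sum]
    simp only [ContinuousLinearMap.adjoint_inner_right]
  have hg0 : ⟪b i₀, g⟫_ℂ = -1 := by
    rw [hginner, Finset.sum_eq_zero, zero_sub, inner_self_eq_norm_sq_to_K, b.orthonormal.1]
    · simp
    · intro t _
      rw [hR0 t i₀ fun ⟨e, he⟩ => hi₀φ ⟨(t, e), he⟩, inner_zero_left]
  have hgφ : ∀ t e, ⟪b (φ (t, e)), g⟫_ℂ = ⟪b (q e), v t⟫_ℂ := fun t e => by
    rw [hginner, b.orthonormal.2 fun h => hi₀φ ⟨_, h⟩, sub_zero, Finset.sum_eq_single t, hR]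
    · intro s _ hs
      rw [hR0 s _ fun ⟨e', he'⟩ => hs (congrArg Prod.fst (hφ he')), inner_zero_left]
    · simp
  have hupper : ∀ j, ∑ i ∈ F j, ‖⟪b i, g⟫_ℂ‖ ^ 2 ≤ S j := by
    intro j
    let w : Fin n → H := fun t => ∑ i ∈ F j, ⟪b i, v t⟫_ℂ • b i
    have hw : ∀ t, ‖w t‖ ^ 2 = ∑ i ∈ F j, ‖⟪b i, v t⟫_ℂ‖ ^ 2 := fun t => by
      rw [← inner_self_eq_norm_sq (𝕜 := ℂ), b.orthonormal.inner_sum, map_sum]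
      refine Finset.sum_congr rfl fun i _ => ?_
      rw [RCLike.conj_mul, ← RCLike.ofReal_pow, RCLike.ofReal_re]
    have hrest : ∀ t, v t - w t ∈ N (c (j + 1)) := fun t => (hb _ _).2 fun i hi => by
      rw [inner_sub_right]
      by_cases h : i.1 < c 0
      · rw [b.orthonormal.inner_right_sum _ ((hF j i).2 ⟨hi, h⟩), sub_self]
      · rw [(hb _ _).1 (hv t) i (not_lt.1 h), inner_sum, Finset.sum_eq_zero, sub_zero]
        intro i' hi'
        rw [inner_smul_right, b.orthonormal.2, mul_zero]
        rintro rfl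
        exact h ((hF _ _).1 hi').2
    have hgw : ∀ i ∈ F j, ⟪b i, g⟫_ℂ = ⟪b i, ∑ t, G t (w t)⟫_ℂ := fun i hi => by
      rw [← sub_eq_zero, ← inner_sub_right, ← Finset.sum_sub_distrib, inner_sum]
      refine Finset.sum_eq_zero fun t _ => ?_
      rw [← map_sub]
      exact (hb _ _).1 (hG t _ _ (hrest t)) i ((hF _ _).1 hi).1
    have hn0 : (0 : ℝ) < n := by exact_mod_cast hn
    have hn1 : (n : ℝ)⁻¹ ≤ 1 := inv_le_one_of_one_le₀ (by exact_mod_cast hn)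
    calc ∑ i ∈ F j, ‖⟪b i, g⟫_ℂ‖ ^ 2 = ∑ i ∈ F j, ‖⟪b i, ∑ t, G t (w t)⟫_ℂ‖ ^ 2 :=
          Finset.sum_congr rfl fun i hi => by rw [hgw i hi]
      _ ≤ ‖∑ t, G t (w t)‖ ^ 2 := b.orthonormal.sum_inner_products_le _
      _ ≤ (∑ t, (n : ℝ)⁻¹ * ‖w t‖) ^ 2 := by
          gcongr
          refine (norm_sum_le _ _).trans (Finset.sum_le_sum fun t _ => ?_)
          exact (G t).le_of_opNorm_le (hclose t).le _
      _ ≤ n * ∑ t, ((n : ℝ)⁻¹ * ‖w t‖) ^ 2 := by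
          simpa using sq_sum_le_card_mul_sum_sq (s := Finset.univ)
            (f := fun t => (n : ℝ)⁻¹ * ‖w t‖)
      _ = (n : ℝ)⁻¹ * ∑ t, ‖w t‖ ^ 2 := by
          simp_rw [mul_pow, ← Finset.mul_sum]
          field_simp
      _ ≤ ∑ t, ‖w t‖ ^ 2 := mul_le_of_le_one_left (by positivity) hn1
      _ = S j := Finset.sum_congr rfl fun t _ => hw t
  have hlower : ∀ j < L, 1 + S j ≤ ∑ i ∈ F (j + 1), ‖⟪b i, g⟫_ℂ‖ ^ 2 := by
    intro j hj
    obtain ⟨e₀, -⟩ := hstep j hj i₀ ((hcanti (by omega)).trans hi₀) hi₀'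
    have : Nonempty D := ⟨e₀⟩
    choose! e he hmem using hstep j hj
    have hi₀F : i₀ ∈ F (j + 1) := (hF _ _).2 ⟨(hcanti (by omega)).trans hi₀, hi₀'⟩
    rw [← Finset.add_sum_erase _ _ hi₀F, hg0, norm_neg, norm_one, one_pow]
    gcongr
    have hinj : Set.InjOn (fun p : Fin n × Σ k, Fin (d k) => φ (p.1, e p.2))
        (Finset.univ ×ˢ F j : Finset (Fin n × Σ k, Fin (d k))) := by
      rintro ⟨t, i⟩ hi ⟨t', i'⟩ hi' h
      have hi := (hF _ _).1 (Finset.mem_product.1 hi).2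
      have hi' := (hF _ _).1 (Finset.mem_product.1 hi').2
      have := hφ h
      simp only [Prod.mk.injEq] at this
      rw [this.1, ← he i hi.1 hi.2, ← he i' hi'.1 hi'.2, this.2]
    calc S j = ∑ p ∈ Finset.univ ×ˢ F j, ‖⟪b (φ (p.1, e p.2)), g⟫_ℂ‖ ^ 2 := by
          rw [Finset.sum_product]
          refine Finset.sum_congr rfl fun t _ => Finset.sum_congr rfl fun i hi => ?_
          have hi := (hF _ _).1 hi
          rw [hgφ, he i hi.1 hi.2]
      _ = ∑ i ∈ (Finset.univ ×ˢ F j).image fun p => φ (p.1, e p.2), ‖⟪b i, g⟫_ℂ‖ ^ 2 :=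
          (Finset.sum_image (f := fun i => ‖⟪b i, g⟫_ℂ‖ ^ 2) hinj).symm
      _ ≤ _ := by
          refine Finset.sum_le_sum_of_subset_of_nonneg ?_ fun _ _ _ => by positivity
          intro i hi
          obtain ⟨⟨t, i'⟩, hi', rfl⟩ := Finset.mem_image.1 hi
          have hi' := (hF _ _).1 (Finset.mem_product.1 hi').2
          exact Finset.mem_erase.2 ⟨fun h => hi₀φ ⟨_, h⟩, (hF _ _).2 (hmem i' hi'.1 hi'.2 t)⟩
  have hgrow : ∀ j ≤ L, (j : ℝ) ≤ S j := by
    intro j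
    induction j with
    | zero => intro _; simp only [Nat.cast_zero, S]; positivity
    | succ j ih =>
      intro hj
      have := ih (by omega)
      have := (hlower j hj).trans (hupper (j + 1))
      push_cast
      linarith
  refine (hgrow L le_rfl).trans (Finset.sum_le_sum fun t _ => ?_)
  refine (b.orthonormal.sum_inner_products_le (v t)).trans ?_
  gcongr
  simpa [v, b.orthonormal.1] using (C t).le_opNorm (b i₀)

/-- **Corollary (subexponential growth).**  If the atom dimensions `n_k` of a
nest of order type `ω` are monotone increasing and
`liminf_{k→∞} n_k^{1/k} = 1`, then `rtsr(T(𝒩)) = ∞`. -/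
theorem rtsr_eq_infty_of_subexponential_growth
    {H : Type*} [NormedAddCommGroup H] [InnerProductSpace ℂ H]
    [CompleteSpace H] [TopologicalSpace.SeparableSpace H]
    (hinf : ¬ FiniteDimensional ℂ H)
    {N : ℕ → Submodule ℂ H} (hN : IsOmegaNest N)
    (hmono : ∀ k, 1 ≤ k → atomDim N k ≤ atomDim N (k + 1))
    (hliminf :
      Filter.liminf (fun k : ℕ => (atomDim N k : ℝ) ^ ((k : ℝ)⁻¹)) Filter.atTop = 1) :
    ∀ n : ℕ, 1 ≤ n → ¬ RgDenseIn (seqNestAlg N) n := by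
  classical
  intro n hn hdense
  have hpos : ∀ k, 0 < atomDim N (k + 1) := fun k => by
    have := hN.finiteDim (k + 1)
    exact Nat.sub_pos_of_lt (Submodule.finrank_lt_finrank_of_lt (hN.strictMono (Nat.lt_succ_self k)))
  have hmono' : Monotone fun k => atomDim N (k + 1) :=
    monotone_nat_of_le_succ fun k => hmono (k + 1) (by omega)
  have hlim : Filter.liminf (fun k : ℕ => (atomDim N (k - 1 + 1) : ℝ) ^ ((k : ℝ)⁻¹))
      Filter.atTop = 1 := by
    rw [← hliminf]
    congr 1
    funext k
    cases k <;> simp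
  obtain ⟨b, hb⟩ := hN.exists_hilbertBasis
  obtain ⟨D, φ, q, hφ, hq, hlev, hwin⟩ := exists_window_shift hpos hmono'
    (fun T hT a => exists_forall_le_ge_subexp hpos hmono' hlim hT a) hn
  have hφt : ∀ t, Function.Injective fun e => φ (t, e) := fun t e e' h => by
    simpa using hφ h
  choose R hR hR0 using fun t => b.exists_partial_shift (hφt t) hq
  have hAmem : ∀ t, ContinuousLinearMap.adjoint (R t) ∈ seqNestAlg N := by
    intro t k x hx
    rw [hb] at hx ⊢
    intro i hi
    rw [ContinuousLinearMap.adjoint_inner_right]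
    by_cases h : i ∈ Set.range fun e => φ (t, e)
    · obtain ⟨e, rfl⟩ := h
      rw [hR]
      exact hx _ (hi.trans (hlev t e))
    · rw [hR0 t i h, inner_zero_left]
  have hn0 : (0 : ℝ) < n := by exact_mod_cast hn
  obtain ⟨B, C, hB, hC, hclose, hBC⟩ := hdense _ hAmem (n : ℝ)⁻¹ (by positivity)
  obtain ⟨L, hL⟩ := exists_nat_gt (∑ t, ‖C t‖ ^ 2)
  obtain ⟨c, hc, ⟨i₀, hi₀, hi₀', hi₀φ⟩, hstep⟩ := hwin L
  refine absurd hL (not_lt.2 ?_)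
  exact le_sum_norm_sq_of_shift b hb hn hφ hR hR0 hB hC hAmem hclose hBC hc hi₀ hi₀' hi₀φ hstep
end
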